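/- arXiv:1405.1738 — 3 statements merged into one kernel-verified Lean document; each statement's English description precedes it below -/
import Mathlib

section
/- The degree of the map W_α : P^p × P^q → P^{p+q} defined by (P,Q) ↦ z(P'Q - PQ') + αPQ, for α ∈ (0,1), equals the binomial coefficient C(p+q, p). -/
open Polynomial

section FiniteMaps

variable {σ τ : Type*}

/-- The polynomial map of affine spaces whose components are the polynomials `r k`. -/
noncomputable def polyMap (r : τ → MvPolynomial σ ℂ) (x : σ → ℂ) : τ → ℂ :=
  fun k => MvPolynomial.eval x (r k)

/-- The point `x` is a regular point of `polyMap r`: the differential there is injective. -/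
def IsRegularPoint [Fintype σ] (r : τ → MvPolynomial σ ℂ) (x : σ → ℂ) : Prop :=
  ∀ v : σ → ℂ, (∀ k, ∑ s, v s * MvPolynomial.eval x (MvPolynomial.pderiv s (r k)) = 0) → v = 0

theorem hasStrictFDerivAt_mvPolynomial_eval [Fintype σ] (f : MvPolynomial σ ℂ) (x : σ → ℂ) :
    HasStrictFDerivAt (fun y => MvPolynomial.eval y f)
      (∑ s, MvPolynomial.eval x (MvPolynomial.pderiv s f) •
        (ContinuousLinearMap.proj s : (σ → ℂ) →L[ℂ] ℂ)) x := by
  classical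
  induction f using MvPolynomial.induction_on with
  | C a =>
    simp only [MvPolynomial.eval_C]
    convert! hasStrictFDerivAt_const (𝕜 := ℂ) a x using 1
    ext v
    simp
  | add f g hf hg =>
    simp only [map_add]
    convert! hf.add hg using 1
    ext v
    simp [add_mul, Finset.sum_add_distrib]
  | mul_X f t hf =>
    have ht : HasStrictFDerivAt (fun y : σ → ℂ => y t)
        (ContinuousLinearMap.proj t : (σ → ℂ) →L[ℂ] ℂ) x :=
      (ContinuousLinearMap.proj t : (σ → ℂ) →L[ℂ] ℂ).hasStrictFDerivAt
    have h := hf.mul ht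
    simp only [map_mul, MvPolynomial.eval_X]
    convert! h using 1
    ext v
    simp [MvPolynomial.pderiv_X, Pi.single_apply, Finset.sum_add_distrib, add_mul,
      apply_ite, Finset.mul_sum]
    simp only [mul_assoc]

theorem eval_polyMap (r : τ → MvPolynomial σ ℂ) (x : σ → ℂ) (g : MvPolynomial τ ℂ) :
    MvPolynomial.eval (polyMap r x) g = MvPolynomial.eval x (MvPolynomial.aeval r g) := by
  rw [← MvPolynomial.coe_aeval_eq_eval, ← MvPolynomial.coe_aeval_eq_eval]
  change _ = ((MvPolynomial.aeval x).comp (MvPolynomial.aeval r)) g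
  rw [MvPolynomial.comp_aeval]
  rfl

theorem continuous_polyMap (r : τ → MvPolynomial σ ℂ) : Continuous (polyMap r) :=
  continuous_pi fun k => MvPolynomial.continuous_eval (r k)

/-- A finite polynomial map is proper in the Euclidean topology. -/
theorem isProperMap_polyMap [Fintype σ] [Fintype τ] (r : τ → MvPolynomial σ ℂ)
    (hr : (MvPolynomial.aeval r : MvPolynomial τ ℂ →ₐ[ℂ] MvPolynomial σ ℂ).toRingHom.IsIntegral) :
    IsProperMap (polyMap r) := by
  rw [isProperMap_iff_isCompact_preimage]
  refine ⟨continuous_polyMap r, fun K hK => ?_⟩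
  refine Metric.isCompact_of_isClosed_isBounded
    (hK.isClosed.preimage (continuous_polyMap r)) ?_
  choose m hm hm0 using fun s : σ => hr (MvPolynomial.X s)
  have hbd : ∀ s, ∃ M : ℝ, ∀ y ∈ K, ∀ i ∈ Finset.range (m s).natDegree,
      ‖MvPolynomial.eval y ((m s).coeff i)‖ ≤ M := by
    intro s
    choose M hM using fun i => hK.exists_bound_of_continuousOn
      (MvPolynomial.continuous_eval ((m s).coeff i)).continuousOn
    refine ⟨∑ i ∈ Finset.range (m s).natDegree, |M i|, fun y hy i hi => ?_⟩
    exact (hM i y hy).trans ((le_abs_self _).trans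
      (Finset.single_le_sum (f := fun i => |M i|) (fun _ _ => abs_nonneg _) hi))
  choose M hM using hbd
  rw [← Set.inter_self (_ ⁻¹' K)]
  refine (Bornology.IsBounded.pi (S := fun s => Metric.closedBall (0 : ℂ) (|M s| + 1))
    fun s => Metric.isBounded_closedBall).subset ?_
  rintro x ⟨hx, -⟩ s -
  have hroot : ((m s).map (MvPolynomial.eval (polyMap r x))).IsRoot (x s) := by
    have h := congrArg (MvPolynomial.eval x) (hm0 s)
    rw [Polynomial.hom_eval₂, map_zero, MvPolynomial.eval_X] at h
    rw [Polynomial.IsRoot, Polynomial.eval_map, ← h]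
    congr 1
    ext g
    · simp
    · simp [polyMap]
  have hmon := (hm s).map (MvPolynomial.eval (polyMap r x))
  have h1 := hroot.norm_lt_cauchyBound hmon.ne_zero
  rw [mem_closedBall_zero_iff]
  refine (NNReal.coe_le_coe.2 h1.le).trans ?_
  rw [Polynomial.cauchyBound, hmon.leadingCoeff]
  simp only [nnnorm_one, div_one, NNReal.coe_add, NNReal.coe_one, add_le_add_iff_right]
  have : Finset.sup (Finset.range ((m s).map (MvPolynomial.eval (polyMap r x))).natDegree)
      (fun i => ‖((m s).map (MvPolynomial.eval (polyMap r x))).coeff i‖₊) ≤ ‖M s‖₊ := by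
    refine Finset.sup_le fun i hi => ?_
    rw [(hm s).natDegree_map] at hi
    rw [Polynomial.coeff_map, ← NNReal.coe_le_coe, coe_nnnorm, coe_nnnorm]
    exact (hM s _ hx i hi).trans (le_abs_self _)
  exact_mod_cast this

/-- Elimination: if `J` has no zero on the fibre of a finite polynomial map over `y`, then some
polynomial on the target which does not vanish at `y` pulls back to a multiple of `J`. -/
theorem exists_eval_ne_zero_dvd_aeval [Finite σ] (r : τ → MvPolynomial σ ℂ)
    (hr : (MvPolynomial.aeval r : MvPolynomial τ ℂ →ₐ[ℂ] MvPolynomial σ ℂ).toRingHom.IsIntegral)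
    (J : MvPolynomial σ ℂ) (y : τ → ℂ)
    (hJ : ∀ x, polyMap r x = y → MvPolynomial.eval x J ≠ 0) :
    ∃ g : MvPolynomial τ ℂ, MvPolynomial.eval y g ≠ 0 ∧ J ∣ MvPolynomial.aeval r g := by
  by_contra! hcon
  let _ : Algebra (MvPolynomial τ ℂ) (MvPolynomial σ ℂ) :=
    (MvPolynomial.aeval r : MvPolynomial τ ℂ →ₐ[ℂ] MvPolynomial σ ℂ).toRingHom.toAlgebra
  have : Algebra.IsIntegral (MvPolynomial τ ℂ) (MvPolynomial σ ℂ) := ⟨hr⟩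
  have hle : (Ideal.span {J}).comap (algebraMap (MvPolynomial τ ℂ) (MvPolynomial σ ℂ)) ≤
      MvPolynomial.vanishingIdeal ℂ {y} := by
    intro g hg
    rw [Ideal.mem_comap, Ideal.mem_span_singleton] at hg
    rw [MvPolynomial.mem_vanishingIdeal_singleton_iff, MvPolynomial.aeval_eq_eval]
    by_contra h
    exact hcon g h hg
  obtain ⟨Q, hQ, hQp, hQc⟩ := Ideal.exists_ideal_over_prime_of_isIntegral _ _ hle
  have hQm : Q.IsMaximal := Ideal.isMaximal_of_isIntegral_of_isMaximal_comap
    (R := MvPolynomial τ ℂ) Q (hQc.symm ▸ inferInstance)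
  obtain ⟨x, rfl⟩ := MvPolynomial.eq_vanishingIdeal_singleton_of_isMaximal ℂ hQm
  refine hJ x ?_ ?_
  · funext k
    have hk : (MvPolynomial.X k - MvPolynomial.C (y k) : MvPolynomial τ ℂ) ∈
        MvPolynomial.vanishingIdeal ℂ {y} := by
      rw [MvPolynomial.mem_vanishingIdeal_singleton_iff]
      simp
    rw [← hQc, Ideal.mem_comap, MvPolynomial.mem_vanishingIdeal_singleton_iff,
      MvPolynomial.aeval_eq_eval] at hk
    change MvPolynomial.eval x (MvPolynomial.aeval r _) = 0 at hk
    rw [← eval_polyMap] at hk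
    simpa [sub_eq_zero] using hk
  · have := hQ (Ideal.mem_span_singleton_self J)
    rwa [MvPolynomial.mem_vanishingIdeal_singleton_iff, MvPolynomial.aeval_eq_eval] at this

/-- The complement of a complex hypersurface is connected. -/
theorem isPreconnected_mvPolynomial_eval_ne_zero [Finite τ] (g : MvPolynomial τ ℂ) :
    IsPreconnected {y : τ → ℂ | MvPolynomial.eval y g ≠ 0} := by
  refine isPreconnected_of_forall_pair fun y hy z hz => ?_
  let l : τ → ℂ[X] := fun k => C (y k) + C (z k - y k) * X
  have hl : ∀ t : ℂ, (MvPolynomial.aeval l g).eval t =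
      MvPolynomial.eval (fun k => y k + (z k - y k) * t) g := by
    intro t
    rw [← Polynomial.coe_evalRingHom, MvPolynomial.aeval_def, MvPolynomial.hom_eval₂,
      MvPolynomial.eval, MvPolynomial.coe_eval₂Hom]
    congr 1
    · ext; simp
    · funext k; simp [l]
  have hne : MvPolynomial.aeval l g ≠ 0 := by
    intro h
    have := hl 0
    simp only [h, mul_zero, add_zero, Polynomial.eval_zero] at this
    exact hy this.symm
  have hfin : {t : ℂ | (MvPolynomial.aeval l g).IsRoot t}.Finite :=
    Polynomial.finite_setOfPred_isRoot hne
  have hconn := (hfin.countable.isPathConnected_compl_of_one_lt_rank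
    (by rw [Complex.rank_real_complex]; exact Nat.one_lt_ofNat)).isConnected.isPreconnected
  refine ⟨(fun (t : ℂ) k => y k + (z k - y k) * t) ''
    {t : ℂ | (MvPolynomial.aeval l g).IsRoot t}ᶜ, ?_, ⟨0, ?_, ?_⟩, ⟨1, ?_, ?_⟩,
    hconn.image _ (by fun_prop)⟩
  · rintro _ ⟨t, ht, rfl⟩
    rw [Set.mem_ofPred_eq, ← hl]
    exact ht
  · rw [Set.mem_compl_iff, Set.mem_ofPred_eq, Polynomial.IsRoot, hl]
    simpa using hy
  · simp
  · rw [Set.mem_compl_iff, Set.mem_ofPred_eq, Polynomial.IsRoot, hl]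
    simpa using hz
  · simp

theorem IsRegularPoint.exists_openPartialHomeomorph [Fintype σ] [Fintype τ]
    (hcard : Fintype.card σ = Fintype.card τ) {r : τ → MvPolynomial σ ℂ} {x : σ → ℂ}
    (hx : IsRegularPoint r x) :
    ∃ φ : OpenPartialHomeomorph (σ → ℂ) (τ → ℂ), x ∈ φ.source ∧ φ = polyMap r := by
  let L : (σ → ℂ) →L[ℂ] (τ → ℂ) := ContinuousLinearMap.pi fun k =>
    ∑ s, MvPolynomial.eval x (MvPolynomial.pderiv s (r k)) •
        (ContinuousLinearMap.proj s : (σ → ℂ) →L[ℂ] ℂ)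
  have hL : HasStrictFDerivAt (polyMap r) L x :=
    hasStrictFDerivAt_pi.2 fun k => hasStrictFDerivAt_mvPolynomial_eval (r k) x
  have hinj : Function.Injective (L : (σ → ℂ) →ₗ[ℂ] (τ → ℂ)) := by
    rw [injective_iff_map_eq_zero]
    intro v hv
    refine hx v fun k => ?_
    have := congrFun hv k
    simpa [L, mul_comm] using this
  let e := (LinearEquiv.ofInjectiveOfFinrankEq (L : (σ → ℂ) →ₗ[ℂ] (τ → ℂ)) hinj
    (by simpa using hcard)).toContinuousLinearEquiv
  have he : HasStrictFDerivAt (polyMap r) (e : (σ → ℂ) →L[ℂ] (τ → ℂ)) x := by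
    convert! hL using 1
  exact ⟨he.toOpenPartialHomeomorph, he.mem_toOpenPartialHomeomorph_source,
    he.toOpenPartialHomeomorph_coe⟩

theorem isRegularPoint_iff_det [Fintype σ] [DecidableEq σ] (e : σ ≃ τ)
    (r : τ → MvPolynomial σ ℂ) (x : σ → ℂ) :
    IsRegularPoint r x ↔ MvPolynomial.eval x
      (Matrix.of fun t s => MvPolynomial.pderiv s (r (e t)) : Matrix σ σ _).det ≠ 0 := by
  rw [RingHom.map_det, ← not_iff_not, not_not, ← Matrix.exists_mulVec_eq_zero_iff, IsRegularPoint]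
  push Not
  refine exists_congr fun v => ?_
  rw [and_comm]
  refine and_congr Iff.rfl ?_
  rw [funext_iff, ← e.forall_congr_right]
  refine forall_congr' fun t => ?_
  simp [Matrix.mulVec, dotProduct, mul_comm]

/-- If a finite polynomial map between affine spaces of the same dimension has a fibre all of whose
points are regular, then the generic fibre has as many points as that one, all regular. -/
theorem exists_generic_card_fiber [Fintype σ] [Fintype τ]
    (hcard : Fintype.card σ = Fintype.card τ) (r : τ → MvPolynomial σ ℂ)
    (hr : (MvPolynomial.aeval r : MvPolynomial τ ℂ →ₐ[ℂ] MvPolynomial σ ℂ).toRingHom.IsIntegral)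
    (y₀ : τ → ℂ) (hreg : ∀ x, polyMap r x = y₀ → IsRegularPoint r x) :
    ∃ D : MvPolynomial τ ℂ, D ≠ 0 ∧ ∀ y, MvPolynomial.eval y D ≠ 0 →
      (polyMap r ⁻¹' {y}).ncard = (polyMap r ⁻¹' {y₀}).ncard ∧
      ∀ x, polyMap r x = y → IsRegularPoint r x := by
  classical
  let e := Fintype.equivOfCardEq hcard
  obtain ⟨D, hD0, hD⟩ := exists_eval_ne_zero_dvd_aeval r hr
    (Matrix.of fun t s => MvPolynomial.pderiv s (r (e t)) : Matrix σ σ _).det y₀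
    fun x hx => (isRegularPoint_iff_det e r x).1 (hreg x hx)
  have hregD : ∀ x, MvPolynomial.eval (polyMap r x) D ≠ 0 → IsRegularPoint r x := by
    intro x hx
    rw [isRegularPoint_iff_det e]
    intro h
    obtain ⟨w, hw⟩ := hD
    exact hx (by rw [eval_polyMap, hw, map_mul, h, zero_mul])
  have hprop := isProperMap_polyMap r hr
  have hcov : ∀ y, MvPolynomial.eval y D ≠ 0 →
      IsEvenlyCovered (polyMap r) y (polyMap r ⁻¹' {y}) := by
    intro y hy
    have hloc : ∀ x ∈ polyMap r ⁻¹' {y},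
        ∃ φ : OpenPartialHomeomorph (σ → ℂ) (τ → ℂ), x ∈ φ.source ∧ φ = polyMap r := by
      rintro x rfl
      exact (hregD x hy).exists_openPartialHomeomorph hcard
    exact hprop.isClosedMap.isEvenlyCovered_of_openPartialHomeomorph
      ((hprop.isCompact_preimage isCompact_singleton).finite
        (.of_openPartialHomeomorph _ subset_rfl hloc)) hloc
  have hcont : ContinuousOn (fun y => (polyMap r ⁻¹' {y}).ncard)
      {y | MvPolynomial.eval y D ≠ 0} := by
    intro y hy
    refine ContinuousAt.continuousWithinAt ?_
    refine continuousAt_const.congr (f := fun _ => (polyMap r ⁻¹' {y}).ncard) ?_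
    obtain ⟨-, U, hyU, hU, -, H, hH⟩ := hcov y hy
    filter_upwards [hU.mem_nhds hyU] with z hz
    have E : (polyMap r ⁻¹' {y}) ≃ (polyMap r ⁻¹' {z}) :=
      { toFun i := ⟨H.symm (⟨z, hz⟩, i), by simp [← hH]⟩
        invFun x := (H ⟨x, by rwa [Set.mem_preimage, (x.2 : polyMap r x = z)]⟩).2
        left_inv _ := by simp
        right_inv x := Set.inclusion_injective
          (Set.preimage_mono (Set.singleton_subset_iff.mpr hz)) <|
          H.injective <| Prod.ext (Subtype.ext <| by simpa [hH] using x.2.symm) (by simp) }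
    exact Nat.card_congr E
  refine ⟨D, fun h => hD0 (by simp [h]), fun y hy => ⟨?_, ?_⟩⟩
  · exact (isPreconnected_mvPolynomial_eval_ne_zero D).constant hcont hy hD0
  · rintro x rfl
    exact hregD x hy

end FiniteMaps

section TwistedWronskian

variable {R : Type*} [CommRing R]

/-- The bilinear operation `(P, Q) ↦ z(P'Q - PQ') + bPQ` on polynomials. -/
noncomputable def twistedWronskian (b : R) (P Q : R[X]) : R[X] :=
  X * (derivative P * Q - P * derivative Q) + C b * (P * Q)

theorem coeff_twistedWronskian (b : R) (P Q : R[X]) (k : ℕ) :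
    (twistedWronskian b P Q).coeff k = ∑ ij ∈ Finset.HasAntidiagonal.antidiagonal k,
      ((ij.1 : R) - ij.2 + b) * (P.coeff ij.1 * Q.coeff ij.2) := by
  have hX : ∀ (S : R[X]) (i : ℕ), (X * derivative S).coeff i = i * S.coeff i := by
    intro S i
    cases i with
    | zero => simp
    | succ i => rw [coeff_X_mul, coeff_derivative]; push_cast; ring
  have h : twistedWronskian b P Q =
      (X * derivative P) * Q - P * (X * derivative Q) + C b * (P * Q) := by
    rw [twistedWronskian]; ring
  rw [h, coeff_add, coeff_sub, coeff_C_mul, coeff_mul, coeff_mul, coeff_mul, Finset.mul_sum,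
    ← Finset.sum_sub_distrib, ← Finset.sum_add_distrib]
  refine Finset.sum_congr rfl fun ij _ => ?_
  rw [hX, hX]
  ring

theorem map_twistedWronskian {S : Type*} [CommRing S] (f : R →+* S) (b : R) (P Q : R[X]) :
    (twistedWronskian b P Q).map f = twistedWronskian (f b) (P.map f) (Q.map f) := by
  simp [twistedWronskian, Polynomial.derivative_map]

theorem natDegree_twistedWronskian_le (b : R) {P Q : R[X]} {p q : ℕ}
    (hP : P.natDegree ≤ p) (hQ : Q.natDegree ≤ q) :
    (twistedWronskian b P Q).natDegree ≤ p + q := by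
  rw [natDegree_le_iff_coeff_eq_zero]
  intro k hk
  rw [coeff_twistedWronskian]
  refine Finset.sum_eq_zero fun ij hij => ?_
  rw [Finset.HasAntidiagonal.mem_antidiagonal] at hij
  rcases le_or_gt ij.1 p with h | h
  · rw [coeff_eq_zero_of_natDegree_lt (p := Q) (by omega)]; simp
  · rw [coeff_eq_zero_of_natDegree_lt (p := P) (by omega)]; simp

theorem coeff_add_twistedWronskian (b : R) {P Q : R[X]} {p q : ℕ}
    (hP : P.natDegree ≤ p) (hQ : Q.natDegree ≤ q) :
    (twistedWronskian b P Q).coeff (p + q) =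
      ((p : R) - q + b) * (P.coeff p * Q.coeff q) := by
  rw [coeff_twistedWronskian]
  refine Finset.sum_eq_single (p, q) (fun ij hij hne => ?_) (by simp)
  rw [Finset.HasAntidiagonal.mem_antidiagonal] at hij
  rcases lt_trichotomy ij.1 p with h | h | h
  · rw [coeff_eq_zero_of_natDegree_lt (p := Q) (by omega)]; simp
  · exact absurd (Prod.ext h (by simp; omega)) hne
  · rw [coeff_eq_zero_of_natDegree_lt (p := P) (by omega)]; simp

theorem twistedWronskian_X_mul_left (b : R) (P Q : R[X]) :
    twistedWronskian b (X * P) Q = X * twistedWronskian (b + 1) P Q := by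
  simp only [twistedWronskian, derivative_mul, derivative_X, C_add, C_1]
  ring

theorem twistedWronskian_X_mul_right (b : R) (P Q : R[X]) :
    twistedWronskian b P (X * Q) = X * twistedWronskian (b - 1) P Q := by
  simp only [twistedWronskian, derivative_mul, derivative_X, C_sub, C_1]
  ring

theorem coeff_zero_twistedWronskian (b : R) (P Q : R[X]) :
    (twistedWronskian b P Q).coeff 0 = b * (P.coeff 0 * Q.coeff 0) := by
  simp [coeff_twistedWronskian]

/-- The polynomial of degree less than `n` with the prescribed coefficients. -/
noncomputable def lowPoly {n : ℕ} (u : Fin n → R) : R[X] := ∑ i, C (u i) * X ^ (i : ℕ)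

theorem coeff_lowPoly {n : ℕ} (u : Fin n → R) (k : ℕ) :
    (lowPoly u).coeff k = if h : k < n then u ⟨k, h⟩ else 0 := by
  simp only [lowPoly, finsetSum_coeff, coeff_C_mul, coeff_X_pow, mul_ite, mul_one, mul_zero]
  split_ifs with h
  · rw [Finset.sum_eq_single ⟨k, h⟩]
    · simp
    · intro i _ hi
      exact if_neg fun hk => hi (Fin.ext hk.symm)
    · simp
  · exact Finset.sum_eq_zero fun i _ => if_neg fun (hk : k = i) => h (hk ▸ i.2)

theorem degree_lowPoly_lt {n : ℕ} (u : Fin n → R) : (lowPoly u).degree < n := by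
  rw [degree_lt_iff_coeff_zero]
  intro k hk
  rw [coeff_lowPoly, dif_neg (by omega)]

theorem lowPoly_coeff {n : ℕ} {f : R[X]} (hf : f.degree < n) :
    lowPoly (fun i : Fin n => f.coeff i) = f := by
  ext k
  rw [coeff_lowPoly]
  split_ifs with h
  · rfl
  · exact ((degree_lt_iff_coeff_zero _ _).1 hf k (by omega)).symm

theorem map_lowPoly {S : Type*} [CommRing S] (f : R →+* S) {n : ℕ} (u : Fin n → R) :
    (lowPoly u).map f = lowPoly (f ∘ u) := by
  simp [lowPoly, Polynomial.map_sum]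

/-- The polynomial of degree at most `n` with leading term `c zⁿ` and the prescribed lower
coefficients. -/
noncomputable def leadPoly (c : R) {n : ℕ} (u : Fin n → R) : R[X] := C c * X ^ n + lowPoly u

theorem coeff_leadPoly (c : R) {n : ℕ} (u : Fin n → R) (k : ℕ) :
    (leadPoly c u).coeff k = if h : k < n then u ⟨k, h⟩ else if k = n then c else 0 := by
  rw [leadPoly, coeff_add, coeff_lowPoly, coeff_C_mul, coeff_X_pow]
  split_ifs <;> first | omega | simp

theorem coeff_leadPoly_fin (c : R) {n : ℕ} (u : Fin n → R) (k : Fin n) :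
    (leadPoly c u).coeff k = u k := by
  rw [coeff_leadPoly, dif_pos k.2]

theorem eq_leadPoly_iff {c : R} {n : ℕ} {u : Fin n → R} {f : R[X]} (hf : f.natDegree ≤ n)
    (hc : f.coeff n = c) : f = leadPoly c u ↔ ∀ k : Fin n, f.coeff k = u k := by
  constructor
  · rintro rfl k
    exact coeff_leadPoly_fin c u k
  · intro h
    ext k
    rw [coeff_leadPoly]
    split_ifs with h1 h2
    · exact h ⟨k, h1⟩
    · rw [h2, hc]
    · exact coeff_eq_zero_of_natDegree_lt (by omega)

theorem map_leadPoly {S : Type*} [CommRing S] (f : R →+* S) (c : R) {n : ℕ} (u : Fin n → R) :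
    (leadPoly c u).map f = leadPoly (f c) (f ∘ u) := by
  simp [leadPoly, map_lowPoly]

theorem natDegree_leadPoly_le (c : R) {n : ℕ} (u : Fin n → R) : (leadPoly c u).natDegree ≤ n := by
  rw [natDegree_le_iff_coeff_eq_zero]
  intro k hk
  rw [coeff_leadPoly, dif_neg (by omega), if_neg (by omega)]

theorem coeff_leadPoly_self (c : R) {n : ℕ} (u : Fin n → R) : (leadPoly c u).coeff n = c := by
  rw [coeff_leadPoly, dif_neg (by omega), if_pos rfl]

theorem monic_leadPoly {n : ℕ} (u : Fin n → R) : (leadPoly 1 u).Monic :=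
  monic_of_natDegree_le_of_coeff_eq_one n (natDegree_leadPoly_le 1 u) (coeff_leadPoly_self 1 u)

theorem natDegree_leadPoly_one [Nontrivial R] {n : ℕ} (u : Fin n → R) :
    (leadPoly 1 u).natDegree = n :=
  natDegree_eq_of_le_of_coeff_ne_zero (natDegree_leadPoly_le 1 u)
    (by rw [coeff_leadPoly_self]; exact one_ne_zero)

theorem leadPoly_cons_zero (c : R) {n : ℕ} (u : Fin n → R) :
    leadPoly c (Fin.cons 0 u : Fin (n + 1) → R) = X * leadPoly c u := by
  simp only [leadPoly, lowPoly, Fin.sum_univ_succ, Fin.cons_zero, Fin.cons_succ, mul_add,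
    Finset.mul_sum, C_0, zero_mul, zero_add, Fin.val_succ, pow_succ']
  congr 1
  · ring
  · exact Finset.sum_congr rfl fun i _ => by ring

end TwistedWronskian

section Integrality

variable {K Γ : Type*} [Field K] [LinearOrderedCommGroupWithZero Γ] (v : Valuation K Γ)

/-- Among the coefficients of maximal valuation of a monic polynomial, there is a last one. -/
theorem exists_last_max_valuation_coeff {P : K[X]} (hP : P.Monic) :
    ∃ i, 1 ≤ v (P.coeff i) ∧ (∀ k, v (P.coeff k) ≤ v (P.coeff i)) ∧
      ∀ k, i < k → v (P.coeff k) < v (P.coeff i) := by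
  classical
  obtain ⟨m, -, hm⟩ := P.support.exists_max_image (fun i => v (P.coeff i))
    (support_nonempty.2 hP.ne_zero)
  have hmax : ∀ k, v (P.coeff k) ≤ v (P.coeff m) := by
    intro k
    by_cases hk : P.coeff k = 0
    · simp [hk]
    · exact hm k (mem_support_iff.2 hk)
  have hone : 1 ≤ v (P.coeff m) := by
    simpa [hP.coeff_natDegree] using hmax P.natDegree
  let T := P.support.filter fun i => v (P.coeff i) = v (P.coeff m)
  have hmem : ∀ k, v (P.coeff k) = v (P.coeff m) → k ∈ T := by
    intro k hk
    refine Finset.mem_filter.2 ⟨mem_support_iff.2 fun h => ?_, hk⟩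
    rw [h, map_zero] at hk
    rw [← hk] at hone
    exact absurd hone (not_le.2 zero_lt_one)
  have hT : T.Nonempty := ⟨m, hmem m rfl⟩
  have hi := (Finset.mem_filter.1 (T.max'_mem hT)).2
  refine ⟨T.max' hT, hi ▸ hone, fun k => hi ▸ hmax k, fun k hk => ?_⟩
  rw [hi]
  exact (hmax k).lt_of_ne fun h => absurd (T.le_max' k (hmem k h)) (not_le.2 hk)

theorem valuation_coeff_le_one_of_twistedWronskian {b : K}
    (hb : ∀ i j : ℕ, v ((i : K) - j + b) = 1) {P Q : K[X]} (hP : P.Monic) (hQ : Q.Monic)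
    (hW : ∀ k, v ((twistedWronskian b P Q).coeff k) ≤ 1) (k : ℕ) :
    v (P.coeff k) ≤ 1 ∧ v (Q.coeff k) ≤ 1 := by
  obtain ⟨i, hi1, hi, hi'⟩ := exists_last_max_valuation_coeff v hP
  obtain ⟨j, hj1, hj, hj'⟩ := exists_last_max_valuation_coeff v hQ
  have hi0 : 0 < v (P.coeff i) := zero_lt_one.trans_le hi1
  have hj0 : 0 < v (Q.coeff j) := zero_lt_one.trans_le hj1
  have hsum : v ((twistedWronskian b P Q).coeff (i + j)) = v (P.coeff i) * v (Q.coeff j) := by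
    have hij : (i, j) ∈ Finset.HasAntidiagonal.antidiagonal (i + j) := by simp
    rw [coeff_twistedWronskian, ← Finset.add_sum_erase _ _ hij]
    have hmain : v (((i : K) - j + b) * (P.coeff i * Q.coeff j)) =
        v (P.coeff i) * v (Q.coeff j) := by simp [hb]
    rw [Valuation.map_add_eq_of_lt_left, hmain]
    rw [hmain]
    refine Valuation.map_sum_lt v (mul_pos hi0 hj0).ne' fun kl hkl => ?_
    obtain ⟨hne, hkl⟩ := Finset.mem_erase.1 hkl
    rw [Finset.HasAntidiagonal.mem_antidiagonal] at hkl
    rw [map_mul, hb, one_mul, map_mul]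
    rcases lt_trichotomy i kl.1 with h | h | h
    · exact (mul_le_mul_right (hj _) _).trans_lt (mul_lt_mul_of_pos_right (hi' _ h) hj0)
    · exact absurd (Prod.ext h.symm (by simp; omega)) hne
    · exact (mul_le_mul_left (hi _) _).trans_lt
        (mul_lt_mul_of_pos_left (hj' _ (by omega)) hi0)
  have hle : v (P.coeff i) * v (Q.coeff j) ≤ 1 := hsum ▸ hW _
  refine ⟨(hi k).trans ?_, (hj k).trans ?_⟩
  · exact (le_mul_of_one_le_right' hj1).trans hle
  · exact (le_mul_of_one_le_left' hi1).trans hle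

end Integrality

/-- The coefficients of the universal value of the twisted Wronskian on monic polynomials of
degrees `p` and `q`. -/
noncomputable def wronskianCoeff (p q n : ℕ) (β : ℂ) (k : Fin n) :
    MvPolynomial (Fin p ⊕ Fin q) ℂ :=
  (twistedWronskian (MvPolynomial.C β) (leadPoly 1 (MvPolynomial.X ∘ Sum.inl : Fin p → _))
    (leadPoly 1 (MvPolynomial.X ∘ Sum.inr : Fin q → _))).coeff k

theorem polyMap_wronskianCoeff (p q n : ℕ) (β : ℂ) (x : Fin p ⊕ Fin q → ℂ) (k : Fin n) :
    polyMap (wronskianCoeff p q n β) x k =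
      (twistedWronskian β (leadPoly 1 (x ∘ Sum.inl)) (leadPoly 1 (x ∘ Sum.inr))).coeff k := by
  have hx : ∀ {m : ℕ} (f : Fin m → Fin p ⊕ Fin q),
      MvPolynomial.eval x ∘ MvPolynomial.X ∘ f = x ∘ f := by
    intro m f
    funext i
    simp
  rw [polyMap, wronskianCoeff, ← Polynomial.coeff_map, map_twistedWronskian, map_leadPoly,
    map_leadPoly, hx, hx, MvPolynomial.eval_C, map_one]

theorem isIntegralElem_of_forall_valuationSubring {A B : Type*} [CommRing A] [CommRing B]
    [IsDomain B] (f : A →+* B) (x : B)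
    (h : ∀ V : ValuationSubring (FractionRing B),
      (∀ a, algebraMap B (FractionRing B) (f a) ∈ V) → algebraMap B (FractionRing B) x ∈ V) :
    f.IsIntegralElem x := by
  let g : A →+* FractionRing B := (algebraMap B (FractionRing B)).comp f
  have hmem : algebraMap B (FractionRing B) x ∈
      (integralClosure (Subring.closure (g.range : Set (FractionRing B)))
        (FractionRing B)).toSubring := by
    rw [← iInf_valuationSubring_superset, Subring.mem_iInf]
    rintro ⟨V, hV⟩
    exact h V fun a => hV ⟨a, rfl⟩
  obtain ⟨m, hm, hm0⟩ := hmem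
  have hlift : m.map (algebraMap _ (FractionRing B)) ∈ Polynomial.lifts g := by
    rw [Polynomial.lifts_iff_coeff_lifts]
    intro k
    rw [Polynomial.coeff_map]
    exact (Subring.closure_eq g.range).le (m.coeff k).2
  obtain ⟨m', hm', -, hmon⟩ := Polynomial.lifts_and_natDegree_eq_and_monic hlift (hm.map _)
  refine ⟨m', hmon, IsFractionRing.injective B (FractionRing B) ?_⟩
  rw [Polynomial.hom_eval₂, map_zero, ← hm0, ← Polynomial.eval_map, ← Polynomial.eval_map, hm']

theorem isIntegral_wronskianCoeff {p q n : ℕ} (hn : p + q = n) {β : ℂ}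
    (hβ : ∀ m : ℤ, (m : ℂ) + β ≠ 0) :
    (MvPolynomial.aeval (wronskianCoeff p q n β) :
      MvPolynomial (Fin n) ℂ →ₐ[ℂ] MvPolynomial (Fin p ⊕ Fin q) ℂ).toRingHom.IsIntegral := by
  have hX : ∀ s, (MvPolynomial.aeval (wronskianCoeff p q n β) :
      MvPolynomial (Fin n) ℂ →ₐ[ℂ] MvPolynomial (Fin p ⊕ Fin q) ℂ).toRingHom.IsIntegralElem
        (MvPolynomial.X s) := by
    intro s
    refine isIntegralElem_of_forall_valuationSubring _ _ fun V hV => ?_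
    let ι := algebraMap (MvPolynomial (Fin p ⊕ Fin q) ℂ)
      (FractionRing (MvPolynomial (Fin p ⊕ Fin q) ℂ))
    have hC : ∀ a : ℂ, ι (MvPolynomial.C a) ∈ V := fun a => by
      simpa using hV (MvPolynomial.C a)
    have hC1 : ∀ a : ℂ, a ≠ 0 → V.valuation (ι (MvPolynomial.C a)) = 1 := by
      intro a ha
      refine le_antisymm ((V.valuation_le_one_iff _).2 (hC a)) ?_
      have h1 := (V.valuation_le_one_iff _).2 (hC a⁻¹)
      have h2 : V.valuation (ι (MvPolynomial.C a)) * V.valuation (ι (MvPolynomial.C a⁻¹)) = 1 := by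
        rw [← map_mul, ← map_mul, ← map_mul, mul_inv_cancel₀ ha]; simp
      calc 1 = _ := h2.symm
        _ ≤ V.valuation (ι (MvPolynomial.C a)) * 1 := mul_le_mul_right h1 _
        _ = _ := mul_one _
    have hcast : ∀ i j : ℕ, (i : FractionRing (MvPolynomial (Fin p ⊕ Fin q) ℂ)) - j +
        ι (MvPolynomial.C β) = ι (MvPolynomial.C (((i - j : ℤ) : ℂ) + β)) := by
      intro i j
      simp
    have hv := valuation_coeff_le_one_of_twistedWronskian V.valuation
      (b := ι (MvPolynomial.C β))
      (fun i j => by rw [hcast]; exact hC1 _ (hβ _))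
      (monic_leadPoly (ι ∘ MvPolynomial.X ∘ Sum.inl : Fin p → _))
      (monic_leadPoly (ι ∘ MvPolynomial.X ∘ Sum.inr : Fin q → _)) ?_
    · rcases s with i | j
      · have := (hv i).1
        rw [coeff_leadPoly_fin] at this
        exact (V.valuation_le_one_iff _).1 this
      · have := (hv j).2
        rw [coeff_leadPoly_fin] at this
        exact (V.valuation_le_one_iff _).1 this
    · intro k
      rw [V.valuation_le_one_iff]
      rcases lt_trichotomy k n with hk | hk | hk
      · have := hV (MvPolynomial.X ⟨k, hk⟩)
        simp only [AlgHom.toRingHom_eq_coe, RingHom.coe_coe, MvPolynomial.aeval_X] at this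
        rwa [wronskianCoeff, ← Polynomial.coeff_map, map_twistedWronskian, map_leadPoly,
          map_leadPoly, map_one] at this
      · rw [hk, ← hn, coeff_add_twistedWronskian _ (natDegree_leadPoly_le _ _)
          (natDegree_leadPoly_le _ _), coeff_leadPoly_self, coeff_leadPoly_self, mul_one, mul_one,
          hcast]
        exact hC _
      · rw [coeff_eq_zero_of_natDegree_lt]
        · exact V.zero_mem
        · exact (natDegree_twistedWronskian_le _ (natDegree_leadPoly_le _ _)
            (natDegree_leadPoly_le _ _)).trans_lt (hn ▸ hk)
  intro f
  induction f using MvPolynomial.induction_on with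
  | C a =>
    have := RingHom.isIntegralElem_map (MvPolynomial.aeval (wronskianCoeff p q n β) :
      MvPolynomial (Fin n) ℂ →ₐ[ℂ] MvPolynomial (Fin p ⊕ Fin q) ℂ).toRingHom
      (x := MvPolynomial.C a)
    simpa using this
  | add f g hf hg => exact hf.add _ hg
  | mul_X f s hf => exact hf.mul _ (hX s)

/-- The pairs of monic polynomials of degrees exactly `p` and `q` with twisted Wronskian `S`. -/
def wronskianFiber (p q : ℕ) (β : ℂ) (S : ℂ[X]) : Set (ℂ[X] × ℂ[X]) :=
  {PQ | PQ.1.Monic ∧ PQ.2.Monic ∧ PQ.1.natDegree = p ∧ PQ.2.natDegree = q ∧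
    twistedWronskian β PQ.1 PQ.2 = S}

/-- The differential of the twisted Wronskian on monic pairs of degrees `p` and `q` is injective
at `PQ`. -/
def IsRegularPair (p q : ℕ) (β : ℂ) (PQ : ℂ[X] × ℂ[X]) : Prop :=
  ∀ u w : ℂ[X], u.degree < p → w.degree < q →
    twistedWronskian β u PQ.2 + twistedWronskian β PQ.1 w = 0 → u = 0 ∧ w = 0

theorem sum_mul_eval_pderiv_mul {σ : Type*} [Fintype σ] (x v : σ → ℂ) (f g : MvPolynomial σ ℂ) :
    ∑ s, v s * MvPolynomial.eval x (MvPolynomial.pderiv s (f * g)) =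
      (∑ s, v s * MvPolynomial.eval x (MvPolynomial.pderiv s f)) * MvPolynomial.eval x g +
      MvPolynomial.eval x f * ∑ s, v s * MvPolynomial.eval x (MvPolynomial.pderiv s g) := by
  rw [Finset.sum_mul, Finset.mul_sum, ← Finset.sum_add_distrib]
  refine Finset.sum_congr rfl fun s _ => ?_
  rw [MvPolynomial.pderiv_mul, map_add, map_mul, map_mul]
  ring

theorem sum_mul_eval_pderiv_coeff_leadPoly {σ : Type*} [Fintype σ] (x v : σ → ℂ)
    {n : ℕ} (f : Fin n → σ) (i : ℕ) :
    ∑ s, v s * MvPolynomial.eval x (MvPolynomial.pderiv s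
      ((leadPoly 1 (MvPolynomial.X ∘ f : Fin n → MvPolynomial σ ℂ)).coeff i)) =
      (lowPoly (v ∘ f)).coeff i := by
  classical
  rw [coeff_leadPoly, coeff_lowPoly]
  split_ifs with h1 h2
  · simp [MvPolynomial.pderiv_X, Pi.single_apply, apply_ite]
  · simp
  · simp

theorem eval_coeff_leadPoly {σ : Type*} (x : σ → ℂ) {n : ℕ} (f : Fin n → σ) (i : ℕ) :
    MvPolynomial.eval x
      ((leadPoly 1 (MvPolynomial.X ∘ f : Fin n → MvPolynomial σ ℂ)).coeff i) =
      (leadPoly 1 (x ∘ f)).coeff i := by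
  rw [coeff_leadPoly, coeff_leadPoly]
  split_ifs <;> simp

theorem sum_mul_eval_pderiv_wronskianCoeff (p q n : ℕ) (β : ℂ) (x v : Fin p ⊕ Fin q → ℂ)
    (k : Fin n) :
    ∑ s, v s * MvPolynomial.eval x (MvPolynomial.pderiv s (wronskianCoeff p q n β k)) =
      (twistedWronskian β (lowPoly (v ∘ Sum.inl)) (leadPoly 1 (x ∘ Sum.inr)) +
        twistedWronskian β (leadPoly 1 (x ∘ Sum.inl)) (lowPoly (v ∘ Sum.inr))).coeff k := by
  rw [wronskianCoeff, coeff_add, coeff_twistedWronskian, coeff_twistedWronskian,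
    coeff_twistedWronskian, ← Finset.sum_add_distrib]
  simp only [map_sum, Finset.mul_sum]
  rw [Finset.sum_comm]
  refine Finset.sum_congr rfl fun ij _ => ?_
  have hC : ((ij.1 : ℕ) : MvPolynomial (Fin p ⊕ Fin q) ℂ) -
      ((ij.2 : ℕ) : MvPolynomial (Fin p ⊕ Fin q) ℂ) + MvPolynomial.C β =
      MvPolynomial.C (((ij.1 : ℕ) : ℂ) - ((ij.2 : ℕ) : ℂ) + β) := by simp
  rw [hC, sum_mul_eval_pderiv_mul, sum_mul_eval_pderiv_mul, sum_mul_eval_pderiv_coeff_leadPoly,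
    sum_mul_eval_pderiv_coeff_leadPoly, eval_coeff_leadPoly, eval_coeff_leadPoly]
  simp only [MvPolynomial.pderiv_C, map_zero, mul_zero, Finset.sum_const_zero, zero_mul, zero_add,
    MvPolynomial.eval_C]
  ring

theorem isRegularPoint_wronskianCoeff_iff {p q n : ℕ} (hn : p + q = n) (β : ℂ)
    (x : Fin p ⊕ Fin q → ℂ) :
    IsRegularPoint (wronskianCoeff p q n β) x ↔
      IsRegularPair p q β (leadPoly 1 (x ∘ Sum.inl), leadPoly 1 (x ∘ Sum.inr)) := by
  simp only [IsRegularPoint, IsRegularPair, sum_mul_eval_pderiv_wronskianCoeff]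
  constructor
  · intro h u w hu hw huw
    have := h (Sum.elim (fun i => u.coeff i) (fun i => w.coeff i)) fun k => by
      rw [Sum.elim_comp_inl, Sum.elim_comp_inr, lowPoly_coeff hu, lowPoly_coeff hw, huw, coeff_zero]
    rw [← lowPoly_coeff hu, ← lowPoly_coeff hw]
    constructor
    · ext k
      rw [coeff_lowPoly, coeff_zero]
      split_ifs with hk
      · exact congrFun this (Sum.inl ⟨k, hk⟩)
      · rfl
    · ext k
      rw [coeff_lowPoly, coeff_zero]
      split_ifs with hk
      · exact congrFun this (Sum.inr ⟨k, hk⟩)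
      · rfl
  · intro h v hv
    have hlow : ∀ {m : ℕ} (g : Fin m → ℂ), (lowPoly g).natDegree ≤ m := fun g =>
      natDegree_le_of_degree_le (degree_lowPoly_lt g).le
    obtain ⟨h1, h2⟩ := h _ _ (degree_lowPoly_lt (v ∘ Sum.inl)) (degree_lowPoly_lt (v ∘ Sum.inr)) (by
      ext k
      rw [coeff_zero]
      rcases lt_trichotomy k n with hk | hk | hk
      · exact hv ⟨k, hk⟩
      · rw [hk, ← hn, coeff_add, coeff_add_twistedWronskian _ (hlow _) (natDegree_leadPoly_le _ _),
          coeff_add_twistedWronskian _ (natDegree_leadPoly_le _ _) (hlow _), coeff_lowPoly,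
          coeff_lowPoly]
        simp
      · refine coeff_eq_zero_of_natDegree_lt (lt_of_le_of_lt (natDegree_add_le_of_degree_le
          (natDegree_twistedWronskian_le _ (hlow _) (natDegree_leadPoly_le _ _))
          (natDegree_twistedWronskian_le _ (natDegree_leadPoly_le _ _) (hlow _))) (hn ▸ hk)))
    funext s
    rcases s with i | j
    · have := congrArg (fun f => f.coeff i) h1
      simpa [coeff_lowPoly] using this
    · have := congrArg (fun f => f.coeff j) h2
      simpa [coeff_lowPoly] using this

theorem leadPoly_one_coeff {n : ℕ} {P : ℂ[X]} (hP : P.Monic) (hn : P.natDegree = n) :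
    leadPoly 1 (fun i : Fin n => P.coeff i) = P :=
  ((eq_leadPoly_iff hn.le (hn ▸ hP.coeff_natDegree)).2 fun _ => rfl).symm

theorem wronskianFiber_eq_image {p q n : ℕ} (hn : p + q = n) (β : ℂ) (y : Fin n → ℂ) :
    wronskianFiber p q β (leadPoly ((p : ℂ) - q + β) y) =
      (fun x : Fin p ⊕ Fin q → ℂ => (leadPoly 1 (x ∘ Sum.inl), leadPoly 1 (x ∘ Sum.inr))) ''
        (polyMap (wronskianCoeff p q n β) ⁻¹' {y}) := by
  have key : ∀ P Q : ℂ[X], P.Monic → Q.Monic → P.natDegree = p → Q.natDegree = q →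
      (twistedWronskian β P Q = leadPoly ((p : ℂ) - q + β) y ↔
        ∀ k : Fin n, (twistedWronskian β P Q).coeff k = y k) := by
    intro P Q hP hQ hp hq
    refine eq_leadPoly_iff (hn ▸ natDegree_twistedWronskian_le β hp.le hq.le) ?_
    have hP' : P.coeff p = 1 := hp ▸ hP.coeff_natDegree
    have hQ' : Q.coeff q = 1 := hq ▸ hQ.coeff_natDegree
    rw [← hn, coeff_add_twistedWronskian β hp.le hq.le, hP', hQ', mul_one, mul_one]
  ext ⟨P, Q⟩
  constructor
  · rintro ⟨hP, hQ, hp, hq, hW⟩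
    refine ⟨Sum.elim (fun i => P.coeff i) (fun i => Q.coeff i), ?_, ?_⟩
    · rw [Set.mem_preimage, Set.mem_singleton_iff]
      funext k
      rw [polyMap_wronskianCoeff, Sum.elim_comp_inl, Sum.elim_comp_inr, leadPoly_one_coeff hP hp,
        leadPoly_one_coeff hQ hq]
      exact (key P Q hP hQ hp hq).1 hW k
    · simp only [Sum.elim_comp_inl, Sum.elim_comp_inr, leadPoly_one_coeff hP hp,
        leadPoly_one_coeff hQ hq]
  · rintro ⟨x, hx, h⟩
    obtain ⟨rfl, rfl⟩ := Prod.mk.inj h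
    refine ⟨monic_leadPoly _, monic_leadPoly _, natDegree_leadPoly_one _, natDegree_leadPoly_one _,
      (key _ _ (monic_leadPoly _) (monic_leadPoly _) (natDegree_leadPoly_one _)
        (natDegree_leadPoly_one _)).2 fun k => ?_⟩
    rw [← polyMap_wronskianCoeff]
    exact congrFun hx k

theorem injective_leadPoly_pair (p q : ℕ) :
    Function.Injective (fun x : Fin p ⊕ Fin q → ℂ =>
      ((leadPoly 1 (x ∘ Sum.inl), leadPoly 1 (x ∘ Sum.inr)) : ℂ[X] × ℂ[X])) := by
  intro x x' h
  obtain ⟨h1, h2⟩ := Prod.mk.inj h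
  funext s
  rcases s with i | j
  · simpa [coeff_leadPoly_fin] using congrArg (fun f => f.coeff i) h1
  · simpa [coeff_leadPoly_fin] using congrArg (fun f => f.coeff j) h2

/-- If every pair in one fibre is regular, then the generic fibre has the same number of elements
and consists of regular pairs. -/
theorem exists_generic_ncard_wronskianFiber {p q n : ℕ} (hn : p + q = n) {β : ℂ}
    (hβ : ∀ m : ℤ, (m : ℂ) + β ≠ 0) (y₀ : Fin n → ℂ)
    (hreg : ∀ PQ ∈ wronskianFiber p q β (leadPoly ((p : ℂ) - q + β) y₀), IsRegularPair p q β PQ) :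
    ∃ D : MvPolynomial (Fin n) ℂ, D ≠ 0 ∧ ∀ y, MvPolynomial.eval y D ≠ 0 →
      (wronskianFiber p q β (leadPoly ((p : ℂ) - q + β) y)).ncard =
        (wronskianFiber p q β (leadPoly ((p : ℂ) - q + β) y₀)).ncard ∧
      ∀ PQ ∈ wronskianFiber p q β (leadPoly ((p : ℂ) - q + β) y), IsRegularPair p q β PQ := by
  simp only [wronskianFiber_eq_image hn, Set.forall_mem_image, Set.mem_preimage,
    Set.mem_singleton_iff, ← isRegularPoint_wronskianCoeff_iff hn,
    Set.ncard_image_of_injective _ (injective_leadPoly_pair p q)] at hreg ⊢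
  exact exists_generic_card_fiber (by simpa using hn) _ (isIntegral_wronskianCoeff hn hβ) y₀ hreg

/-- The part of the fibre over `z S` where the first polynomial vanishes at the origin. -/
theorem wronskianFiber_X_mul_left (p q : ℕ) (β : ℂ) (S : ℂ[X]) :
    {PQ ∈ wronskianFiber (p + 1) q β (X * S) | X ∣ PQ.1} =
      (fun PQ => (X * PQ.1, PQ.2)) '' wronskianFiber p q (β + 1) S := by
  ext ⟨P, Q⟩
  constructor
  · rintro ⟨⟨hP, hQ, hp, hq, hW⟩, P, rfl⟩
    dsimp only at hP hQ hp hq hW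
    rw [twistedWronskian_X_mul_left] at hW
    have hP' := monic_X.of_mul_monic_left hP
    rw [natDegree_X_mul hP'.ne_zero] at hp
    exact ⟨(P, Q), ⟨hP', hQ, by simpa using hp, hq, mul_left_cancel₀ X_ne_zero hW⟩, rfl⟩
  · rintro ⟨⟨P, Q⟩, ⟨hP, hQ, hp, hq, hW⟩, h⟩
    obtain ⟨rfl, rfl⟩ := Prod.mk.inj h
    dsimp only at hP hQ hp hq hW ⊢
    refine ⟨⟨monic_X.mul hP, hQ, ?_, hq, ?_⟩, dvd_mul_right _ _⟩
    · rw [natDegree_X_mul hP.ne_zero, hp]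
    · rw [twistedWronskian_X_mul_left, hW]

/-- The part of the fibre over `z S` where the second polynomial vanishes at the origin. -/
theorem wronskianFiber_X_mul_right (p q : ℕ) (β : ℂ) (S : ℂ[X]) :
    {PQ ∈ wronskianFiber p (q + 1) β (X * S) | X ∣ PQ.2} =
      (fun PQ => (PQ.1, X * PQ.2)) '' wronskianFiber p q (β - 1) S := by
  ext ⟨P, Q⟩
  constructor
  · rintro ⟨⟨hP, hQ, hp, hq, hW⟩, Q, rfl⟩
    dsimp only at hP hQ hp hq hW
    rw [twistedWronskian_X_mul_right] at hW
    have hQ' := monic_X.of_mul_monic_left hQ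
    rw [natDegree_X_mul hQ'.ne_zero] at hq
    exact ⟨(P, Q), ⟨hP, hQ', hp, by simpa using hq, mul_left_cancel₀ X_ne_zero hW⟩, rfl⟩
  · rintro ⟨⟨P, Q⟩, ⟨hP, hQ, hp, hq, hW⟩, h⟩
    obtain ⟨rfl, rfl⟩ := Prod.mk.inj h
    dsimp only at hP hQ hp hq hW ⊢
    refine ⟨⟨hP, monic_X.mul hQ, hp, ?_, ?_⟩, dvd_mul_right _ _⟩
    · rw [natDegree_X_mul hQ.ne_zero, hq]
    · rw [twistedWronskian_X_mul_right, hW]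

theorem degree_lt_of_degree_X_mul_lt {f : ℂ[X]} {n : ℕ}
    (h : (X * f).degree < ((n + 1 : ℕ) : WithBot ℕ)) : f.degree < (n : WithBot ℕ) := by
  rw [degree_lt_iff_coeff_zero] at h ⊢
  intro k hk
  rw [← coeff_X_mul]
  exact h (k + 1) (by omega)

theorem IsRegularPair.X_mul_left {p q : ℕ} {β : ℂ} (hβ : β ≠ 0) {P Q : ℂ[X]}
    (hQ : Q.coeff 0 ≠ 0) (h : IsRegularPair p q (β + 1) (P, Q)) :
    IsRegularPair (p + 1) q β (X * P, Q) := by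
  intro u w hu hw huw
  dsimp only at huw
  rw [twistedWronskian_X_mul_left] at huw
  have hu0 : u.coeff 0 = 0 := by
    have := congrArg (fun f => f.coeff 0) huw
    simpa [coeff_zero_twistedWronskian, hβ, hQ] using this
  obtain ⟨u, rfl⟩ := X_dvd_iff.2 hu0
  rw [twistedWronskian_X_mul_left, ← mul_add, mul_eq_zero, or_iff_right X_ne_zero] at huw
  obtain ⟨rfl, rfl⟩ := h u w (degree_lt_of_degree_X_mul_lt hu) hw huw
  simp

theorem IsRegularPair.X_mul_right {p q : ℕ} {β : ℂ} (hβ : β ≠ 0) {P Q : ℂ[X]}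
    (hP : P.coeff 0 ≠ 0) (h : IsRegularPair p q (β - 1) (P, Q)) :
    IsRegularPair p (q + 1) β (P, X * Q) := by
  intro u w hu hw huw
  dsimp only at huw
  rw [twistedWronskian_X_mul_right] at huw
  have hw0 : w.coeff 0 = 0 := by
    have := congrArg (fun f => f.coeff 0) huw
    simpa [coeff_zero_twistedWronskian, hβ, hP] using this
  obtain ⟨w, rfl⟩ := X_dvd_iff.2 hw0
  rw [twistedWronskian_X_mul_right, ← mul_add, mul_eq_zero, or_iff_right X_ne_zero] at huw
  obtain ⟨rfl, rfl⟩ := h u w hu (degree_lt_of_degree_X_mul_lt hw) huw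
  simp

/-- The generic fibre over the pairs of degrees `p` and `q` has `d` elements, all regular. -/
def HasGenericFiber (p q n : ℕ) (β : ℂ) (d : ℕ) : Prop :=
  ∃ D : MvPolynomial (Fin n) ℂ, D ≠ 0 ∧ ∀ y, MvPolynomial.eval y D ≠ 0 →
    (wronskianFiber p q β (leadPoly ((p : ℂ) - q + β) y)).ncard = d ∧
    ∀ PQ ∈ wronskianFiber p q β (leadPoly ((p : ℂ) - q + β) y), IsRegularPair p q β PQ

theorem coeff_zero_ne_zero_of_mem_wronskianFiber {p q : ℕ} {β : ℂ} {S : ℂ[X]}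
    (hS : S.coeff 0 ≠ 0) {PQ : ℂ[X] × ℂ[X]} (h : PQ ∈ wronskianFiber p q β S) :
    PQ.1.coeff 0 ≠ 0 ∧ PQ.2.coeff 0 ≠ 0 := by
  rw [← h.2.2.2.2, coeff_zero_twistedWronskian] at hS
  exact ⟨left_ne_zero_of_mul (right_ne_zero_of_mul hS),
    right_ne_zero_of_mul (right_ne_zero_of_mul hS)⟩

theorem not_X_dvd_of_mem_wronskianFiber {p q : ℕ} {β : ℂ} {S : ℂ[X]} {PQ : ℂ[X] × ℂ[X]}
    (h : PQ ∈ wronskianFiber p q β S) : (p = 0 → ¬ X ∣ PQ.1) ∧ (q = 0 → ¬ X ∣ PQ.2) := by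
  obtain ⟨hP, hQ, hp, hq, -⟩ := h
  constructor
  · rintro rfl hX
    rw [hP.natDegree_eq_zero.1 hp] at hX
    exact not_isUnit_X (isUnit_of_dvd_one hX)
  · rintro rfl hX
    rw [hQ.natDegree_eq_zero.1 hq] at hX
    exact not_isUnit_X (isUnit_of_dvd_one hX)

theorem exists_generic_left_part {p q n : ℕ} {β : ℂ} (hβ : ∀ m : ℤ, (m : ℂ) + β ≠ 0) (d : ℕ)
    (hd : p = 0 → d = 0) (h : ∀ p', p = p' + 1 → HasGenericFiber p' q n (β + 1) d) :
    ∃ D : MvPolynomial (Fin n) ℂ, D ≠ 0 ∧ ∀ y, MvPolynomial.eval y D ≠ 0 →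
      (leadPoly ((p : ℂ) - q + β) y).coeff 0 ≠ 0 →
      {PQ ∈ wronskianFiber p q β (X * leadPoly ((p : ℂ) - q + β) y) | X ∣ PQ.1}.ncard = d ∧
      ∀ PQ ∈ wronskianFiber p q β (X * leadPoly ((p : ℂ) - q + β) y), X ∣ PQ.1 →
        IsRegularPair p q β PQ := by
  cases p with
  | zero =>
    refine ⟨1, one_ne_zero, fun y _ _ => ⟨?_, fun PQ hPQ hX =>
      absurd hX ((not_X_dvd_of_mem_wronskianFiber hPQ).1 rfl)⟩⟩
    rw [hd rfl]
    refine (congrArg Set.ncard ?_).trans (Set.ncard_empty (ℂ[X] × ℂ[X]))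
    ext PQ
    exact ⟨fun hPQ => (not_X_dvd_of_mem_wronskianFiber hPQ.1).1 rfl hPQ.2, fun h => h.elim⟩
  | succ p =>
    obtain ⟨D, hD0, hD⟩ := h p rfl
    refine ⟨D, hD0, fun y hy hy0 => ?_⟩
    have hc : ((p + 1 : ℕ) : ℂ) - q + β = (p : ℂ) - q + (β + 1) := by push_cast; ring
    rw [hc] at hy0 ⊢
    obtain ⟨hcard, hreg⟩ := hD y hy
    have himg := wronskianFiber_X_mul_left p q β (leadPoly ((p : ℂ) - q + (β + 1)) y)
    refine ⟨?_, fun PQ hPQ hX => ?_⟩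
    · rw [himg, Set.ncard_image_of_injective _ ?_, hcard]
      rintro ⟨P, Q⟩ ⟨P', Q'⟩ h
      obtain ⟨h1, rfl⟩ := Prod.mk.inj h
      exact Prod.ext (mul_left_cancel₀ X_ne_zero h1) rfl
    · have hmem := himg.le ⟨hPQ, hX⟩
      obtain ⟨⟨P, Q⟩, hPQ', rfl⟩ := hmem
      exact (hreg _ hPQ').X_mul_left (by simpa using hβ 0)
        (coeff_zero_ne_zero_of_mem_wronskianFiber hy0 hPQ').2

theorem exists_generic_right_part {p q n : ℕ} {β : ℂ} (hβ : ∀ m : ℤ, (m : ℂ) + β ≠ 0) (d : ℕ)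
    (hd : q = 0 → d = 0) (h : ∀ q', q = q' + 1 → HasGenericFiber p q' n (β - 1) d) :
    ∃ D : MvPolynomial (Fin n) ℂ, D ≠ 0 ∧ ∀ y, MvPolynomial.eval y D ≠ 0 →
      (leadPoly ((p : ℂ) - q + β) y).coeff 0 ≠ 0 →
      {PQ ∈ wronskianFiber p q β (X * leadPoly ((p : ℂ) - q + β) y) | X ∣ PQ.2}.ncard = d ∧
      ∀ PQ ∈ wronskianFiber p q β (X * leadPoly ((p : ℂ) - q + β) y), X ∣ PQ.2 →
        IsRegularPair p q β PQ := by
  cases q with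
  | zero =>
    refine ⟨1, one_ne_zero, fun y _ _ => ⟨?_, fun PQ hPQ hX =>
      absurd hX ((not_X_dvd_of_mem_wronskianFiber hPQ).2 rfl)⟩⟩
    rw [hd rfl]
    refine (congrArg Set.ncard ?_).trans (Set.ncard_empty (ℂ[X] × ℂ[X]))
    ext PQ
    exact ⟨fun hPQ => (not_X_dvd_of_mem_wronskianFiber hPQ.1).2 rfl hPQ.2, fun h => h.elim⟩
  | succ q =>
    obtain ⟨D, hD0, hD⟩ := h q rfl
    refine ⟨D, hD0, fun y hy hy0 => ?_⟩
    have hc : (p : ℂ) - ((q + 1 : ℕ) : ℂ) + β = (p : ℂ) - q + (β - 1) := by push_cast; ring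
    rw [hc] at hy0 ⊢
    obtain ⟨hcard, hreg⟩ := hD y hy
    have himg := wronskianFiber_X_mul_right p q β (leadPoly ((p : ℂ) - q + (β - 1)) y)
    refine ⟨?_, fun PQ hPQ hX => ?_⟩
    · rw [himg, Set.ncard_image_of_injective _ ?_, hcard]
      rintro ⟨P, Q⟩ ⟨P', Q'⟩ h
      obtain ⟨rfl, h2⟩ := Prod.mk.inj h
      exact Prod.ext rfl (mul_left_cancel₀ X_ne_zero h2)
    · have hmem := himg.le ⟨hPQ, hX⟩
      obtain ⟨⟨P, Q⟩, hPQ', rfl⟩ := hmem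
      exact (hreg _ hPQ').X_mul_right (by simpa using hβ 0)
        (coeff_zero_ne_zero_of_mem_wronskianFiber hy0 hPQ').1

theorem exists_generic_coeff_zero_leadPoly {c : ℂ} (hc : c ≠ 0) (n : ℕ) :
    ∃ D : MvPolynomial (Fin n) ℂ, D ≠ 0 ∧ ∀ y, MvPolynomial.eval y D ≠ 0 →
      (leadPoly c y).coeff 0 ≠ 0 := by
  cases n with
  | zero => exact ⟨1, one_ne_zero, fun y _ => by simpa [coeff_leadPoly] using hc⟩
  | succ n =>
    refine ⟨MvPolynomial.X 0, MvPolynomial.X_ne_zero _, fun y hy => ?_⟩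
    simpa [coeff_leadPoly] using hy

theorem exists_eval_ne_zero {σ : Type*} {D : MvPolynomial σ ℂ} (hD : D ≠ 0) :
    ∃ y, MvPolynomial.eval y D ≠ 0 := by
  by_contra! h
  exact hD (MvPolynomial.funext fun y => by rw [h y, map_zero])

theorem hasGenericFiber_choose (n : ℕ) : ∀ (p q : ℕ) (β : ℂ), p + q = n →
    (∀ m : ℤ, (m : ℂ) + β ≠ 0) → HasGenericFiber p q n β (n.choose p) := by
  induction n with
  | zero =>
    intro p q β hpq _
    obtain ⟨rfl, rfl⟩ := Nat.add_eq_zero_iff.1 hpq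
    refine ⟨1, one_ne_zero, fun y _ => ⟨?_, fun PQ _ u w hu hw _ => ?_⟩⟩
    · rw [Nat.choose_self, Set.ncard_eq_one]
      refine ⟨(1, 1), Set.eq_singleton_iff_unique_mem.2 ⟨⟨monic_one, monic_one, natDegree_one,
        natDegree_one, ?_⟩, ?_⟩⟩
      · simp [twistedWronskian, leadPoly, lowPoly]
      · rintro ⟨P, Q⟩ ⟨hP, hQ, hp, hq, -⟩
        exact Prod.ext (hP.natDegree_eq_zero.1 hp) (hQ.natDegree_eq_zero.1 hq)
    · simpa [Nat.WithBot.lt_zero_iff] using And.intro hu hw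
  | succ n ih =>
    intro p q β hpq hβ
    obtain ⟨D₁, hD₁, h₁⟩ := exists_generic_left_part (p := p) (q := q) (n := n) hβ
      ((n + 1).choose p - n.choose p) (by rintro rfl; simp) (by
        rintro p' rfl
        rw [Nat.choose_succ_succ, Nat.add_sub_cancel]
        exact ih p' q (β + 1) (by omega) fun m => by
          simpa [add_assoc, add_comm (1 : ℂ)] using hβ (m + 1))
    obtain ⟨D₂, hD₂, h₂⟩ := exists_generic_right_part (p := p) (q := q) (n := n) hβ
      (n.choose p) (fun hq => Nat.choose_eq_zero_of_lt (by omega)) (by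
        rintro q' rfl
        exact ih p q' (β - 1) (by omega) fun m => by
          have := hβ (m - 1)
          push_cast at this
          convert this using 1
          ring)
    have hc : (p : ℂ) - q + β ≠ 0 := by simpa using hβ (p - q)
    obtain ⟨D₀, hD₀, h₀⟩ := exists_generic_coeff_zero_leadPoly hc n
    obtain ⟨y, hy⟩ := exists_eval_ne_zero (mul_ne_zero hD₀ (mul_ne_zero hD₁ hD₂))
    rw [map_mul, map_mul, mul_ne_zero_iff, mul_ne_zero_iff] at hy
    have hy0 := h₀ y hy.1
    obtain ⟨hcard₁, hreg₁⟩ := h₁ y hy.2.1 hy0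
    obtain ⟨hcard₂, hreg₂⟩ := h₂ y hy.2.2 hy0
    set S := leadPoly ((p : ℂ) - q + β) y with hS
    have hβ0 : β ≠ 0 := by simpa using hβ 0
    have hdvd : ∀ PQ ∈ wronskianFiber p q β (X * S), X ∣ PQ.1 ∨ X ∣ PQ.2 := by
      rintro PQ ⟨-, -, -, -, hW⟩
      have := congrArg (fun f => f.coeff 0) hW
      simpa [coeff_zero_twistedWronskian, hβ0, X_dvd_iff] using this
    have hunion : wronskianFiber p q β (X * S) =
        {PQ ∈ wronskianFiber p q β (X * S) | X ∣ PQ.1} ∪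
          {PQ ∈ wronskianFiber p q β (X * S) | X ∣ PQ.2} := by
      rw [← Set.sep_or]
      exact (Set.sep_eq_self_iff_mem_true.2 hdvd).symm
    have hdisj : Disjoint {PQ ∈ wronskianFiber p q β (X * S) | X ∣ PQ.1}
        {PQ ∈ wronskianFiber p q β (X * S) | X ∣ PQ.2} := by
      rw [Set.disjoint_left]
      rintro ⟨P, Q⟩ ⟨⟨-, -, -, -, hW⟩, hP⟩ ⟨-, hQ⟩
      obtain ⟨P, rfl⟩ := hP
      dsimp only at hW hQ
      rw [twistedWronskian_X_mul_left] at hW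
      refine hy0 ?_
      rw [← mul_left_cancel₀ X_ne_zero hW, coeff_zero_twistedWronskian, X_dvd_iff.1 hQ]
      simp
    have hfin₁ : {PQ ∈ wronskianFiber p q β (X * S) | X ∣ PQ.1}.Finite := by
      rcases Nat.eq_zero_or_pos p with hp | hp
      · exact Set.finite_empty.subset fun PQ hPQ =>
          (not_X_dvd_of_mem_wronskianFiber hPQ.1).1 hp hPQ.2
      · refine Set.finite_of_ncard_ne_zero ?_
        obtain ⟨p, rfl⟩ := Nat.exists_eq_add_of_lt hp
        rw [hcard₁, zero_add, Nat.choose_succ_succ, Nat.add_sub_cancel]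
        exact (Nat.choose_pos (by omega)).ne'
    have hfin₂ : {PQ ∈ wronskianFiber p q β (X * S) | X ∣ PQ.2}.Finite := by
      rcases Nat.eq_zero_or_pos q with hq | hq
      · exact Set.finite_empty.subset fun PQ hPQ =>
          (not_X_dvd_of_mem_wronskianFiber hPQ.1).2 hq hPQ.2
      · refine Set.finite_of_ncard_ne_zero ?_
        rw [hcard₂]
        exact (Nat.choose_pos (by omega)).ne'
    have hcard : (wronskianFiber p q β (X * S)).ncard = (n + 1).choose p := by
      rw [hunion, Set.ncard_union_eq hdisj hfin₁ hfin₂, hcard₁, hcard₂]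
      exact Nat.sub_add_cancel (Nat.choose_le_choose p n.le_succ)
    have hcons : X * S = leadPoly ((p : ℂ) - q + β) (Fin.cons 0 y : Fin (n + 1) → ℂ) :=
      (leadPoly_cons_zero _ _).symm
    rw [hcons] at hcard hdvd hreg₁ hreg₂
    obtain ⟨D, hD, h⟩ := exists_generic_ncard_wronskianFiber hpq hβ (Fin.cons 0 y)
      fun PQ hPQ => (hdvd PQ hPQ).elim (hreg₁ PQ hPQ) (hreg₂ PQ hPQ)
    exact ⟨D, hD, fun z hz => ⟨(h z hz).1.trans hcard, (h z hz).2⟩⟩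

/-- Clearing the denominators of a polynomial after the substitution `yᵢ = c aᵢ / aₙ`. -/
theorem exists_eval_eq_pow_mul_eval_div {n : ℕ} (D : MvPolynomial (Fin n) ℂ) (c : ℂ) :
    ∃ (k : ℕ) (D' : MvPolynomial (Fin (n + 1)) ℂ), ∀ a : Fin (n + 1) → ℂ, a (Fin.last n) ≠ 0 →
      MvPolynomial.eval a D' = a (Fin.last n) ^ k *
        MvPolynomial.eval (fun i => c * a i.castSucc / a (Fin.last n)) D := by
  induction D using MvPolynomial.induction_on with
  | C z => exact ⟨0, MvPolynomial.C z, fun a _ => by simp⟩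
  | add f g hf hg =>
    obtain ⟨k, f', hf⟩ := hf
    obtain ⟨l, g', hg⟩ := hg
    refine ⟨k + l, MvPolynomial.X (Fin.last n) ^ l * f' + MvPolynomial.X (Fin.last n) ^ k * g',
      fun a ha => ?_⟩
    simp only [map_add, map_mul, map_pow, MvPolynomial.eval_X, hf a ha, hg a ha]
    ring
  | mul_X f i hf =>
    obtain ⟨k, f', hf⟩ := hf
    refine ⟨k + 1, MvPolynomial.C c * (f' * MvPolynomial.X i.castSucc), fun a ha => ?_⟩
    simp only [map_mul, MvPolynomial.eval_X, MvPolynomial.eval_C, hf a ha]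
    field_simp
    ring

/-- The pairs whose twisted Wronskian is proportional to a polynomial of exact degree `p + q` are
those of exact degrees `p` and `q` with a prescribed twisted Wronskian. -/
theorem setOf_twistedWronskian_proportional {p q : ℕ} {β : ℂ} (hc : (p : ℂ) - q + β ≠ 0)
    (a : Fin (p + q + 1) → ℂ) (ha : a (Fin.last (p + q)) ≠ 0) :
    {PQ : ℂ[X] × ℂ[X] | PQ.1.Monic ∧ PQ.2.Monic ∧ PQ.1.natDegree ≤ p ∧ PQ.2.natDegree ≤ q ∧
      ∃ c : ℂ, c ≠ 0 ∧ twistedWronskian β PQ.1 PQ.2 =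
        C c * ∑ i : Fin (p + q + 1), C (a i) * X ^ (i : ℕ)} =
      wronskianFiber p q β (leadPoly ((p : ℂ) - q + β)
        fun i => ((p : ℂ) - q + β) * a i.castSucc / a (Fin.last (p + q))) := by
  have hsum : ∀ c : ℂ, C c * ∑ i : Fin (p + q + 1), C (a i) * X ^ (i : ℕ) =
      leadPoly (c * a (Fin.last (p + q))) fun i => c * a i.castSucc := by
    intro c
    rw [Fin.sum_univ_castSucc, mul_add, add_comm, leadPoly, lowPoly, Finset.mul_sum]
    simp [mul_assoc]
  ext ⟨P, Q⟩
  constructor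
  · rintro ⟨hP, hQ, hp, hq, c, hc0, hW⟩
    dsimp only at hP hQ hp hq hW
    rw [hsum] at hW
    have hlead := congrArg (fun f => f.coeff (p + q)) hW
    simp only [coeff_add_twistedWronskian β hp hq, coeff_leadPoly, lt_irrefl, dite_false,
      if_true] at hlead
    have hne : P.coeff p * Q.coeff q ≠ 0 := fun h0 =>
      mul_ne_zero hc0 ha (by rw [← hlead, h0, mul_zero])
    have hp' : P.natDegree = p := le_antisymm hp (le_natDegree_of_ne_zero (left_ne_zero_of_mul hne))
    have hq' : Q.natDegree = q := le_antisymm hq (le_natDegree_of_ne_zero (right_ne_zero_of_mul hne))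
    have hP1 : P.coeff p = 1 := hp' ▸ hP.coeff_natDegree
    have hQ1 : Q.coeff q = 1 := hq' ▸ hQ.coeff_natDegree
    rw [hP1, hQ1, mul_one, mul_one] at hlead
    refine ⟨hP, hQ, hp', hq', hW.trans ?_⟩
    rw [hlead]
    congr 1
    funext i
    field_simp
  · rintro ⟨hP, hQ, hp, hq, hW⟩
    refine ⟨hP, hQ, hp.le, hq.le, ((p : ℂ) - q + β) / a (Fin.last (p + q)), div_ne_zero hc ha, ?_⟩
    rw [hW, hsum, div_mul_cancel₀ _ ha]
    congr 1
    funext i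
    ring

theorem intCast_add_ofReal_ne_zero {α : ℝ} (hα : α ∈ Set.Ioo (0 : ℝ) 1) (m : ℤ) :
    (m : ℂ) + (α : ℂ) ≠ 0 := by
  intro h
  have h' : (m : ℝ) + α = 0 := by exact_mod_cast h
  have h1 : (m : ℝ) < 0 := by linarith [hα.1]
  have h2 : (-1 : ℝ) < m := by linarith [hα.2]
  have h3 : m < 0 := by exact_mod_cast h1
  have h4 : -1 < m := by exact_mod_cast h2
  omega

/-- The degree of the map `W_α : P^p × P^q → P^{p+q}`,
`(P,Q) ↦ z(P'Q - PQ') + αPQ`, equals `C(p+q, p)`: there is a nonzero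
polynomial condition `D` on the coefficients `a = (a_0, …, a_{p+q})` of the
target polynomial `R = Σ a_i z^i` such that whenever `D(a) ≠ 0` the fiber of
`W_α` over the projective class of `R` (represented by pairs of monic
polynomials, i.e. projective classes) has exactly `C(p+q, p)` elements. -/
theorem W_alpha_degree (p q : ℕ) (α : ℝ) (hα : α ∈ Set.Ioo (0 : ℝ) 1) :
    ∃ D : MvPolynomial (Fin (p + q + 1)) ℂ, D ≠ 0 ∧
      ∀ a : Fin (p + q + 1) → ℂ, MvPolynomial.eval a D ≠ 0 →
        Nat.card {PQ : Polynomial ℂ × Polynomial ℂ //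
          PQ.1.Monic ∧ PQ.2.Monic ∧ PQ.1.natDegree ≤ p ∧ PQ.2.natDegree ≤ q ∧
          ∃ c : ℂ, c ≠ 0 ∧
            X * (derivative PQ.1 * PQ.2 - PQ.1 * derivative PQ.2)
              + C (α : ℂ) * (PQ.1 * PQ.2)
            = C c * ∑ i : Fin (p + q + 1), C (a i) * X ^ (i : ℕ)}
          = (p + q).choose p := by
  have hβ := intCast_add_ofReal_ne_zero hα
  have hc : (p : ℂ) - q + α ≠ 0 := by simpa using hβ (p - q)
  obtain ⟨D, hD0, hD⟩ := hasGenericFiber_choose (p + q) p q α rfl hβ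
  obtain ⟨k, D', hD'⟩ := exists_eval_eq_pow_mul_eval_div D ((p : ℂ) - q + α)
  refine ⟨D' * MvPolynomial.X (Fin.last (p + q)), ?_, fun a ha => ?_⟩
  · obtain ⟨y, hy⟩ := exists_eval_ne_zero hD0
    intro h
    have h' := congrArg (MvPolynomial.eval (Fin.snoc y ((p : ℂ) - q + α) : Fin (p + q + 1) → ℂ)) h
    rw [map_mul, hD' _ (by simpa using hc)] at h'
    simp [hc, hy] at h'
  · rw [map_mul, MvPolynomial.eval_X, mul_ne_zero_iff] at ha
    obtain ⟨ha1, ha2⟩ := ha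
    rw [hD' a ha2] at ha1
    refine Eq.trans ?_ (hD _ (right_ne_zero_of_mul ha1)).1
    rw [← setOf_twistedWronskian_proportional hc a ha2]
    rfl
end

section
/- For symmetric chord diagrams with ν even (ν = number of crossing edges), E(m₀, m₁, …, m_{n-2}, m_{n-1}) = E(m₀ + 2, m₁, …, m_{n-2}, m_{n-1} + 2). -/
/-- Vertex of the end in position `x`, for a diagram whose consecutive
vertices have the degrees listed in `L`. -/
def vertexOf : List ℕ → ℕ → ℕ
  | [], _ => 0
  | m :: L, x => if x < m then 0 else vertexOf L (x - m) + 1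

/-- A chord diagram on a set of linearly ordered arc-ends with vertex degree
list `L`: a fixed-point-free noncrossing involution joining ends at distinct
vertices. -/
def IsChordDiagram (L : List ℕ) (σ : Equiv.Perm (Fin L.sum)) : Prop :=
  (∀ i, σ (σ i) = i) ∧ (∀ i, σ i ≠ i) ∧
  (∀ i j, ¬(i < j ∧ j < σ i ∧ σ i < σ j)) ∧
  ∀ i : Fin L.sum, vertexOf L (i : ℕ) ≠ vertexOf L ((σ i : ℕ))

/-- The reflection `z ↦ -z̄` on the circle of `N` arc-ends, the first `m₀` of
which sit at the vertex `0`:  `x ↦ (m₀ - 1 - x) mod N`. -/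
def reflEnd (m₀ : ℕ) {N : ℕ} (x : Fin N) : Fin N :=
  ⟨(m₀ + N - 1 - (x : ℕ)) % N, Nat.mod_lt _ x.pos⟩

/-- The degree list of a symmetric diagram: `m₀` ends at `0`, the positive
vertices `L`, `minf` ends at `∞`, then the mirror (negative) vertices. -/
def symList (m₀ : ℕ) (L : List ℕ) (minf : ℕ) : List ℕ :=
  m₀ :: (L ++ minf :: L.reverse)

/-- The number `ν` of crossing edges (edges with one positive and one
negative endpoint) of a symmetric chord diagram. -/
noncomputable def crossNum (m₀ : ℕ) (L : List ℕ) (minf : ℕ)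
    (σ : Equiv.Perm (Fin (symList m₀ L minf).sum)) : ℕ :=
  Nat.card {x : Fin (symList m₀ L minf).sum //
    m₀ ≤ (x : ℕ) ∧ (x : ℕ) < m₀ + L.sum ∧ m₀ + L.sum + minf ≤ ((σ x : ℕ))}

/-- The number of chord diagrams symmetric under `z ↦ -z̄`, with degrees `m₀`
at `0`, `minf` at `∞`, `L` at the positive vertices, and an even number `ν`
of crossing edges. -/
noncomputable def symCountEvenCross (m₀ : ℕ) (L : List ℕ) (minf : ℕ) : ℕ :=
  Nat.card {σ : Equiv.Perm (Fin (symList m₀ L minf).sum) //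
    IsChordDiagram (symList m₀ L minf) σ ∧
    (∀ i, σ (reflEnd m₀ i) = reflEnd m₀ (σ i)) ∧
    Even (crossNum m₀ L minf σ)}

/-- `V` labels the points of the line by vertices: negative points lie at the vertex `0`,
points of `[0, S)` at the vertices `1, …, n`, and the others at the vertex `n + 1`. -/
structure IsVertexMap (S n : ℤ) (V : ℤ → ℤ) : Prop where
  mono : Monotone V
  nonneg : 0 ≤ S
  neg : ∀ x, x < 0 → V x = 0
  mid : ∀ x, 0 ≤ x → x < S → 1 ≤ V x ∧ V x ≤ n
  top : ∀ x, S ≤ x → V x = n + 1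
  len_nonneg : 0 ≤ n

/-- The right half of a symmetric diagram, as an involution of `ℤ` supported in `[-a, S + b)`.
The fixed points in `[0, S)` are the ends of the crossing edges. -/
structure IsHalf (S : ℤ) (V : ℤ → ℤ) (a b : ℤ) (τ : ℤ → ℤ) : Prop where
  inv : ∀ x, τ (τ x) = x
  out : ∀ x, x < -a ∨ S + b ≤ x → τ x = x
  nofix : ∀ x, (-a ≤ x ∧ x < 0) ∨ (S ≤ x ∧ x < S + b) → τ x ≠ x
  nest : ∀ x y, x < y → y < τ x → τ y ≠ y ∧ x < τ y ∧ τ y < τ x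
  vert : ∀ x, τ x ≠ x → V x ≠ V (τ x)
  even : Even {x | 0 ≤ x ∧ x < S ∧ τ x = x}.ncard

/-- Delete the points `A` and `B`, turning their partners into fixed points. -/
def shrink (A B : ℤ) (τ : ℤ → ℤ) (x : ℤ) : ℤ :=
  if τ x = A ∨ τ x = B ∨ x = A ∨ x = B then x else τ x

section Half

variable {S n a b : ℤ} {V τ : ℤ → ℤ}

lemma fixed_finite (S : ℤ) (τ : ℤ → ℤ) : {x | 0 ≤ x ∧ x < S ∧ τ x = x}.Finite :=
  (Set.finite_Ico 0 S).subset fun _ hx => ⟨hx.1, hx.2.1⟩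

lemma IsHalf.range (h : IsHalf S V a b τ) (x : ℤ) (h1 : -a ≤ x) (h2 : x < S + b) :
    -a ≤ τ x ∧ τ x < S + b := by
  by_contra hc
  have := h.out (τ x) (by omega)
  rw [h.inv] at this
  omega

/-- The partners of the two extreme points are either each other, or the extreme fixed points
of the shrunken diagram. -/
lemma IsHalf.extreme (hV : IsVertexMap S n V) (ha : 0 ≤ a) (hb : 0 ≤ b)
    (h : IsHalf S V (a + 1) (b + 1) τ) :
    (τ (-a - 1) = S + b ∧ ∀ x, 0 ≤ x → x < S → shrink (-a - 1) (S + b) τ x ≠ x) ∨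
    (0 ≤ τ (-a - 1) ∧ τ (-a - 1) < τ (S + b) ∧ τ (S + b) < S ∧
      ∀ x, 0 ≤ x → x < S → shrink (-a - 1) (S + b) τ x = x →
        τ (-a - 1) ≤ x ∧ x ≤ τ (S + b)) := by
  have hS := hV.nonneg
  have hA := h.nofix (-a - 1) (by omega)
  have hB := h.nofix (S + b) (by omega)
  have hAr := h.range (-a - 1) (by omega) (by omega)
  have hBr := h.range (S + b) (by omega) (by omega)
  by_cases hAB : τ (-a - 1) = S + b
  · left
    refine ⟨hAB, fun x h0 hS' => ?_⟩
    have := h.nest (-a - 1) x (by omega) (by omega)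
    unfold shrink
    split_ifs <;> omega
  · right
    have hBA : τ (S + b) ≠ -a - 1 := fun hc => hAB (by rw [← hc, h.inv])
    have hlt : τ (-a - 1) < τ (S + b) := by
      by_contra hc
      have hne : τ (-a - 1) ≠ τ (S + b) := fun he => by
        have := congrArg τ he
        rw [h.inv, h.inv] at this
        omega
      have h1 := h.nest (-a - 1) (τ (S + b)) (by omega) (by omega)
      rw [h.inv] at h1
      omega
    have vA := h.vert _ hA
    have vB := h.vert _ hB
    have m1 := hV.mono hlt.le
    have m2 := hV.mono (show τ (S + b) ≤ S + b by omega)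
    have m3 := hV.mono (show -a - 1 ≤ τ (-a - 1) by omega)
    have vA0 := hV.neg (-a - 1) (by omega)
    have vB0 := hV.top (S + b) (by omega)
    have h0 : 0 ≤ τ (-a - 1) := by
      by_contra hc
      have := hV.neg (τ (-a - 1)) (by omega)
      omega
    have h0' : τ (S + b) < S := by
      by_contra hc
      have := hV.top (τ (S + b)) (by omega)
      omega
    refine ⟨h0, hlt, h0', fun x hx0 hxS hx => ?_⟩
    constructor
    · by_contra hc
      have := h.nest (-a - 1) x (by omega) (by omega)
      unfold shrink at hx
      split_ifs at hx <;> omega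
    · by_contra hc
      have := h.nest (τ (S + b)) x (by omega) (by rw [h.inv]; omega)
      rw [h.inv] at this
      unfold shrink at hx
      split_ifs at hx <;> omega

lemma IsHalf.shrink (hV : IsVertexMap S n V) (ha : 0 ≤ a) (hb : 0 ≤ b)
    (h : IsHalf S V (a + 1) (b + 1) τ) : IsHalf S V a b (shrink (-a - 1) (S + b) τ) := by
  have hS := hV.nonneg
  have hex := h.extreme hV ha hb
  set A := -a - 1 with hA
  set B := S + b with hB
  have hiA := h.inv A
  have hiB := h.inv B
  have eqA : ∀ x, τ x = A → x = τ A := fun x hx => by rw [← hx, h.inv]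
  have eqB : ∀ x, τ x = B → x = τ B := fun x hx => by rw [← hx, h.inv]
  refine ⟨?_, ?_, ?_, ?_, ?_, ?_⟩
  · intro x
    have hi := h.inv x
    by_cases hx : τ x = A ∨ τ x = B ∨ x = A ∨ x = B
    · simp only [_root_.shrink, if_pos hx]
    · simp only [_root_.shrink, if_neg hx, hi]
      rw [if_neg (by tauto)]
  · intro x hx
    have := h.out x
    unfold _root_.shrink
    split_ifs
    · rfl
    · omega
  · intro x hx
    have := h.nofix x
    have h1 := eqA x
    have h2 := eqB x
    have h3 : τ A = B → τ B = A := fun hAB => by rw [← hAB, hiA]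
    unfold _root_.shrink
    split_ifs <;> omega
  · intro x y hxy hy
    have hx : ¬ (τ x = A ∨ τ x = B ∨ x = A ∨ x = B) := fun hc => by
      simp only [_root_.shrink, if_pos hc] at hy; omega
    simp only [_root_.shrink, if_neg hx] at hy ⊢
    have h1 := h.nest x y hxy hy
    have h2 : A ≤ x := by
      by_contra hc
      have := h.out x (by omega)
      omega
    have h3 : τ x ≤ B := by
      by_contra hc
      have := h.out (τ x) (by omega)
      rw [h.inv] at this
      omega
    rw [if_neg (by omega)]
    exact h1
  · intro x
    have := h.vert x
    unfold _root_.shrink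
    split_ifs
    · simp
    · exact this
  · rcases hex with ⟨-, hno⟩ | ⟨h0, hlt, h1, -⟩
    · have : {x | 0 ≤ x ∧ x < S ∧ _root_.shrink A B τ x = x} = ∅ := by
        ext x
        simp only [Set.mem_ofPred_eq, Set.mem_empty_iff_false, iff_false]
        exact fun ⟨u, v, w⟩ => hno x u v w
      simp [this]
    · have hset : {x | 0 ≤ x ∧ x < S ∧ _root_.shrink A B τ x = x} =
          insert (τ A) (insert (τ B) {x | 0 ≤ x ∧ x < S ∧ τ x = x}) := by
        ext x
        have e1 := eqA x
        have e2 := eqB x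
        simp only [Set.mem_ofPred_eq, Set.mem_insert_iff, _root_.shrink]
        constructor
        · rintro ⟨u, v, w⟩
          split_ifs at w <;> omega
        · rintro (rfl | rfl | ⟨u, v, w⟩)
          · simp [hiA]; omega
          · simp [hiB]; omega
          · simp [w]; omega
      have hfin := fixed_finite S τ
      have n2 : τ B ∉ {x | 0 ≤ x ∧ x < S ∧ τ x = x} := by
        rintro ⟨-, -, w⟩
        omega
      have n1 : τ A ∉ insert (τ B) {x | 0 ≤ x ∧ x < S ∧ τ x = x} := by
        rintro (w | ⟨-, -, w⟩) <;> omega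
      rw [hset, Set.ncard_insert_of_notMem n1 (hfin.insert _), Set.ncard_insert_of_notMem n2 hfin]
      have := h.even
      rw [add_assoc]
      exact this.add (by decide)

lemma shrink_injOn (hV : IsVertexMap S n V) (ha : 0 ≤ a) (hb : 0 ≤ b) :
    Set.InjOn (shrink (-a - 1) (S + b)) {τ | IsHalf S V (a + 1) (b + 1) τ} := by
  intro τ₁ h₁ τ₂ h₂ heq
  have hS := hV.nonneg
  have hex₁ := IsHalf.extreme hV ha hb h₁
  have hex₂ := IsHalf.extreme hV ha hb h₂
  rw [heq] at hex₁
  set A := -a - 1 with hA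
  set B := S + b with hB
  have hfix : ∀ τ : ℤ → ℤ, (∀ x, τ (τ x) = x) →
      shrink A B τ (τ A) = τ A ∧ shrink A B τ (τ B) = τ B := by
    intro τ h
    simp [shrink, h]
  have f₁ := hfix τ₁ h₁.inv
  have f₂ := hfix τ₂ h₂.inv
  rw [heq] at f₁
  have key : τ₁ A = τ₂ A ∧ τ₁ B = τ₂ B := by
    rcases hex₁ with ⟨u₁, v₁⟩ | ⟨u₁, v₁, w₁, z₁⟩ <;> rcases hex₂ with ⟨u₂, v₂⟩ | ⟨u₂, v₂, w₂, z₂⟩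
    · refine ⟨u₁.trans u₂.symm, ?_⟩
      have i₁ := h₁.inv A
      have i₂ := h₂.inv A
      rw [u₁] at i₁
      rw [u₂] at i₂
      rw [i₁, i₂]
    · exact absurd f₂.1 (v₁ _ u₂ (by omega))
    · exact absurd f₁.1 (v₂ _ u₁ (by omega))
    · have a1 := z₁ _ u₂ (by omega) f₂.1
      have a2 := z₂ _ u₁ (by omega) f₁.1
      have a3 := z₁ _ (by omega) w₂ f₂.2
      have a4 := z₂ _ (by omega) w₁ f₁.2
      omega
  funext x
  have hx := congrFun heq x
  have aux : ∀ τ σ : ℤ → ℤ, (∀ x, τ (τ x) = x) → (∀ x, σ (σ x) = x) → τ A = σ A → τ B = σ B →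
      τ x = A ∨ τ x = B ∨ x = A ∨ x = B → τ x = σ x := by
    rintro τ σ hτ hσ eA eB (h | h | h | h)
    · rw [h, ← hτ x, h, eA, hσ]
    · rw [h, ← hτ x, h, eB, hσ]
    · rw [h, eA]
    · rw [h, eB]
  by_cases c₁ : τ₁ x = A ∨ τ₁ x = B ∨ x = A ∨ x = B
  · exact aux _ _ h₁.inv h₂.inv key.1 key.2 c₁
  by_cases c₂ : τ₂ x = A ∨ τ₂ x = B ∨ x = A ∨ x = B
  · exact (aux _ _ h₂.inv h₁.inv key.1.symm key.2.symm c₂).symm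
  simpa only [shrink, if_neg c₁, if_neg c₂] using hx

/-- Join the point `A` to `p` and the point `B` to `q`. -/
def joinPoints (A B p q : ℤ) (τ : ℤ → ℤ) (x : ℤ) : ℤ :=
  if x = A then p else if x = B then q else if x = p then A else if x = q then B else τ x

lemma shrink_joinPoints {A B p q : ℤ} (hA : τ A = A) (hB : τ B = B) (hp : τ p = p)
    (hq : τ q = q) (hinv : ∀ x, τ (τ x) = x) : shrink A B (joinPoints A B p q τ) = τ := by
  funext x
  have e1 : τ x = A → x = A := fun h => by rw [← hinv x, h, hA]
  have e2 : τ x = B → x = B := fun h => by rw [← hinv x, h, hB]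
  simp only [shrink, joinPoints]
  grind

lemma exists_shrink_eq (hV : IsVertexMap S n V) (ha : 0 ≤ a) (hb : 0 ≤ b)
    (h : IsHalf S V a b τ) :
    ∃ τ', IsHalf S V (a + 1) (b + 1) τ' ∧ shrink (-a - 1) (S + b) τ' = τ := by
  have hS := hV.nonneg
  have hA := h.out (-a - 1) (by omega)
  have hB := h.out (S + b) (by omega)
  have hfin := fixed_finite S τ
  have range := h.range
  rcases Set.eq_empty_or_nonempty {x | 0 ≤ x ∧ x < S ∧ τ x = x} with he | hne
  · have hno : ∀ x, -a ≤ x → x < S + b → τ x ≠ x := by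
      intro x h1 h2 hx
      by_cases hc : 0 ≤ x ∧ x < S
      · have : x ∈ {x | 0 ≤ x ∧ x < S ∧ τ x = x} := ⟨hc.1, hc.2, hx⟩
        rw [he] at this
        exact this
      · exact h.nofix x (by omega) hx
    refine ⟨joinPoints (-a - 1) (S + b) (S + b) (-a - 1) τ, ⟨?_, ?_, ?_, ?_, ?_, ?_⟩,
      shrink_joinPoints hA hB hB hA h.inv⟩
    · intro x
      have := h.inv x
      simp only [joinPoints]
      grind
    · intro x hx
      have := h.out x (by omega)
      simp only [joinPoints]
      split_ifs <;> omega
    · intro x hx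
      have := hno x
      simp only [joinPoints]
      split_ifs <;> omega
    · intro x y hxy hy
      have h1 := hno x
      have h2 := hno y
      have h3 := h.nest x y hxy
      have h4 := range x
      have h5 := range y
      have h6 := h.out x
      have h7 := h.out y
      simp only [joinPoints] at hy ⊢
      split_ifs at hy ⊢ <;> omega
    · intro x hx
      have h1 := h.vert x
      have h2 := hV.neg (-a - 1) (by omega)
      have h3 := hV.top (S + b) (by omega)
      have h4 := hV.len_nonneg
      simp only [joinPoints] at hx ⊢
      split_ifs at hx ⊢ with c1 c2
      · rw [c1]; omega
      · rw [c2]; omega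
      · exact h1 hx
    · have : {x | 0 ≤ x ∧ x < S ∧ joinPoints (-a - 1) (S + b) (S + b) (-a - 1) τ x = x} = ∅ := by
        ext x
        have h1 := hno x
        simp only [Set.mem_ofPred_eq, Set.mem_empty_iff_false, iff_false, joinPoints]
        split_ifs <;> omega
      simp [this]
  · obtain ⟨p, hp, hpmin⟩ := hfin.exists_minimal hne
    obtain ⟨q, hq, hqmax⟩ := hfin.exists_maximal hne
    have hp' : ∀ y, 0 ≤ y → y < S → τ y = y → p ≤ y := fun y h1 h2 h3 => by
      have := @hpmin y ⟨h1, h2, h3⟩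
      omega
    have hq' : ∀ y, 0 ≤ y → y < S → τ y = y → y ≤ q := fun y h1 h2 h3 => by
      have := @hqmax y ⟨h1, h2, h3⟩
      omega
    obtain ⟨hp0, hpS, hpf⟩ := hp
    obtain ⟨hq0, hqS, hqf⟩ := hq
    have hpq : p < q := by
      have h1 := hp' q hq0 hqS hqf
      rcases h1.lt_or_eq with h2 | h2
      · exact h2
      · exfalso
        have : {x | 0 ≤ x ∧ x < S ∧ τ x = x} = {p} := by
          ext x
          constructor
          · rintro ⟨u, v, w⟩
            have := hp' x u v w
            have := hq' x u v w
            simp only [Set.mem_singleton_iff]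
            omega
          · rintro rfl
            exact ⟨hp0, hpS, hpf⟩
        have hev := h.even
        rw [this, Set.ncard_singleton] at hev
        exact absurd hev (by decide)
    refine ⟨joinPoints (-a - 1) (S + b) p q τ, ⟨?_, ?_, ?_, ?_, ?_, ?_⟩,
      shrink_joinPoints hA hB hpf hqf h.inv⟩
    · intro x
      have := h.inv x
      simp only [joinPoints]
      grind
    · intro x hx
      have := h.out x (by omega)
      simp only [joinPoints]
      split_ifs <;> omega
    · intro x hx
      have := h.nofix x
      simp only [joinPoints]
      split_ifs <;> omega
    · intro x y hxy hy
      have hfy := h.nofix y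
      have hpy := hp' y
      have hqy := hq' y
      have n1 := h.nest x y hxy
      have n2 := h.nest x p
      have n3 := h.nest x q
      have n4 := h.nest (τ y) p
      have n5 := h.nest (τ y) q
      have n6 := h.nest y p
      have n7 := h.nest y q
      rw [h.inv y] at n4 n5
      have h4 := range x
      have h5 := range y
      have h6 := h.out x
      have h7 := h.out y
      have e1 : τ y = p → y = p := fun h' => by rw [← h.inv y, h', hpf]
      have e2 : τ y = q → y = q := fun h' => by rw [← h.inv y, h', hqf]
      simp only [joinPoints] at hy ⊢
      split_ifs at hy ⊢ <;> omega
    · intro x hx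
      have h1 := h.vert x
      have h2 := hV.neg (-a - 1) (by omega)
      have h3 := hV.top (S + b) (by omega)
      have h4 := hV.mid p hp0 hpS
      have h5 := hV.mid q hq0 hqS
      simp only [joinPoints] at hx ⊢
      split_ifs at hx ⊢ with c1 c2 c3 c4
      · rw [c1]; omega
      · rw [c2]; omega
      · rw [c3]; omega
      · rw [c4]; omega
      · exact h1 hx
    · have hset : {x | 0 ≤ x ∧ x < S ∧ τ x = x} = insert p (insert q
          {x | 0 ≤ x ∧ x < S ∧ joinPoints (-a - 1) (S + b) p q τ x = x}) := by
        ext x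
        simp only [Set.mem_ofPred_eq, Set.mem_insert_iff, joinPoints]
        constructor
        · rintro ⟨u, v, w⟩
          split_ifs <;> omega
        · rintro (rfl | rfl | ⟨u, v, w⟩)
          · omega
          · omega
          · split_ifs at w <;> omega
      have hf := fixed_finite S (joinPoints (-a - 1) (S + b) p q τ)
      have n2 : q ∉ {x | 0 ≤ x ∧ x < S ∧ joinPoints (-a - 1) (S + b) p q τ x = x} := by
        rintro ⟨-, -, w⟩
        simp only [joinPoints] at w
        split_ifs at w <;> omega
      have n1 : p ∉ insert q {x | 0 ≤ x ∧ x < S ∧ joinPoints (-a - 1) (S + b) p q τ x = x} := by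
        rintro (w | ⟨-, -, w⟩)
        · omega
        · simp only [joinPoints] at w
          split_ifs at w <;> omega
      have hev := h.even
      rw [hset, Set.ncard_insert_of_notMem n1 (hf.insert _),
        Set.ncard_insert_of_notMem n2 hf] at hev
      rw [Nat.even_add_one, Nat.even_add_one, not_not] at hev
      exact hev

theorem card_isHalf_add_one (hV : IsVertexMap S n V) (ha : 0 ≤ a) (hb : 0 ≤ b) :
    Nat.card {τ // IsHalf S V a b τ} = Nat.card {τ // IsHalf S V (a + 1) (b + 1) τ} := by
  symm
  refine Nat.card_eq_of_bijective
    (fun τ => ⟨shrink (-a - 1) (S + b) τ.1, τ.2.shrink hV ha hb⟩) ⟨?_, ?_⟩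
  · intro τ₁ τ₂ h
    exact Subtype.ext (shrink_injOn hV ha hb τ₁.2 τ₂.2 (congrArg Subtype.val h))
  · rintro ⟨τ, h⟩
    obtain ⟨τ', h', e⟩ := exists_shrink_eq hV ha hb h
    exact ⟨⟨τ', h'⟩, Subtype.ext e⟩

end Half

/-- The vertex of a point of the unfolded line: the reflection `x ↦ 2 * M - 1 - x` exchanges the
right half `x < M` and the left half. -/
def foldVertex (n M : ℤ) (V : ℤ → ℤ) (x : ℤ) : ℤ :=
  if x < M then V x else if 2 * M ≤ x then 0 else 2 * n + 2 - V (2 * M - 1 - x)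

/-- A symmetric diagram with an even number of crossing edges, cut open in the middle of the
vertex `0`, as an involution of `ℤ` supported in `[-a, 2 * (S + b) + a)`. -/
structure IsFull (S n : ℤ) (V : ℤ → ℤ) (a b : ℤ) (s : ℤ → ℤ) : Prop where
  inv : ∀ x, s (s x) = x
  out : ∀ x, x < -a ∨ 2 * (S + b) + a ≤ x → s x = x
  nofix : ∀ x, -a ≤ x → x < 2 * (S + b) + a → s x ≠ x
  nest : ∀ x y, x < y → y < s x → x < s y ∧ s y < s x
  vert : ∀ x, -a ≤ x → x < 2 * (S + b) + a →
    foldVertex n (S + b) V x ≠ foldVertex n (S + b) V (s x)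
  symm : ∀ x, s (2 * (S + b) - 1 - x) = 2 * (S + b) - 1 - s x
  even : Even {x | 0 ≤ x ∧ x < S ∧ S + 2 * b ≤ s x ∧ s x < 2 * (S + b)}.ncard

/-- Restrict an involution to the points of `[-a, M)` whose partner is less than `M`. -/
def foldHalf (a M : ℤ) (s : ℤ → ℤ) (x : ℤ) : ℤ :=
  if -a ≤ x ∧ x < M ∧ s x < M then s x else x

/-- Double an involution of `[-a, M)`, joining every fixed point to its mirror image. -/
def unfoldHalf (a M : ℤ) (τ : ℤ → ℤ) (x : ℤ) : ℤ :=
  if x < -a ∨ 2 * M + a ≤ x then x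
  else if x < M then if τ x = x then 2 * M - 1 - x else τ x
  else if τ (2 * M - 1 - x) = 2 * M - 1 - x then 2 * M - 1 - x
  else 2 * M - 1 - τ (2 * M - 1 - x)

section Fold

variable {S n a b : ℤ} {V τ s : ℤ → ℤ}

lemma IsFull.range (h : IsFull S n V a b s) (x : ℤ) (h1 : -a ≤ x) (h2 : x < 2 * (S + b) + a) :
    -a ≤ s x ∧ s x < 2 * (S + b) + a := by
  by_contra hc
  have := h.out (s x) (by omega)
  rw [h.inv] at this
  omega

/-- An edge joining the two halves is symmetric. -/
lemma IsFull.eq_refl (h : IsFull S n V a b s) (x : ℤ) (h2 : x < S + b)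
    (h3 : S + b ≤ s x) : s x = 2 * (S + b) - 1 - x := by
  have e := h.symm x
  have i := h.inv x
  rcases lt_trichotomy x (2 * (S + b) - 1 - s x) with hlt | heq | hlt
  · have e' := h.symm (s x)
    rw [i] at e'
    have := h.nest x (2 * (S + b) - 1 - s x) hlt (by omega)
    omega
  · omega
  · have e' := h.symm (s x)
    rw [i] at e'
    have := h.nest (2 * (S + b) - 1 - s x) x hlt (by omega)
    omega

/-- An edge joining the two halves ends at a positive vertex. -/
lemma IsFull.pos_of_cross (hV : IsVertexMap S n V)
    (h : IsFull S n V a b s) (x : ℤ) (h2 : x < S + b) (h3 : S + b ≤ s x) : 0 ≤ x ∧ x < S := by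
  have hS := hV.nonneg
  have e := h.eq_refl x h2 h3
  have h1 : -a ≤ x := by
    by_contra hc
    have := h.out x (by omega)
    omega
  have hv := h.vert x h1 (by omega)
  rw [e, foldVertex, foldVertex, if_pos h2, if_neg (by omega)] at hv
  by_contra hc
  rcases (by omega : x < 0 ∨ S ≤ x) with c | c
  · rw [if_pos (by omega), hV.neg x c] at hv
    exact hv rfl
  · rw [if_neg (by omega), show 2 * (S + b) - 1 - (2 * (S + b) - 1 - x) = x by ring,
      hV.top x c] at hv
    omega

lemma IsFull.foldHalf (hV : IsVertexMap S n V) (ha : 0 ≤ a) (hb : 0 ≤ b)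
    (h : IsFull S n V a b s) : IsHalf S V a b (foldHalf a (S + b) s) := by
  have hS := hV.nonneg
  refine ⟨?_, ?_, ?_, ?_, ?_, ?_⟩
  · intro x
    have hi := h.inv x
    have hr := h.range x
    by_cases hx : -a ≤ x ∧ x < S + b ∧ s x < S + b
    · simp only [_root_.foldHalf, if_pos hx, hi]
      rw [if_pos (by omega)]
    · simp only [_root_.foldHalf, if_neg hx]
  · intro x hx
    unfold _root_.foldHalf
    rw [if_neg (by omega)]
  · intro x hx
    have h1 := h.nofix x
    have h2 := h.pos_of_cross hV x
    unfold _root_.foldHalf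
    split_ifs <;> omega
  · intro x y hxy hy
    have hx : -a ≤ x ∧ x < S + b ∧ s x < S + b := by
      by_contra hc
      simp only [_root_.foldHalf, if_neg hc] at hy
      omega
    simp only [_root_.foldHalf, if_pos hx] at hy ⊢
    have h1 := h.nest x y hxy hy
    rw [if_pos (by omega)]
    exact ⟨h.nofix y (by omega) (by omega), h1⟩
  · intro x hx
    by_cases hc : -a ≤ x ∧ x < S + b ∧ s x < S + b
    · simp only [_root_.foldHalf, if_pos hc]
      have := h.vert x hc.1 (by omega)
      rwa [foldVertex, foldVertex, if_pos hc.2.1, if_pos hc.2.2] at this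
    · simp [_root_.foldHalf, if_neg hc] at hx
  · have : {x | 0 ≤ x ∧ x < S ∧ _root_.foldHalf a (S + b) s x = x} =
        {x | 0 ≤ x ∧ x < S ∧ S + 2 * b ≤ s x ∧ s x < 2 * (S + b)} := by
      ext x
      have h1 := h.nofix x
      have h2 := h.eq_refl x
      simp only [Set.mem_ofPred_eq, _root_.foldHalf]
      split_ifs <;> omega
    rw [this]
    exact h.even

lemma foldVertex_refl (hV : IsVertexMap S n V) (x y : ℤ) (hx : x < S + b)
    (hy : y < S + b) (hne : V x ≠ V y) :
    foldVertex n (S + b) V (2 * (S + b) - 1 - x) ≠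
      foldVertex n (S + b) V (2 * (S + b) - 1 - y) := by
  have hS := hV.nonneg
  have hn := hV.len_nonneg
  have x1 := hV.neg x
  have x2 := hV.mid x
  have x3 := hV.top x
  have y1 := hV.neg y
  have y2 := hV.mid y
  have y3 := hV.top y
  simp only [foldVertex, sub_sub_cancel]
  split_ifs <;> omega

lemma foldVertex_cross (hV : IsVertexMap S n V) (hb : 0 ≤ b) (x : ℤ) (hx0 : 0 ≤ x)
    (hx : x < S) : foldVertex n (S + b) V x ≠ foldVertex n (S + b) V (2 * (S + b) - 1 - x) := by
  have x2 := hV.mid x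
  simp only [foldVertex, sub_sub_cancel]
  split_ifs <;> omega

lemma IsHalf.unfoldHalf (hV : IsVertexMap S n V) (ha : 0 ≤ a) (hb : 0 ≤ b)
    (h : IsHalf S V a b τ) : IsFull S n V a b (unfoldHalf a (S + b) τ) := by
  have hS := hV.nonneg
  refine ⟨?_, ?_, ?_, ?_, ?_, ?_, ?_⟩
  · intro x
    have r1 := h.range x
    have r2 := h.range (2 * (S + b) - 1 - x)
    have i1 := h.inv x
    have i2 := h.inv (2 * (S + b) - 1 - x)
    by_cases c1 : x < -a ∨ 2 * (S + b) + a ≤ x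
    · simp [_root_.unfoldHalf, c1]
    by_cases c2 : x < S + b
    · by_cases c3 : τ x = x
      · simp only [_root_.unfoldHalf, if_neg c1, if_pos c2, if_pos c3, sub_sub_cancel]
        rw [if_neg (by omega), if_neg (by omega)]
      · simp only [_root_.unfoldHalf, if_neg c1, if_pos c2, if_neg c3, i1]
        rw [if_neg (by omega), if_pos (by omega), if_neg (by omega)]
    · by_cases c3 : τ (2 * (S + b) - 1 - x) = 2 * (S + b) - 1 - x
      · simp only [_root_.unfoldHalf, if_neg c1, if_neg c2, if_pos c3, sub_sub_cancel]
        rw [if_neg (by omega), if_pos (by omega)]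
      · simp only [_root_.unfoldHalf, if_neg c1, if_neg c2, if_neg c3, sub_sub_cancel, i2]
        rw [if_neg (by omega), if_neg (by omega), if_neg (by omega)]
  · intro x hx
    unfold _root_.unfoldHalf
    rw [if_pos hx]
  · intro x h1 h2
    unfold _root_.unfoldHalf
    split_ifs <;> omega
  · intro x y hxy hy
    have rx1 := h.range x
    have rx2 := h.range (2 * (S + b) - 1 - x)
    have ry1 := h.range y
    have ry2 := h.range (2 * (S + b) - 1 - y)
    have i1 := h.inv x
    have i2 := h.inv (2 * (S + b) - 1 - x)
    have i3 := h.inv y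
    have i4 := h.inv (2 * (S + b) - 1 - y)
    have n1 := h.nest x y hxy
    have n2 := h.nest (τ (2 * (S + b) - 1 - x)) (2 * (S + b) - 1 - y)
    have n3 := h.nest y x
    have n4 := h.nest (τ y) x
    have n5 := h.nest (2 * (S + b) - 1 - y) x
    have n6 := h.nest (τ (2 * (S + b) - 1 - y)) x
    have e1 : τ y = x → τ x = y := fun e => by rw [← e, i3]
    have e2 : τ (2 * (S + b) - 1 - y) = x → τ x = 2 * (S + b) - 1 - y := fun e => by rw [← e, i4]
    rw [i2] at n2
    rw [i3] at n4
    rw [i4] at n6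
    unfold _root_.unfoldHalf at hy ⊢
    split_ifs at hy ⊢ <;> omega
  · intro x h1 h2
    have r1 := h.range x
    have r2 := h.range (2 * (S + b) - 1 - x)
    have f1 := h.nofix x
    have f2 := h.nofix (2 * (S + b) - 1 - x)
    have key : x = 2 * (S + b) - 1 - (2 * (S + b) - 1 - x) := by ring
    unfold _root_.unfoldHalf
    split_ifs with c1 c2 c3 c4
    · omega
    · exact foldVertex_cross hV hb x (by omega) (by omega)
    · simp only [foldVertex, if_pos c2, if_pos (r1 h1 c2).2]
      exact h.vert x c3
    · have := foldVertex_cross hV hb (2 * (S + b) - 1 - x) (by omega) (by omega)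
      rw [← key] at this
      exact this.symm
    · have := foldVertex_refl hV _ _ (by omega) (r2 (by omega) (by omega)).2 (h.vert _ c4)
      rwa [← key] at this
  · intro x
    have r1 := h.range x
    have r2 := h.range (2 * (S + b) - 1 - x)
    simp only [_root_.unfoldHalf, sub_sub_cancel]
    split_ifs <;> omega
  · have : {x | 0 ≤ x ∧ x < S ∧ S + 2 * b ≤ _root_.unfoldHalf a (S + b) τ x ∧
        _root_.unfoldHalf a (S + b) τ x < 2 * (S + b)} =
        {x | 0 ≤ x ∧ x < S ∧ τ x = x} := by
      ext x
      have h1 := h.range x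
      simp only [Set.mem_ofPred_eq, _root_.unfoldHalf]
      split_ifs <;> omega
    rw [this]
    exact h.even

lemma IsHalf.fold_unfold (hV : IsVertexMap S n V) (ha : 0 ≤ a) (hb : 0 ≤ b)
    (h : IsHalf S V a b τ) : _root_.foldHalf a (S + b) (_root_.unfoldHalf a (S + b) τ) = τ := by
  have hS := hV.nonneg
  funext x
  have h1 := h.range x
  have h2 := h.out x
  simp only [_root_.foldHalf, _root_.unfoldHalf]
  split_ifs <;> omega

lemma IsFull.unfold_fold (hV : IsVertexMap S n V) (ha : 0 ≤ a) (hb : 0 ≤ b)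
    (h : IsFull S n V a b s) :
    _root_.unfoldHalf a (S + b) (_root_.foldHalf a (S + b) s) = s := by
  have hS := hV.nonneg
  funext x
  have h1 := h.nofix x
  have h1' := h.nofix (2 * (S + b) - 1 - x)
  have h2 := h.out x
  have h3 := h.eq_refl x
  have h4 := h.eq_refl (2 * (S + b) - 1 - x)
  have h5 := h.symm x
  simp only [_root_.foldHalf, _root_.unfoldHalf]
  split_ifs <;> omega

theorem card_isFull_eq (hV : IsVertexMap S n V) (ha : 0 ≤ a) (hb : 0 ≤ b) :
    Nat.card {s // IsFull S n V a b s} = Nat.card {τ // IsHalf S V a b τ} :=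
  Nat.card_congr
    { toFun := fun s => ⟨foldHalf a (S + b) s.1, s.2.foldHalf hV ha hb⟩
      invFun := fun τ => ⟨unfoldHalf a (S + b) τ.1, τ.2.unfoldHalf hV ha hb⟩
      left_inv := fun s => Subtype.ext (s.2.unfold_fold hV ha hb)
      right_inv := fun τ => Subtype.ext (τ.2.fold_unfold hV ha hb) }

end Fold

section Vertices

lemma vertexOf_of_sum_le (L : List ℕ) (x : ℕ) (h : L.sum ≤ x) : vertexOf L x = L.length := by
  induction L generalizing x with
  | nil => rfl
  | cons m L ih =>
    rw [List.sum_cons] at h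
    rw [vertexOf, if_neg (by omega), ih _ (by omega), List.length_cons]

lemma vertexOf_lt_length (L : List ℕ) (x : ℕ) (h : x < L.sum) : vertexOf L x < L.length := by
  induction L generalizing x with
  | nil => simp at h
  | cons m L ih =>
    rw [List.sum_cons] at h
    have := ih (x - m)
    rw [vertexOf, List.length_cons]
    split_ifs <;> omega

lemma vertexOf_mono (L : List ℕ) : Monotone (vertexOf L) := by
  induction L with
  | nil => exact fun _ _ _ => le_rfl
  | cons m L ih =>
    intro x y h
    have := @ih (x - m) (y - m) (by omega)
    simp only [vertexOf]
    split_ifs <;> omega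

lemma vertexOf_append (A B : List ℕ) (x : ℕ) :
    vertexOf (A ++ B) x =
      if x < A.sum then vertexOf A x else A.length + vertexOf B (x - A.sum) := by
  induction A generalizing x with
  | nil => simp
  | cons m A ih =>
    simp only [List.cons_append, vertexOf, ih, List.sum_cons, List.length_cons, Nat.sub_sub]
    split_ifs <;> omega

lemma vertexOf_reverse (L : List ℕ) (x : ℕ) (h : x < L.sum) :
    vertexOf L.reverse (L.sum - 1 - x) + vertexOf L x + 1 = L.length := by
  induction L generalizing x with
  | nil => simp at h
  | cons m L ih =>
    rw [List.sum_cons] at h ⊢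
    have hi := ih (x - m)
    rw [List.reverse_cons, vertexOf_append, List.sum_reverse, List.length_reverse,
      List.length_cons]
    simp only [vertexOf]
    rw [show L.sum - 1 - (x - m) = if x < m then L.sum - 1 else m + L.sum - 1 - x by
      split_ifs <;> omega] at hi
    split_ifs at hi ⊢ <;> omega

/-- The vertex of a point of the line, the positive vertices having degrees `L`. -/
def lineVertex (L : List ℕ) (x : ℤ) : ℤ :=
  if x < 0 then 0 else vertexOf L x.toNat + 1

lemma isVertexMap_lineVertex (L : List ℕ) : IsVertexMap L.sum L.length (lineVertex L) where
  mono x y h := by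
    have := @vertexOf_mono L x.toNat y.toNat (by omega)
    simp only [lineVertex]
    split_ifs <;> omega
  nonneg := by omega
  neg x h := if_pos h
  mid x h0 h1 := by
    have := vertexOf_lt_length L x.toNat (by omega)
    simp only [lineVertex]
    split_ifs <;> omega
  top x h := by
    rw [lineVertex, if_neg (by omega), vertexOf_of_sum_le L _ (by omega)]
  len_nonneg := by omega

/-- The position on the line of the end `p`, the circle of `N` ends being cut open in the middle
of the first `2 * a` ends. -/
def cutPos (a : ℕ) {N : ℕ} (p : Fin N) : ℤ :=
  if (p : ℕ) < a then (p : ℤ) - 2 * a + N else (p : ℤ) - 2 * a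

lemma sum_symList (a b : ℕ) (L : List ℕ) :
    (symList (2 * a) L (2 * b)).sum = 2 * (a + L.sum + b) := by
  simp only [symList, List.sum_cons, List.sum_append, List.sum_reverse]
  ring

lemma vertexOf_symList (a b : ℕ) (L : List ℕ) (i : Fin (symList (2 * a) L (2 * b)).sum) :
    (vertexOf (symList (2 * a) L (2 * b)) i : ℤ) =
      foldVertex L.length (L.sum + b) (lineVertex L) (cutPos a i) := by
  have hN := sum_symList a b L
  have hi := i.2
  have hV := isVertexMap_lineVertex L
  have hw : vertexOf (symList (2 * a) L (2 * b)) i = if (i : ℕ) < 2 * a then 0 else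
      (if (i : ℕ) - 2 * a < L.sum then vertexOf L (i - 2 * a) else
        L.length + if (i : ℕ) - 2 * a - L.sum < 2 * b then 0 else
          vertexOf L.reverse (i - 2 * a - L.sum - 2 * b) + 1) + 1 := by
    simp only [symList, vertexOf, vertexOf_append]
  have hx : cutPos a i = if (i : ℕ) < a then (i : ℤ) + 2 * (L.sum + b) else (i : ℤ) - 2 * a := by
    rw [cutPos]
    split_ifs <;> omega
  rcases lt_or_ge (i : ℕ) (2 * a) with c2 | c2
  · rw [if_pos c2] at hw
    rcases lt_or_ge (i : ℕ) a with c1 | c1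
    · rw [if_pos c1] at hx
      rw [hw, hx, foldVertex, if_neg (by omega), if_pos (by omega), Nat.cast_zero]
    · rw [if_neg (by omega)] at hx
      rw [hw, hx, foldVertex, if_pos (by omega), hV.neg _ (by omega), Nat.cast_zero]
  rw [if_neg (by omega)] at hw hx
  rw [hx, foldVertex]
  rcases lt_or_ge (i : ℕ) (2 * a + L.sum) with c3 | c3
  · rw [if_pos (by omega)] at hw
    rw [hw, if_pos (by omega), lineVertex, if_neg (by omega),
      show ((i : ℤ) - 2 * a).toNat = i - 2 * a by omega, Nat.cast_add_one]
  rw [if_neg (by omega)] at hw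
  rcases lt_or_ge (i : ℕ) (2 * a + L.sum + 2 * b) with c4 | c4
  · rw [if_pos (by omega)] at hw
    rw [hw]
    split_ifs
    · rw [hV.top _ (by omega)]
      omega
    · omega
    · rw [hV.top _ (by omega)]
      omega
  · have hr := vertexOf_reverse L (2 * a + 2 * L.sum + 2 * b - 1 - i) (by omega)
    rw [show L.sum - 1 - (2 * a + 2 * L.sum + 2 * b - 1 - i) = i - 2 * a - L.sum - 2 * b by
      omega] at hr
    rw [if_neg (by omega)] at hw
    rw [hw, if_neg (by omega), if_neg (by omega), lineVertex,
      if_neg (by omega), show (2 * ((L.sum : ℤ) + b) - 1 - (i - 2 * a)).toNat =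
        2 * a + 2 * L.sum + 2 * b - 1 - i by omega]
    omega

end Vertices

section Cut

variable {a N : ℕ}

lemma cutPos_injective : Function.Injective fun i : Fin N => cutPos a i := by
  intro i j hij
  have := i.2
  have := j.2
  simp only [cutPos] at hij
  ext
  split_ifs at hij <;> omega

lemma exists_cutPos_eq (h : 2 * a ≤ N) (x : ℤ) (h1 : -(a : ℤ) ≤ x) (h2 : x < (N : ℤ) - a) :
    ∃ i : Fin N, cutPos a i = x := by
  by_cases hc : x < N - 2 * a
  · refine ⟨⟨(x + 2 * a).toNat, by omega⟩, ?_⟩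
    simp only [cutPos]
    split_ifs <;> omega
  · refine ⟨⟨(x + 2 * a - N).toNat, by omega⟩, ?_⟩
    simp only [cutPos]
    split_ifs <;> omega

lemma cutPos_range (h : 2 * a ≤ N) (i : Fin N) :
    -(a : ℤ) ≤ cutPos a i ∧ cutPos a i < (N : ℤ) - a := by
  have := i.2
  simp only [cutPos]
  split_ifs <;> omega

lemma val_reflEnd (h : 2 * a ≤ N) (i : Fin N) :
    (reflEnd (2 * a) i : ℕ) = if (i : ℕ) < 2 * a then 2 * a - 1 - i else N + 2 * a - 1 - i := by
  have := i.2
  simp only [reflEnd]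
  split_ifs with hc
  · rw [show 2 * a + N - 1 - (i : ℕ) = 2 * a - 1 - i + N by omega, Nat.add_mod_right]
    exact Nat.mod_eq_of_lt (by omega)
  · rw [Nat.mod_eq_of_lt (by omega)]
    omega

lemma cutPos_reflEnd (h : 2 * a ≤ N) (i : Fin N) :
    cutPos a (reflEnd (2 * a) i) = N - 2 * a - 1 - cutPos a i := by
  have := i.2
  simp only [cutPos, val_reflEnd h]
  split_ifs <;> omega

/-- Being noncrossing does not depend on where the circle is cut open. -/
lemma nest_cutPos_iff (a : ℕ) (σ : Equiv.Perm (Fin N)) (hinv : ∀ i, σ (σ i) = i) :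
    (∀ i j, ¬(i < j ∧ j < σ i ∧ σ i < σ j)) ↔
    ∀ i j : Fin N, cutPos a i < cutPos a j → cutPos a j < cutPos a (σ i) →
      cutPos a i < cutPos a (σ j) ∧ cutPos a (σ j) < cutPos a (σ i) := by
  have ne : ∀ i j : Fin N, i ≠ j → (i : ℕ) ≠ j := fun i j hij => Fin.val_ne_of_ne hij
  simp only [Fin.lt_def]
  constructor
  · intro hn i j hij hj
    have d1 : (σ i : ℕ) ≠ σ j := by
      refine ne _ _ fun hc => ?_
      rw [σ.injective hc] at hij
      omega
    have d2 : (i : ℕ) ≠ σ j := by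
      refine ne _ _ fun hc => ?_
      rw [hc, hinv] at hj
      omega
    have n1 := hn i j
    have n2 := hn j i
    have n3 := hn (σ i) j
    have n4 := hn j (σ i)
    have n5 := hn i (σ j)
    have n6 := hn (σ j) i
    have n7 := hn (σ i) (σ j)
    have n8 := hn (σ j) (σ i)
    simp only [hinv] at n3 n4 n5 n6 n7 n8
    have := i.2
    have := j.2
    have := (σ i).2
    have := (σ j).2
    simp only [cutPos] at hij hj ⊢
    split_ifs at hij hj ⊢ <;> omega
  · rintro hn i j ⟨h1, h2, h3⟩
    have n1 := hn i j
    have n2 := hn j i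
    have n3 := hn (σ i) j
    have n4 := hn j (σ i)
    have n5 := hn i (σ j)
    have n6 := hn (σ j) i
    have n7 := hn (σ i) (σ j)
    have n8 := hn (σ j) (σ i)
    simp only [hinv] at n3 n4 n5 n6 n7 n8
    have := i.2
    have := j.2
    have := (σ i).2
    have := (σ j).2
    simp only [cutPos] at *
    split_ifs at * <;> omega

end Cut

section Circle

variable {a b : ℕ} {L : List ℕ} {s : ℤ → ℤ}

/-- The number of crossing edges, computed on the line. -/
lemma crossNum_eq_ncard (σ : Equiv.Perm (Fin (symList (2 * a) L (2 * b)).sum))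
    (hs : ∀ i : Fin (symList (2 * a) L (2 * b)).sum,
      s (cutPos a i) =
        cutPos a (σ i)) :
    crossNum (2 * a) L (2 * b) σ = {x : ℤ | 0 ≤ x ∧ x < L.sum ∧ (L.sum : ℤ) + 2 * b ≤ s x ∧
      s x < 2 * ((L.sum : ℤ) + b)}.ncard := by
  have hN := sum_symList a b L
  have hset : {x : ℤ | 0 ≤ x ∧ x < L.sum ∧ (L.sum : ℤ) + 2 * b ≤ s x ∧
      s x < 2 * ((L.sum : ℤ) + b)} =
      (fun i : Fin (symList (2 * a) L (2 * b)).sum =>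
        cutPos a i) ''
      {i | 2 * a ≤ (i : ℕ) ∧ (i : ℕ) < 2 * a + L.sum ∧ 2 * a + L.sum + 2 * b ≤ (σ i : ℕ)} := by
    have key : ∀ i : Fin (symList (2 * a) L (2 * b)).sum,
        (0 ≤ cutPos a i ∧
          cutPos a i < L.sum ∧
          (L.sum : ℤ) + 2 * b ≤ cutPos a (σ i) ∧
          cutPos a (σ i) < 2 * ((L.sum : ℤ) + b)) ↔
        2 * a ≤ (i : ℕ) ∧ (i : ℕ) < 2 * a + L.sum ∧ 2 * a + L.sum + 2 * b ≤ (σ i : ℕ) := by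
      intro i
      have := i.2
      have := (σ i).2
      simp only [cutPos]
      split_ifs <;> omega
    ext x
    constructor
    · intro hx
      obtain ⟨i, rfl⟩ := exists_cutPos_eq (N := (symList (2 * a) L (2 * b)).sum) (a := a)
        (by omega) x (by have := hx.1; omega) (by have := hx.2.1; omega)
      rw [Set.mem_ofPred_eq, hs] at hx
      exact ⟨i, (key i).1 hx, rfl⟩
    · rintro ⟨i, hi, rfl⟩
      simp only [Set.mem_ofPred_eq, hs]
      exact (key i).2 hi
  rw [hset, Set.ncard_image_of_injective _ cutPos_injective]
  rfl

/-- A symmetric chord diagram on the circle is the same as one on the line. -/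
lemma isFull_iff (σ : Equiv.Perm (Fin (symList (2 * a) L (2 * b)).sum))
    (hs : ∀ i : Fin (symList (2 * a) L (2 * b)).sum,
      s (cutPos a i) =
        cutPos a (σ i))
    (hout : ∀ x : ℤ, x < -a ∨ 2 * ((L.sum : ℤ) + b) + a ≤ x → s x = x) :
    IsFull L.sum L.length (lineVertex L) a b s ↔
      IsChordDiagram (symList (2 * a) L (2 * b)) σ ∧
      (∀ i, σ (reflEnd (2 * a) i) = reflEnd (2 * a) (σ i)) ∧
      Even (crossNum (2 * a) L (2 * b) σ) := by
  have hcross := crossNum_eq_ncard σ hs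
  have hN := sum_symList a b L
  have hvert := vertexOf_symList a b L
  have hle : 2 * a ≤ (symList (2 * a) L (2 * b)).sum := by omega
  have inj : ∀ i j : Fin (symList (2 * a) L (2 * b)).sum, cutPos a i = cutPos a j → i = j :=
    fun i j h => cutPos_injective h
  have range : ∀ x : ℤ, (x < -a ∨ 2 * ((L.sum : ℤ) + b) + a ≤ x) ∨
      ∃ i : Fin (symList (2 * a) L (2 * b)).sum, cutPos a i = x := by
    intro x
    by_cases hx : x < -a ∨ 2 * ((L.sum : ℤ) + b) + a ≤ x
    · exact Or.inl hx
    · exact Or.inr (exists_cutPos_eq hle x (by omega) (by omega))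
  have refl : ∀ i : Fin (symList (2 * a) L (2 * b)).sum, cutPos a (reflEnd (2 * a) i) =
      2 * ((L.sum : ℤ) + b) - 1 - cutPos a i := by
    intro i
    rw [cutPos_reflEnd hle]
    omega
  constructor
  · intro h
    have hinv : ∀ i, σ (σ i) = i := fun i => inj _ _ (by rw [← hs, ← hs, h.inv])
    refine ⟨⟨hinv, ?_, ?_, ?_⟩, ?_, ?_⟩
    · intro i hi
      have := cutPos_range hle i
      refine h.nofix (cutPos a i) (by omega) (by omega) ?_
      rw [hs, hi]
    · rw [nest_cutPos_iff a σ hinv]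
      intro i j hij hj
      have := h.nest (cutPos a i) (cutPos a j) hij
      rw [hs, hs] at this
      exact this hj
    · intro i hi
      have := cutPos_range hle i
      refine h.vert (cutPos a i) (by omega) (by omega) ?_
      rw [hs, ← hvert i, ← hvert (σ i), hi]
    · intro i
      apply inj
      rw [← hs, refl, refl, h.symm, hs]
    · rw [hcross]
      exact h.even
  · rintro ⟨⟨hinv, hfix, hnest, hv⟩, hsymm, heven⟩
    rw [nest_cutPos_iff a σ hinv] at hnest
    refine ⟨?_, hout, ?_, ?_, ?_, ?_, ?_⟩
    · intro x
      rcases range x with hx | ⟨i, rfl⟩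
      · rw [hout x hx, hout x hx]
      · rw [hs, hs, hinv]
    · intro x h1 h2
      obtain ⟨i, rfl⟩ := (range x).resolve_left (by omega)
      rw [hs]
      exact fun hc => hfix i (inj _ _ hc)
    · intro x y hxy hy
      rcases range x with hx | ⟨i, rfl⟩
      · have := hout x hx
        omega
      · have r1 := cutPos_range hle i
        have r2 := cutPos_range hle (σ i)
        rw [hs] at hy ⊢
        obtain ⟨j, rfl⟩ := (range y).resolve_left (by omega)
        rw [hs]
        exact hnest i j hxy hy
    · intro x h1 h2
      obtain ⟨i, rfl⟩ := (range x).resolve_left (by omega)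
      rw [hs, ← hvert i, ← hvert (σ i)]
      exact_mod_cast hv i
    · intro x
      rcases range x with hx | ⟨i, rfl⟩
      · rw [hout x hx, hout _ (by omega)]
      · rw [← refl, hs, hs, hsymm, refl]
    · rwa [← hcross]

/-- The involution of the line induced by a permutation of the circle. -/
noncomputable def lineMap (a : ℕ) {N : ℕ} (σ : Equiv.Perm (Fin N)) (x : ℤ) : ℤ :=
  open Classical in
  if h : ∃ i : Fin N, cutPos a i = x then cutPos a (σ h.choose) else x

lemma lineMap_cutPos {N : ℕ} (σ : Equiv.Perm (Fin N)) (i : Fin N) :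
    lineMap a σ (cutPos a i) = cutPos a (σ i) := by
  have h : ∃ j : Fin N, cutPos a j = cutPos a i := ⟨i, rfl⟩
  rw [lineMap, dif_pos h]
  congr 3
  exact cutPos_injective h.choose_spec

lemma lineMap_of_out {N : ℕ} (hN : 2 * a ≤ N) (σ : Equiv.Perm (Fin N)) (x : ℤ)
    (hx : x < -a ∨ (N : ℤ) - a ≤ x) : lineMap a σ x = x := by
  refine dif_neg ?_
  rintro ⟨i, rfl⟩
  have := cutPos_range hN i
  omega

theorem symCountEvenCross_eq_card_isFull (a b : ℕ) (L : List ℕ) :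
    symCountEvenCross (2 * a) L (2 * b) =
      Nat.card {s // IsFull L.sum L.length (lineVertex L) a b s} := by
  have hN := sum_symList a b L
  have hle : 2 * a ≤ (symList (2 * a) L (2 * b)).sum := by omega
  refine Nat.card_eq_of_bijective (fun σ => ⟨lineMap a σ.1, (isFull_iff σ.1 (lineMap_cutPos σ.1)
    fun x hx => lineMap_of_out hle σ.1 x (by omega)).2 σ.2⟩) ⟨?_, ?_⟩
  · intro σ₁ σ₂ h
    have h' := congrArg Subtype.val h
    refine Subtype.ext (Equiv.ext fun i => cutPos_injective (a := a) ?_)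
    have := congrFun h' (cutPos a i)
    simpa only [lineMap_cutPos] using this
  · rintro ⟨s, h⟩
    have hex : ∀ i : Fin (symList (2 * a) L (2 * b)).sum,
        ∃ j : Fin (symList (2 * a) L (2 * b)).sum,
          cutPos a j =
            s (cutPos a i) := by
      intro i
      have h1 := cutPos_range hle i
      have h2 := h.range (cutPos a i) (by omega) (by omega)
      exact exists_cutPos_eq hle _ (by omega) (by omega)
    choose f hf using hex
    have hinv : Function.Involutive f := fun i => cutPos_injective (a := a) (by
      simp only [hf, h.inv])
    have hs : ∀ i : Fin (symList (2 * a) L (2 * b)).sum,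
        s (cutPos a i) =
          cutPos a (hinv.toPerm f i) := fun i => (hf i).symm
    refine ⟨⟨hinv.toPerm f, (isFull_iff _ hs h.out).1 h⟩, Subtype.ext (funext fun x => ?_)⟩
    by_cases hx : x < -a ∨ ((symList (2 * a) L (2 * b)).sum : ℤ) - a ≤ x
    · exact (lineMap_of_out hle _ x hx).trans (h.out x (by omega)).symm
    · obtain ⟨i, rfl⟩ := exists_cutPos_eq hle x (by omega) (by omega)
      exact (lineMap_cutPos _ i).trans (hs i).symm

end Circle

/-- For symmetric chord diagrams with an even number `ν` of crossing edges,
`E(m₀, m₁, …, m_{n-2}, m_{n-1}) = E(m₀ + 2, m₁, …, m_{n-2}, m_{n-1} + 2)`. -/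
theorem symCount_add_two (m₀ minf : ℕ) (L : List ℕ)
    (h₀ : Even m₀) (hinf : Even minf) :
    symCountEvenCross m₀ L minf = symCountEvenCross (m₀ + 2) L (minf + 2) := by
  obtain ⟨a, rfl⟩ := h₀.two_dvd
  obtain ⟨b, rfl⟩ := hinf.two_dvd
  have hV := isVertexMap_lineVertex L
  rw [show 2 * a + 2 = 2 * (a + 1) by ring, show 2 * b + 2 = 2 * (b + 1) by ring,
    symCountEvenCross_eq_card_isFull, symCountEvenCross_eq_card_isFull,
    card_isFull_eq hV (by omega) (by omega), card_isFull_eq hV (by omega) (by omega)]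
  rw [Nat.cast_add_one, Nat.cast_add_one]
  exact card_isHalf_add_one hV (by omega) (by omega)
end

section
/- Let R be a real polynomial of degree p + q all of whose roots are real and non-negative, with p = q or q = p + 1. Then every solution (P, Q) ∈ P^p × P^q of the equation z(P'Q - PQ') + (1/2)PQ = cR (projectively, i.e., up to scalar) consists of polynomials P, Q with real coefficients (up to a common scalar multiple). -/
open Polynomial

namespace Gaudin

section Scalars

variable {ι : Type*}

/-- The coefficients of the local operators at spectral parameter `u`. -/
noncomputable def resolvent (z : ι → ℂ) (u : ℂ) (i : ι) : ℂ := (u - z i)⁻¹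

lemma resolvent_mul {z : ι → ℂ} {u t : ℂ} (hu : ∀ i, u ≠ z i) (ht : ∀ i, t ≠ z i) (hut : u ≠ t) :
    resolvent z u * resolvent z t = (u - t)⁻¹ • (resolvent z t - resolvent z u) := by
  ext i
  have h1 := sub_ne_zero.mpr (hu i)
  have h2 := sub_ne_zero.mpr (ht i)
  have h3 := sub_ne_zero.mpr hut
  simp only [resolvent, Pi.mul_apply, Pi.smul_apply, Pi.sub_apply, smul_eq_mul]
  field_simp
  ring

variable [Fintype ι]

/-- The weight function `∑ (x - zᵢ)⁻¹ - 2 ∑ (x - t)⁻¹`. -/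
noncomputable def potential (z : ι → ℂ) (T : Finset ℂ) (x : ℂ) : ℂ :=
  ∑ i, (x - z i)⁻¹ - 2 * ∑ t ∈ T, (x - t)⁻¹

lemma potential_insert (z : ι → ℂ) {T : Finset ℂ} {t : ℂ} (ht : t ∉ T) (x : ℂ) :
    potential z (insert t T) x = potential z T x - 2 * (x - t)⁻¹ := by
  rw [potential, potential, Finset.sum_insert ht]
  ring

/-- The Hermitian form for which distinct spin configurations are orthonormal. -/
def herm (φ ψ : Finset ι → ℂ) : ℂ := ∑ I, star (φ I) * ψ I

lemma herm_smul_right (c : ℂ) (φ ψ : Finset ι → ℂ) : herm φ (c • ψ) = c * herm φ ψ := by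
  simp [herm, Finset.mul_sum, mul_left_comm]

lemma star_herm (φ ψ : Finset ι → ℂ) : star (herm φ ψ) = herm ψ φ := by
  simp [herm, mul_comm]

lemma herm_self_ne_zero {φ : Finset ι → ℂ} (hφ : φ ≠ 0) : herm φ φ ≠ 0 := by
  have h : herm φ φ = ((∑ I, Complex.normSq (φ I) : ℝ) : ℂ) := by
    simp [herm, Complex.normSq_eq_conj_mul_self]
  rw [h, Complex.ofReal_ne_zero]
  obtain ⟨I, hI⟩ := Function.ne_iff.mp hφ
  exact (Finset.sum_pos' (fun J _ => Complex.normSq_nonneg _)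
    ⟨I, Finset.mem_univ I, Complex.normSq_pos.mpr hI⟩).ne'

end Scalars

variable {ι : Type*} [DecidableEq ι]

/-- The lowering operator of the `i`-th spin. -/
def siteLower (i : ι) : (Finset ι → ℂ) →ₗ[ℂ] (Finset ι → ℂ) where
  toFun φ I := if i ∈ I then φ (I.erase i) else 0
  map_add' φ ψ := by ext I; by_cases h : i ∈ I <;> simp [h]
  map_smul' c φ := by ext I; by_cases h : i ∈ I <;> simp [h]

/-- The raising operator of the `i`-th spin. -/
def siteRaise (i : ι) : (Finset ι → ℂ) →ₗ[ℂ] (Finset ι → ℂ) where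
  toFun φ I := if i ∈ I then 0 else φ (insert i I)
  map_add' φ ψ := by ext I; by_cases h : i ∈ I <;> simp [h]
  map_smul' c φ := by ext I; by_cases h : i ∈ I <;> simp [h]

/-- The weight operator of the `i`-th spin. -/
def siteWeight (i : ι) : (Finset ι → ℂ) →ₗ[ℂ] (Finset ι → ℂ) where
  toFun φ I := if i ∈ I then - φ I else φ I
  map_add' φ ψ := by ext I; by_cases h : i ∈ I <;> simp [h]; ring
  map_smul' c φ := by ext I; by_cases h : i ∈ I <;> simp [h]

lemma siteRaise_siteLower (i j : ι) (φ : Finset ι → ℂ) :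
    siteRaise i (siteLower j φ) =
      siteLower j (siteRaise i φ) + if i = j then siteWeight i φ else 0 := by
  ext I
  by_cases hij : i = j
  · subst hij
    by_cases hi : i ∈ I <;> simp [siteRaise, siteLower, siteWeight, hi]
  · by_cases hi : i ∈ I <;> by_cases hj : j ∈ I <;>
      simp [siteRaise, siteLower, hi, hj, hij, Ne.symm hij,
        Finset.erase_insert_of_ne hij]

lemma siteWeight_siteLower (i j : ι) (φ : Finset ι → ℂ) :
    siteWeight i (siteLower j φ) =
      siteLower j (siteWeight i φ) - if i = j then (2 : ℂ) • siteLower j φ else 0 := by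
  ext I
  by_cases hij : i = j
  · subst hij
    by_cases hi : i ∈ I <;> simp [siteLower, siteWeight, hi]
    ring
  · by_cases hi : i ∈ I <;> by_cases hj : j ∈ I <;>
      simp [siteWeight, siteLower, hi, hj, hij]

lemma siteLower_comm (i j : ι) (φ : Finset ι → ℂ) :
    siteLower i (siteLower j φ) = siteLower j (siteLower i φ) := by
  ext I
  by_cases hij : i = j
  · rw [hij]
  · by_cases hi : i ∈ I <;> by_cases hj : j ∈ I <;>
      simp [siteLower, hi, hj, hij, Ne.symm hij, Finset.erase_right_comm (a := i)]

variable [Fintype ι]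

/-- The lowering operator with coefficients `a`. -/
def lower (a : ι → ℂ) : (Finset ι → ℂ) →ₗ[ℂ] (Finset ι → ℂ) := ∑ i, a i • siteLower i

/-- The raising operator with coefficients `a`. -/
def raise (a : ι → ℂ) : (Finset ι → ℂ) →ₗ[ℂ] (Finset ι → ℂ) := ∑ i, a i • siteRaise i

/-- The weight operator with coefficients `a`. -/
def weight (a : ι → ℂ) : (Finset ι → ℂ) →ₗ[ℂ] (Finset ι → ℂ) := ∑ i, a i • siteWeight i

lemma lower_sub (a b : ι → ℂ) (φ : Finset ι → ℂ) :
    lower (a - b) φ = lower a φ - lower b φ := by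
  simp only [lower, LinearMap.sum_apply, LinearMap.smul_apply, Pi.sub_apply, sub_smul,
    Finset.sum_sub_distrib]

lemma lower_smul (c : ℂ) (a : ι → ℂ) (φ : Finset ι → ℂ) : lower (c • a) φ = c • lower a φ := by
  simp [lower, mul_smul, Finset.smul_sum]

lemma weight_sub (a b : ι → ℂ) (φ : Finset ι → ℂ) :
    weight (a - b) φ = weight a φ - weight b φ := by
  simp only [weight, LinearMap.sum_apply, LinearMap.smul_apply, Pi.sub_apply, sub_smul,
    Finset.sum_sub_distrib]

lemma weight_smul (c : ℂ) (a : ι → ℂ) (φ : Finset ι → ℂ) : weight (c • a) φ = c • weight a φ := by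
  simp [weight, mul_smul, Finset.smul_sum]

lemma raise_lower (a b : ι → ℂ) (φ : Finset ι → ℂ) :
    raise a (lower b φ) = lower b (raise a φ) + weight (a * b) φ := by
  simp only [raise, lower, weight, LinearMap.sum_apply, LinearMap.smul_apply, map_sum, map_smul,
    siteRaise_siteLower, smul_add, Finset.smul_sum, Finset.sum_add_distrib, Pi.mul_apply]
  congr 1
  · rw [Finset.sum_comm]
    refine Finset.sum_congr rfl fun i _ => Finset.sum_congr rfl fun j _ => smul_comm _ _ _
  · refine Finset.sum_congr rfl fun i _ => ?_
    simp [mul_smul, smul_comm (b i)]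

lemma weight_lower (a b : ι → ℂ) (φ : Finset ι → ℂ) :
    weight a (lower b φ) = lower b (weight a φ) - (2 : ℂ) • lower (a * b) φ := by
  simp only [lower, weight, LinearMap.sum_apply, LinearMap.smul_apply, map_sum, map_smul,
    siteWeight_siteLower, smul_sub, Finset.smul_sum, Finset.sum_sub_distrib, Pi.mul_apply]
  congr 1
  · rw [Finset.sum_comm]
    refine Finset.sum_congr rfl fun i _ => Finset.sum_congr rfl fun j _ => smul_comm _ _ _
  · refine Finset.sum_congr rfl fun i _ => ?_
    simp only [smul_ite, smul_zero, Finset.sum_ite_eq', Finset.mem_univ, if_true, smul_smul]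
    ring_nf

lemma lower_comm (a b : ι → ℂ) (φ : Finset ι → ℂ) :
    lower a (lower b φ) = lower b (lower a φ) := by
  simp only [lower, LinearMap.sum_apply, LinearMap.smul_apply, map_sum, map_smul,
    Finset.smul_sum]
  rw [Finset.sum_comm]
  refine Finset.sum_congr rfl fun i _ => Finset.sum_congr rfl fun j _ => ?_
  rw [siteLower_comm, smul_comm]

/-- The vector with all spins up. -/
def vacuum : Finset ι → ℂ := Pi.single ∅ 1

lemma raise_vacuum (a : ι → ℂ) : raise a vacuum = 0 := by
  ext I
  simp [raise, vacuum, siteRaise]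

lemma weight_vacuum (a : ι → ℂ) : weight a vacuum = (∑ i, a i) • vacuum := by
  have h (i : ι) : siteWeight i vacuum = vacuum := by
    ext I
    by_cases hI : I = ∅ <;> simp [siteWeight, vacuum, hI]
  simp [weight, h, Finset.sum_smul]

lemma herm_siteRaise (i : ι) (φ ψ : Finset ι → ℂ) :
    herm φ (siteRaise i ψ) = herm (siteLower i φ) ψ := by
  unfold herm siteRaise siteLower
  simp only [LinearMap.coe_mk, AddHom.coe_mk, mul_ite, mul_zero, apply_ite star, star_zero,
    ite_mul, zero_mul]
  rw [Finset.sum_ite, ← Finset.sum_filter, Finset.sum_const_zero, zero_add]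
  refine Finset.sum_nbij' (fun I => insert i I) (fun I => I.erase i) ?_ ?_ ?_ ?_ ?_ <;>
    simp +contextual


lemma herm_siteWeight (i : ι) (φ ψ : Finset ι → ℂ) :
    herm φ (siteWeight i ψ) = herm (siteWeight i φ) ψ := by
  refine Finset.sum_congr rfl fun I _ => ?_
  by_cases hi : i ∈ I <;> simp [siteWeight, hi]

lemma herm_raise (a : ι → ℝ) (φ ψ : Finset ι → ℂ) :
    herm φ (raise (fun i => (a i : ℂ)) ψ) = herm (lower (fun i => (a i : ℂ)) φ) ψ := by
  have h (i : ι) := herm_siteRaise i φ ψ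
  simp only [herm] at h
  simp only [herm, raise, lower, LinearMap.sum_apply, LinearMap.smul_apply, Finset.sum_apply,
    Pi.smul_apply, smul_eq_mul, Finset.mul_sum, star_sum, Finset.sum_mul, star_mul']
  rw [Finset.sum_comm, Finset.sum_comm (s := Finset.univ (α := Finset ι))]
  refine Finset.sum_congr rfl fun i _ => ?_
  simp only [Complex.star_def, Complex.conj_ofReal, mul_assoc, mul_left_comm _ (a i : ℂ),
    ← Finset.mul_sum] at h ⊢
  rw [h i]

lemma herm_weight (a : ι → ℝ) (φ ψ : Finset ι → ℂ) :
    herm φ (weight (fun i => (a i : ℂ)) ψ) = herm (weight (fun i => (a i : ℂ)) φ) ψ := by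
  have h (i : ι) := herm_siteWeight i φ ψ
  simp only [herm] at h
  simp only [herm, weight, LinearMap.sum_apply, LinearMap.smul_apply, Finset.sum_apply,
    Pi.smul_apply, smul_eq_mul, Finset.mul_sum, star_sum, Finset.sum_mul, star_mul']
  rw [Finset.sum_comm, Finset.sum_comm (s := Finset.univ (α := Finset ι))]
  refine Finset.sum_congr rfl fun i _ => ?_
  simp only [Complex.star_def, Complex.conj_ofReal, mul_assoc, mul_left_comm _ (a i : ℂ),
    ← Finset.mul_sum] at h ⊢
  rw [h i]

/-- The generating function of the Gaudin Hamiltonians, with coefficients `a`. -/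
noncomputable def hamiltonian (a : ι → ℂ) (φ : Finset ι → ℂ) : Finset ι → ℂ :=
  raise a (lower a φ) + lower a (raise a φ) + (1 / 2 : ℂ) • weight a (weight a φ)

lemma raise_eq_zero_of_card (φ : Finset ι → ℂ) (a : ι → ℂ) (hφ : ∀ I, I.card ≠ 0 → φ I = 0) :
    raise a φ = 0 := by
  ext I
  simp [raise, siteRaise, hφ]

lemma weight_one (φ : Finset ι → ℂ) (I : Finset ι) :
    weight 1 φ I = (Fintype.card ι - 2 * I.card) * φ I := by
  have h (i : ι) : siteWeight i φ I = (1 - 2 * if i ∈ I then 1 else 0) * φ I := by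
    by_cases hi : i ∈ I <;> simp [siteWeight, hi]
    ring
  simp only [weight, LinearMap.sum_apply, Pi.one_apply, one_smul, Finset.sum_apply, h,
    ← Finset.sum_mul, Finset.sum_sub_distrib, ← Finset.mul_sum]
  simp

/-- `φ` is supported on configurations with `k` spins down. -/
def HasLevel (k : ℕ) (φ : Finset ι → ℂ) : Prop := ∀ I : Finset ι, I.card ≠ k → φ I = 0

lemma HasLevel.lower {k : ℕ} {φ : Finset ι → ℂ} (h : HasLevel k φ) (a : ι → ℂ) :
    HasLevel (k + 1) (lower a φ) := by
  intro I hI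
  simp only [Gaudin.lower, LinearMap.sum_apply, LinearMap.smul_apply, Finset.sum_apply,
    Pi.smul_apply]
  refine Finset.sum_eq_zero fun i _ => ?_
  by_cases hi : i ∈ I
  · have : (I.erase i).card ≠ k := by
      have := Finset.card_erase_add_one hi
      omega
    simp [siteLower, hi, h _ this]
  · simp [siteLower, hi]

lemma HasLevel.raise {k : ℕ} {φ : Finset ι → ℂ} (h : HasLevel (k + 1) φ) (a : ι → ℂ) :
    HasLevel k (raise a φ) := by
  intro I hI
  simp only [Gaudin.raise, LinearMap.sum_apply, LinearMap.smul_apply, Finset.sum_apply,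
    Pi.smul_apply]
  refine Finset.sum_eq_zero fun i _ => ?_
  by_cases hi : i ∈ I
  · simp [siteRaise, hi]
  · have : (insert i I).card ≠ k + 1 := by
      rw [Finset.card_insert_of_notMem hi]
      omega
    simp [siteRaise, hi, h _ this]

lemma HasLevel.weight_one {k : ℕ} {φ : Finset ι → ℂ} (h : HasLevel k φ) :
    weight 1 φ = (Fintype.card ι - 2 * k : ℂ) • φ := by
  ext I
  rw [Gaudin.weight_one]
  by_cases hI : I.card = k
  · simp [hI]
  · simp [h I hI]

lemma HasLevel.lower_raise {a b : ι → ℂ} (hab : b * a = 1) {k : ℕ} {φ : Finset ι → ℂ}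
    (hφ : HasLevel k φ) {c : ℂ} (h : Gaudin.raise b (Gaudin.lower a φ) = (-c) • φ) :
    Gaudin.lower a (Gaudin.raise b φ) = (-(c + (Fintype.card ι - 2 * k))) • φ := by
  rw [raise_lower, hab, hφ.weight_one, ← eq_sub_iff_add_eq] at h
  rw [h, ← sub_smul]
  ring_nf

lemma HasLevel.eq_zero_of_raise_lower {a b : ι → ℂ} (hab : b * a = 1) {k : ℕ}
    (hk : 2 * k < Fintype.card ι) {φ : Finset ι → ℂ} (hφ : HasLevel k φ) {c : ℕ}
    (h : Gaudin.raise b (Gaudin.lower a φ) = (-c : ℂ) • φ) : φ = 0 := by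
  obtain ⟨m, hm⟩ := Nat.exists_eq_add_of_lt hk
  have hcomm : Gaudin.lower a (Gaudin.raise b φ) = (-(c + m + 1 : ℕ) : ℂ) • φ := by
    rw [hφ.lower_raise hab h, hm]
    push_cast
    ring_nf
  suffices hz : Gaudin.raise b φ = 0 by
    rw [hz, map_zero, eq_comm, smul_eq_zero] at hcomm
    exact hcomm.resolve_left (neg_ne_zero.mpr (Nat.cast_ne_zero.mpr (by omega)))
  induction k generalizing φ c m with
  | zero => exact raise_eq_zero_of_card φ b hφ
  | succ k ih =>
    have h' : Gaudin.raise b (Gaudin.lower a (Gaudin.raise b φ)) =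
        (-(c + m + 1 : ℕ) : ℂ) • Gaudin.raise b φ := by rw [hcomm, map_smul]
    have hψ := hφ.raise b
    have hc : Gaudin.lower a (Gaudin.raise b (Gaudin.raise b φ)) =
        (-((c + m + 1) + (m + 2) + 1 : ℕ) : ℂ) • Gaudin.raise b φ := by
      rw [hψ.lower_raise hab h', hm]
      push_cast
      ring_nf
    have hz := ih (by omega) hψ h' (m + 2) (by omega) hc
    rw [hz, map_zero, eq_comm, smul_eq_zero] at hc
    exact hc.resolve_left (neg_ne_zero.mpr (Nat.cast_ne_zero.mpr (by omega)))

/-- The lowering operator is injective on vectors of positive weight. -/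
lemma HasLevel.lower_ne_zero {a : ι → ℂ} (ha : ∀ i, a i ≠ 0) {k : ℕ}
    (hk : 2 * k < Fintype.card ι) {φ : Finset ι → ℂ} (hφ : HasLevel k φ) (h : φ ≠ 0) :
    Gaudin.lower a φ ≠ 0 := by
  intro h0
  refine h (hφ.eq_zero_of_raise_lower (a := a) (b := a⁻¹) (c := 0) ?_ hk (by simp [h0]))
  ext i
  simp [ha i]

lemma hamiltonian_lower {a b : ι → ℂ} {κ : ℂ} (hab : a * b = κ • (b - a)) (φ : Finset ι → ℂ) :
    hamiltonian a (lower b φ) = lower b (hamiltonian a φ) +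
      (2 * κ) • (lower a (weight b φ) - lower b (weight a φ)) := by
  have h1 : raise a (lower a (lower b φ)) = lower b (raise a (lower a φ)) +
      lower a (weight (a * b) φ) - (2 : ℂ) • lower (a * b * a) φ := by
    rw [lower_comm a b, raise_lower, weight_lower, add_sub_assoc]
  have h2 : lower a (raise a (lower b φ)) = lower b (lower a (raise a φ)) +
      lower a (weight (a * b) φ) := by
    rw [raise_lower, map_add, lower_comm a b]
  have h3 : weight a (weight a (lower b φ)) = lower b (weight a (weight a φ)) -
      (4 : ℂ) • lower (a * b) (weight a φ) + (4 : ℂ) • lower (a * b * a) φ := by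
    rw [weight_lower, map_sub, weight_lower, map_smul, weight_lower, mul_comm a (a * b)]
    module
  simp only [hamiltonian, h1, h2, h3, map_add, map_smul]
  rw [hab, lower_smul, weight_smul, map_smul, lower_sub, weight_sub, map_sub]
  module

lemma pairwise_commute_lower_resolvent (z : ι → ℂ) (T : Set ℂ) :
    T.Pairwise (Function.onFun Commute
      fun t => (lower (resolvent z t) : Module.End ℂ (Finset ι → ℂ))) :=
  fun _ _ _ _ _ => LinearMap.ext fun φ => lower_comm _ _ φ

/-- The Bethe vector with Bethe roots `T`. -/
noncomputable def betheVector (z : ι → ℂ) (T : Finset ℂ) : Finset ι → ℂ :=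
  T.noncommProd (β := Module.End ℂ (Finset ι → ℂ)) (fun t => lower (resolvent z t))
    (pairwise_commute_lower_resolvent z T) vacuum

lemma betheVector_empty (z : ι → ℂ) : betheVector z ∅ = vacuum := by
  rw [betheVector, Finset.noncommProd_empty]
  rfl

lemma betheVector_insert (z : ι → ℂ) {T : Finset ℂ} {t : ℂ} (ht : t ∉ T) :
    betheVector z (insert t T) = lower (resolvent z t) (betheVector z T) := by
  rw [betheVector, Finset.noncommProd_insert_of_notMem _ _ _ _ ht]
  rfl

lemma betheVector_hasLevel (z : ι → ℂ) (T : Finset ℂ) : HasLevel T.card (betheVector z T) := by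
  induction T using Finset.induction_on with
  | empty =>
    intro I hI
    simp_all [betheVector_empty, vacuum]
  | insert t T ht ih =>
    rw [betheVector_insert z ht, Finset.card_insert_of_notMem ht]
    exact ih.lower _

lemma betheVector_ne_zero {z : ι → ℂ} {T : Finset ℂ} (hT : ∀ t ∈ T, ∀ i, t ≠ z i)
    (hcard : 2 * T.card ≤ Fintype.card ι + 1) : betheVector z T ≠ 0 := by
  induction T using Finset.induction_on with
  | empty =>
    intro h
    simpa [betheVector_empty, vacuum] using congr_fun h ∅
  | insert t T ht ih =>
    rw [Finset.card_insert_of_notMem ht] at hcard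
    rw [betheVector_insert z ht]
    refine (betheVector_hasLevel z T).lower_ne_zero (fun i => ?_) (by omega)
      (ih (fun s hs => hT s (Finset.mem_insert_of_mem hs)) (by omega))
    exact inv_ne_zero (sub_ne_zero.mpr (hT t (Finset.mem_insert_self t T) i))

/-- The eigenvalue of the Hamiltonian on the Bethe vector. -/
noncomputable def energy (z : ι → ℂ) (T : Finset ℂ) (u : ℂ) : ℂ :=
  1 / 2 * potential z T u ^ 2 + ∑ i, (u - z i)⁻¹ ^ 2 - 2 * ∑ t ∈ T, (u - t)⁻¹ ^ 2

lemma sum_erase_betheVector (z : ι → ℂ) {T : Finset ℂ} {t : ℂ} (ht : t ∉ T) (u : ℂ)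
    (c : ℂ → ℂ) :
    ∑ s ∈ insert t T, c s • lower (resolvent z u) (betheVector z ((insert t T).erase s)) =
      c t • lower (resolvent z u) (betheVector z T) +
        ∑ s ∈ T, c s • lower (resolvent z t)
          (lower (resolvent z u) (betheVector z (T.erase s))) := by
  rw [Finset.sum_insert ht, Finset.erase_insert ht]
  congr 1
  refine Finset.sum_congr rfl fun s hs => ?_
  have hts : t ≠ s := fun h => ht (h ▸ hs)
  rw [Finset.erase_insert_of_ne hts,
    betheVector_insert z (fun h => ht (Finset.mem_of_mem_erase h)), lower_comm]

lemma weight_betheVector {z : ι → ℂ} {T : Finset ℂ} (hT : ∀ t ∈ T, ∀ i, t ≠ z i) {x : ℂ}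
    (hx : ∀ i, x ≠ z i) (hxT : x ∉ T) :
    weight (resolvent z x) (betheVector z T) = potential z T x • betheVector z T +
      ∑ s ∈ T, (2 * (x - s)⁻¹) • lower (resolvent z x) (betheVector z (T.erase s)) := by
  induction T using Finset.induction_on with
  | empty => simp [betheVector_empty, weight_vacuum, potential, resolvent]
  | insert t T ht ih =>
    rw [Finset.mem_insert, not_or] at hxT
    rw [sum_erase_betheVector z ht, betheVector_insert z ht, potential_insert z ht, weight_lower,
      ih (fun s hs => hT s (Finset.mem_insert_of_mem hs)) hxT.2,
      resolvent_mul hx (hT t (Finset.mem_insert_self t T)) hxT.1, lower_smul, lower_sub, map_add,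
      map_smul, map_sum]
    simp only [map_smul]
    module

/-- The action of the Hamiltonian on a Bethe vector. -/
lemma hamiltonian_betheVector {z : ι → ℂ} {T : Finset ℂ} (hT : ∀ t ∈ T, ∀ i, t ≠ z i) {u : ℂ}
    (hu : ∀ i, u ≠ z i) (huT : u ∉ T) :
    hamiltonian (resolvent z u) (betheVector z T) = energy z T u • betheVector z T +
      ∑ s ∈ T, (2 * (u - s)⁻¹ * potential z (T.erase s) s) •
        lower (resolvent z u) (betheVector z (T.erase s)) := by
  induction T using Finset.induction_on with
  | empty =>
    simp only [betheVector_empty, hamiltonian, raise_vacuum, raise_lower, weight_vacuum, map_zero,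
      map_smul, energy, potential, resolvent, Pi.mul_apply, Finset.sum_empty]
    simp only [← pow_two]
    module
  | insert t T ht ih =>
    rw [Finset.mem_insert, not_or] at huT
    have hT' : ∀ s ∈ T, ∀ i, s ≠ z i := fun s hs => hT s (Finset.mem_insert_of_mem hs)
    have htz := hT t (Finset.mem_insert_self t T)
    have hE : energy z (insert t T) u = energy z T u - 2 * (u - t)⁻¹ * potential z T u := by
      rw [energy, energy, potential_insert z ht, Finset.sum_insert ht]
      ring
    have hc : ∑ s ∈ T, (2 * (u - s)⁻¹ * potential z ((insert t T).erase s) s) •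
          lower (resolvent z t) (lower (resolvent z u) (betheVector z (T.erase s))) =
        ∑ s ∈ T, (2 * (u - s)⁻¹ * potential z (T.erase s) s) •
          lower (resolvent z t) (lower (resolvent z u) (betheVector z (T.erase s))) +
        (2 * (u - t)⁻¹) • (∑ s ∈ T, (2 * (t - s)⁻¹) •
          lower (resolvent z t) (lower (resolvent z u) (betheVector z (T.erase s))) -
        ∑ s ∈ T, (2 * (u - s)⁻¹) •
          lower (resolvent z t) (lower (resolvent z u) (betheVector z (T.erase s)))) := by
      rw [← Finset.sum_sub_distrib, Finset.smul_sum, ← Finset.sum_add_distrib]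
      refine Finset.sum_congr rfl fun s hs => ?_
      have hts : t ≠ s := fun h => ht (h ▸ hs)
      have hus : u ≠ s := fun h => huT.2 (h ▸ hs)
      rw [Finset.erase_insert_of_ne hts,
        potential_insert z (fun h => ht (Finset.mem_of_mem_erase h)), ← sub_smul, smul_smul,
        ← add_smul]
      congr 1
      have h1 := sub_ne_zero.mpr hts
      have h2 := sub_ne_zero.mpr hts.symm
      have h3 := sub_ne_zero.mpr hus
      have h4 := sub_ne_zero.mpr huT.1
      field_simp
      ring
    rw [sum_erase_betheVector z ht, hc, betheVector_insert z ht, Finset.erase_insert ht,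
      hamiltonian_lower (resolvent_mul hu htz huT.1), ih hT' huT.2,
      weight_betheVector hT' htz ht, weight_betheVector hT' hu huT.2, hE]
    simp only [map_add, map_smul, map_sum, lower_comm (resolvent z u) (resolvent z t)]
    module

lemma herm_hamiltonian (a : ι → ℝ) (φ : Finset ι → ℂ) :
    star (herm φ (hamiltonian (fun i => (a i : ℂ)) φ)) =
      herm φ (hamiltonian (fun i => (a i : ℂ)) φ) := by
  have hadd (α β γ : Finset ι → ℂ) : herm α (β + γ) = herm α β + herm α γ := by
    simp [herm, mul_add, Finset.sum_add_distrib]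
  have hlower (α β : Finset ι → ℂ) : herm α (lower (fun i => (a i : ℂ)) β) =
      herm (raise (fun i => (a i : ℂ)) α) β := by
    rw [← star_herm, ← herm_raise, star_herm]
  simp only [hamiltonian, hadd, herm_smul_right, herm_raise, herm_weight, hlower, star_add,
    star_mul', star_herm]
  simp

/-- Bethe roots give real eigenvalues when the sites are real. -/
lemma star_energy {x : ι → ℝ} {T : Finset ℂ} (hT : ∀ t ∈ T, ∀ i, t ≠ x i)
    (hcard : 2 * T.card ≤ Fintype.card ι + 1)
    (hbethe : ∀ t ∈ T, potential (fun i => (x i : ℂ)) (T.erase t) t = 0)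
    {u : ℝ} (hu : ∀ i, u ≠ x i) (huT : (u : ℂ) ∉ T) :
    star (energy (fun i => (x i : ℂ)) T u) = energy (fun i => (x i : ℂ)) T u := by
  set z : ι → ℂ := fun i => (x i : ℂ)
  have hr : resolvent z u = fun i => (((u - x i)⁻¹ : ℝ) : ℂ) := by
    ext i
    simp [resolvent, z]
  have heig := hamiltonian_betheVector (z := z) hT (u := u)
    (fun i => Complex.ofReal_injective.ne (hu i)) huT
  rw [Finset.sum_eq_zero (fun t ht => by rw [hbethe t ht, mul_zero, zero_smul]), add_zero] at heig
  have hsymm := herm_hamiltonian (fun i => (u - x i)⁻¹) (betheVector z T)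
  rw [← hr, heig, herm_smul_right, star_mul', star_herm] at hsymm
  exact mul_right_cancel₀ (herm_self_ne_zero (betheVector_ne_zero hT hcard)) hsymm

end Gaudin
open Gaudin

lemma coeff_X_mul_derivative {R : Type*} [CommSemiring R] (P : R[X]) (n : ℕ) :
    (X * derivative P).coeff n = n * P.coeff n := by
  cases n with
  | zero => simp
  | succ n =>
    rw [coeff_X_mul, coeff_derivative]
    push_cast
    ring

lemma natDegree_X_mul_derivative_le {R : Type*} [CommSemiring R] (P : R[X]) :
    (X * derivative P).natDegree ≤ P.natDegree := by
  refine natDegree_le_iff_coeff_eq_zero.mpr fun n hn => ?_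
  rw [coeff_X_mul_derivative, coeff_eq_zero_of_natDegree_lt hn, mul_zero]

/-- Polynomials with the same logarithmic derivative have the same degree. -/
lemma natDegree_eq_of_derivative_mul_eq {D W : ℂ[X]} (hD : D ≠ 0) (hW : W ≠ 0)
    (h : derivative D * W = derivative W * D) : D.natDegree = W.natDegree := by
  have h' : (X * derivative D) * W = D * (X * derivative W) := by linear_combination X * h
  have hc := congr_arg (fun p => p.coeff (D.natDegree + W.natDegree)) h'
  rw [coeff_mul_add_eq_of_natDegree_le (natDegree_X_mul_derivative_le D) le_rfl,
    coeff_mul_add_eq_of_natDegree_le le_rfl (natDegree_X_mul_derivative_le W),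
    coeff_X_mul_derivative, coeff_X_mul_derivative, coeff_natDegree, coeff_natDegree] at hc
  have hne := mul_ne_zero (leadingCoeff_ne_zero.mpr hD) (leadingCoeff_ne_zero.mpr hW)
  have : (D.natDegree : ℂ) = W.natDegree :=
    mul_right_cancel₀ hne (by linear_combination hc)
  exact_mod_cast this

lemma eval_derivative_prod_X_sub_C {ι : Type*} (s : Finset ι) (y : ι → ℂ) {u : ℂ}
    (hu : ∀ i ∈ s, u ≠ y i) :
    (derivative (∏ i ∈ s, (X - C (y i)))).eval u =
        (∏ i ∈ s, (X - C (y i))).eval u * ∑ i ∈ s, (u - y i)⁻¹ ∧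
      (derivative (derivative (∏ i ∈ s, (X - C (y i))))).eval u =
        (∏ i ∈ s, (X - C (y i))).eval u *
          ((∑ i ∈ s, (u - y i)⁻¹) ^ 2 - ∑ i ∈ s, (u - y i)⁻¹ ^ 2) := by
  classical
  induction s using Finset.induction_on with
  | empty => simp
  | insert i s hi ih =>
    obtain ⟨h1, h2⟩ := ih fun j hj => hu j (Finset.mem_insert_of_mem hj)
    have h := sub_ne_zero.mpr (hu i (Finset.mem_insert_self i s))
    simp only [Finset.prod_insert hi, Finset.sum_insert hi, derivative_mul, derivative_add,
      derivative_sub, derivative_X, derivative_C, sub_zero, one_mul, eval_add, eval_mul, eval_sub,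
      eval_X, eval_C, h1, h2]
    constructor
    · field_simp
    · field_simp
      ring

/-- Solutions of the Bethe equations with real sites are closed under conjugation. -/
lemma conj_mem_of_bethe {ι : Type*} [Fintype ι] {x : ι → ℝ} {T : Finset ℂ}
    (hT : ∀ t ∈ T, ∀ i, t ≠ x i) (hcard : 2 * T.card ≤ Fintype.card ι)
    (hbethe : ∀ t ∈ T, potential (fun i => (x i : ℂ)) (T.erase t) t = 0) {t : ℂ} (ht : t ∈ T) :
    star t ∈ T := by
  classical
  set g : ℂ[X] := ∏ t ∈ T, (X - C t) with hg
  set W : ℂ[X] := ∏ i, (X - C (x i : ℂ)) with hW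
  set G : ℂ[X] := g.map (starRingEnd ℂ) with hG
  have hgdeg : g.natDegree = T.card := natDegree_finsetProd_X_sub_C_eq_card T id
  have hGdeg : G.natDegree = T.card := by rw [hG, natDegree_map, hgdeg]
  have hWmonic : W.Monic := monic_prod_X_sub_C _ _
  have hWdeg : W.natDegree = Fintype.card ι := by
    rw [hW, natDegree_prod_of_monic _ _ fun i _ => monic_X_sub_C _]
    simp
  set D := derivative g * G - g * derivative G with hD
  have hGconj (p : ℂ[X]) (u : ℝ) :
      (p.map (starRingEnd ℂ)).eval (u : ℂ) = star (p.eval (u : ℂ)) := by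
    have := eval_map_apply (f := starRingEnd ℂ) (p := p) (u : ℂ)
    rwa [Complex.conj_ofReal] at this
  have hode : derivative D * W = derivative W * D := by
    let bad : Finset ℝ := Finset.univ.image x ∪ T.image Complex.re
    refine eq_of_infinite_eval_eq _ _ ?_
    refine ((bad.finite_toSet.infinite_compl).image Complex.ofReal_injective.injOn).mono ?_
    rintro _ ⟨u, hu, rfl⟩
    have hux : ∀ i, u ≠ x i := by
      rintro i rfl
      exact hu (by simp [bad])
    have huT : (u : ℂ) ∉ T := fun h => hu (by
      simp only [bad, Finset.coe_union, Set.mem_union, Finset.mem_coe, Finset.mem_image]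
      exact Or.inr ⟨_, h, rfl⟩)
    obtain ⟨hg1, hg2⟩ := eval_derivative_prod_X_sub_C T id (u := (u : ℂ))
      fun s hs h => huT (h ▸ hs)
    obtain ⟨hW1, -⟩ := eval_derivative_prod_X_sub_C Finset.univ (fun i => (x i : ℂ)) (u := (u : ℂ))
      fun i _ => Complex.ofReal_injective.ne (hux i)
    have hen := star_energy hT (by omega) hbethe hux huT
    have hw : star (∑ i, ((u : ℂ) - x i)⁻¹) = ∑ i, ((u : ℂ) - x i)⁻¹ := by simp
    have hw2 : star (∑ i, ((u : ℂ) - x i)⁻¹ ^ 2) = ∑ i, ((u : ℂ) - x i)⁻¹ ^ 2 := by simp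
    simp only [energy, potential, star_add, star_sub, star_mul', star_pow, hw, hw2] at hen
    simp only [id] at hg1 hg2
    simp only [← hg, ← hW] at hg1 hg2 hW1
    simp only [hD, hG, derivative_sub, derivative_mul, derivative_map, Set.mem_ofPred_eq, eval_mul,
      eval_add, eval_sub, hGconj, hg1, hg2, hW1, star_mul', star_sub, star_pow]
    have h2 : star (2 : ℂ) = 2 := by simp
    have h12 : star (1 / 2 : ℂ) = 1 / 2 := by simp
    rw [h2, h12] at hen
    linear_combination
      (W.eval (u : ℂ) * g.eval (u : ℂ) * star (g.eval (u : ℂ)) * (-1 / 2)) * hen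
  have hD0 : D = 0 := by
    by_contra hne
    have h1 := natDegree_eq_of_derivative_mul_eq hne hWmonic.ne_zero hode
    have hpos : 0 < T.card := Finset.card_pos.mpr ⟨t, ht⟩
    have h2 : (derivative g * G).natDegree ≤ 2 * T.card - 1 := by
      refine natDegree_mul_le.trans ?_
      have := natDegree_derivative_le g
      omega
    have h3 : (g * derivative G).natDegree ≤ 2 * T.card - 1 := by
      refine natDegree_mul_le.trans ?_
      have := natDegree_derivative_le G
      omega
    have := (natDegree_sub_le (derivative g * G) (g * derivative G)).trans (max_le h2 h3)
    rw [← hD] at this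
    omega
  have hgt : g.eval t = 0 := by
    rw [hg, eval_prod]
    exact Finset.prod_eq_zero ht (by simp)
  have hg't : (derivative g).eval t ≠ 0 := by
    rw [hg, ← Finset.mul_prod_erase T _ ht, derivative_mul]
    simp only [derivative_sub, derivative_X, derivative_C, sub_zero, one_mul, eval_add, eval_mul,
      eval_sub, eval_X, eval_C, sub_self, zero_mul, add_zero, eval_prod]
    exact Finset.prod_ne_zero_iff.mpr fun s hs => sub_ne_zero.mpr (Finset.ne_of_mem_erase hs).symm
  have hGt : G.eval t = 0 := by
    have := congr_arg (eval t) hD0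
    rw [hD] at this
    simpa [hgt, hg't] using this
  rw [hG, hg, Polynomial.map_prod, eval_prod, Finset.prod_eq_zero_iff] at hGt
  obtain ⟨s, hs, h⟩ := hGt
  simp only [Polynomial.map_sub, map_X, map_C, eval_sub, eval_X, eval_C, sub_eq_zero] at h
  rw [h]
  simpa using hs

lemma inv_sub_inv_sub {t z a : ℂ} (ht : t ≠ a) (hz : z ≠ a) (htz : t ≠ z) :
    ((t - a)⁻¹ - (z - a)⁻¹)⁻¹ = -(t - a) * ((t - a) * (t - z)⁻¹ - 1) := by
  have h1 := sub_ne_zero.mpr ht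
  have h2 := sub_ne_zero.mpr hz
  have h3 := sub_ne_zero.mpr htz
  have h4 : (t - a)⁻¹ - (z - a)⁻¹ = (z - t) / ((t - a) * (z - a)) := by
    field_simp
    ring
  have h5 := sub_ne_zero.mpr htz.symm
  rw [h4]
  field_simp
  ring

/-- The Bethe equations with one Bethe root at a real point `a` and no site at infinity: the
remaining Bethe roots are closed under conjugation. -/
lemma conj_mem_of_logDeriv_eq {S : Finset ℂ} {a : ℝ} (ha : (a : ℂ) ∈ S) {W : ℂ[X]}
    (hdeg : W.natDegree + 2 = 2 * S.card) (hreal : ∀ z, W.IsRoot z → ∃ y : ℝ, z = y)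
    (hS : ∀ t ∈ S, W.eval t ≠ 0)
    (hlog : ∀ t ∈ S, t ≠ a →
      (derivative W).eval t / W.eval t = 2 * ∑ s ∈ S.erase t, (t - s)⁻¹)
    {t : ℂ} (ht : t ∈ S) : star t ∈ S := by
  by_cases hta : t = a
  · rw [hta]
    simpa using ha
  have hW0 : W ≠ 0 := fun h => hS _ ha (by simp [h])
  have hsplits := IsAlgClosed.splits W
  set l := W.roots.toList with hl
  have hlen : l.length = W.natDegree := by
    rw [hl, Multiset.length_toList, hsplits.natDegree_eq_card_roots]
  have hlroot (i : Fin l.length) : W.IsRoot l[i] := by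
    have : l[i] ∈ l := List.getElem_mem _
    exact isRoot_of_mem_roots (Multiset.mem_toList.mp this)
  choose y hy using fun i => hreal _ (hlroot i)
  have hya (i : Fin l.length) : (y i : ℂ) ≠ a := fun h => hS _ ha (by
    rw [← h, ← hy]; exact hlroot i)
  have htl {s : ℂ} (hs : s ∈ S) (i : Fin l.length) : s ≠ y i := fun h => hS _ hs (by
    rw [h, ← hy]; exact hlroot i)
  have hsum {s : ℂ} (hs : s ∈ S) :
      (derivative W).eval s / W.eval s = ∑ i : Fin l.length, (s - y i)⁻¹ := by
    rw [hsplits.eval_derivative_div_eval_of_ne_zero (hS s hs)]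
    simp only [← hy, one_div, Fin.getElem_fin]
    rw [← List.sum_ofFn, List.ofFn_getElem_eq_map l fun z => (s - z)⁻¹, ← Multiset.sum_coe,
      ← Multiset.map_coe, Multiset.coe_toList]
  let T : Finset ℂ := (S.erase (a : ℂ)).image fun s => (s - a)⁻¹
  have hinj : Function.Injective fun s : ℂ => (s - a)⁻¹ := fun s s' h => by simpa using h
  have hTcard : T.card + 1 = S.card := by
    rw [Finset.card_image_of_injective _ hinj, Finset.card_erase_add_one ha]
  have hmem {s : ℂ} : (s - a)⁻¹ ∈ T ↔ s ≠ a ∧ s ∈ S := by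
    simp only [T, hinj.mem_finset_image, Finset.mem_erase]
  have key := conj_mem_of_bethe (x := fun i => (y i - a)⁻¹) (T := T) ?_ ?_ ?_ (hmem.mpr ⟨hta, ht⟩)
  · have h : star ((t - a)⁻¹) = (star t - a)⁻¹ := by simp
    rw [h, hmem] at key
    exact key.2
  · intro τ hτ i h
    obtain ⟨s, hs, rfl⟩ := Finset.mem_image.mp hτ
    push_cast at h
    exact htl (Finset.mem_of_mem_erase hs) i (hinj h)
  · rw [Fintype.card_fin]
    omega
  · intro τ hτ
    obtain ⟨s, hs, rfl⟩ := Finset.mem_image.mp hτ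
    obtain ⟨hsa, hsS⟩ := Finset.mem_erase.mp hs
    have herase : T.erase (s - a)⁻¹ =
        ((S.erase (a : ℂ)).erase s).image fun s : ℂ => (s - a)⁻¹ := by
      rw [Finset.image_erase hinj]
    have h1 : ∑ i : Fin l.length, ((s - a)⁻¹ - (((y i - a)⁻¹ : ℝ) : ℂ))⁻¹ =
        -(s - a) * ((s - a) * ∑ i : Fin l.length, (s - y i)⁻¹ - l.length) := by
      simp only [Complex.ofReal_inv, Complex.ofReal_sub, inv_sub_inv_sub hsa (hya _) (htl hsS _)]
      simp [Finset.mul_sum, Finset.sum_sub_distrib, mul_sub]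
      ring
    have h2 : ∑ r ∈ (S.erase a).erase s, ((s - a)⁻¹ - (r - a)⁻¹)⁻¹ =
        -(s - a) * ((s - a) * ∑ r ∈ (S.erase a).erase s, (s - r)⁻¹ -
          ((S.erase a).erase s).card) := by
      have : ∀ r ∈ (S.erase a).erase s, ((s - a)⁻¹ - (r - a)⁻¹)⁻¹ =
          -(s - a) * ((s - a) * (s - r)⁻¹ - 1) := fun r hr => by
        rw [Finset.mem_erase, Finset.mem_erase] at hr
        exact inv_sub_inv_sub hsa hr.2.1 hr.1.symm
      rw [Finset.sum_congr rfl this]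
      simp [Finset.mul_sum, Finset.sum_sub_distrib, mul_sub]
      ring
    have h3 : ((((S.erase a).erase s).card : ℕ) : ℂ) = l.length / 2 - 1 := by
      have h4 := Finset.card_erase_add_one hs
      have h5 := Finset.card_erase_add_one ha
      have h6 : 2 * ((S.erase a).erase s).card + 2 = l.length := by omega
      rw [← h6]
      push_cast
      ring
    have h4 := hlog s hsS hsa
    rw [hsum hsS, ← Finset.add_sum_erase _ _ (Finset.mem_erase.mpr ⟨Ne.symm hsa, ha⟩),
      Finset.erase_right_comm] at h4
    rw [potential, h1, herase, Finset.sum_image fun _ _ _ _ h => hinj h, h2, h4, h3]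
    have h5 := sub_ne_zero.mpr hsa
    field_simp
    ring

lemma exists_map_ofReal_of_map_conj {p : ℂ[X]} (hp : p.map (starRingEnd ℂ) = p) :
    ∃ r : ℝ[X], p = r.map (algebraMap ℝ ℂ) := by
  have : p ∈ lifts (algebraMap ℝ ℂ) := by
    rw [lifts_iff_coeff_lifts]
    intro n
    have h := congr_arg (fun q => q.coeff n) hp
    rw [coeff_map] at h
    exact ⟨_, (Complex.conj_eq_iff_re.mp h)⟩
  obtain ⟨r, hr⟩ := (mem_lifts _).mp this
  exact ⟨r, hr.symm⟩

lemma exists_real_of_roots_real {D : ℂ[X]} (hroots : ∀ z, D.IsRoot z → ∃ y : ℝ, z = y) :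
    ∃ r : ℝ[X], D = C D.leadingCoeff * r.map (algebraMap ℝ ℂ) := by
  obtain ⟨r, hr⟩ := exists_map_ofReal_of_map_conj (p := (D.roots.map fun z => X - C z).prod) (by
    rw [Polynomial.map_multiset_prod, Multiset.map_map]
    congr 1
    refine Multiset.map_congr rfl fun z hz => ?_
    obtain ⟨y, rfl⟩ := hroots z (isRoot_of_mem_roots hz)
    simp)
  exact ⟨r, by rw [← hr]; exact (IsAlgClosed.splits D).eq_prod_roots⟩

lemma exists_real_of_conj_mem {S : Finset ℂ} (hS : ∀ t ∈ S, star t ∈ S) :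
    ∃ r : ℝ[X], ∏ t ∈ S, (X - C t) = r.map (algebraMap ℝ ℂ) := by
  refine exists_map_ofReal_of_map_conj ?_
  rw [Polynomial.map_prod]
  refine Finset.prod_nbij' star star hS hS (by simp) (by simp) (by simp)

/-- A member of a pencil whose Wronskian has only real roots is real if it has a real root and
no root in common with the Wronskian. -/
lemma exists_real_of_wronskian {f u W : ℂ[X]} (hW : derivative f * u - f * derivative u = W)
    (hreal : ∀ z, W.IsRoot z → ∃ y : ℝ, z = y) (hdeg : W.natDegree + 2 = 2 * u.natDegree)
    {a : ℝ} (ha : u.IsRoot a) (hu : ∀ t, u.IsRoot t → W.eval t ≠ 0) :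
    ∃ r : ℝ[X], u = C u.leadingCoeff * r.map (algebraMap ℝ ℂ) := by
  have hu0 : u ≠ 0 := by
    rintro rfl
    refine hu a ha ?_
    rw [← hW]
    simp
  have hsplits := IsAlgClosed.splits u
  have hu' {t : ℂ} (ht : u.IsRoot t) : (derivative u).eval t ≠ 0 := fun h => hu t ht (by
    rw [← hW]
    simp [h, ht.eq_zero])
  have hnodup : u.roots.Nodup := by
    refine Multiset.nodup_iff_count_le_one.mpr fun t => ?_
    rw [count_roots]
    by_contra! h
    have := (one_lt_rootMultiplicity_iff_isRoot hu0).mp h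
    exact hu' this.1 this.2
  set S := u.roots.toFinset with hS
  have hmem {t : ℂ} : t ∈ S ↔ u.IsRoot t := by rw [hS, Multiset.mem_toFinset, mem_roots hu0]
  have hcard : S.card = u.natDegree := by
    rw [hS, Multiset.toFinset_card_of_nodup hnodup, hsplits.natDegree_eq_card_roots]
  have hprod : u = C u.leadingCoeff * ∏ t ∈ S, (X - C t) := by
    conv_lhs => rw [hsplits.eq_prod_roots]
    rw [hS, Finset.prod_multiset_map_count]
    congr 1
    refine Finset.prod_congr rfl fun t ht => ?_
    rw [Multiset.count_eq_one_of_mem hnodup (Multiset.mem_toFinset.mp ht), pow_one]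
  have hclosed : ∀ t ∈ S, star t ∈ S := by
    intro t ht
    refine conj_mem_of_logDeriv_eq (hmem.mpr ha) (by rw [hcard, hdeg]) hreal
      (fun t ht => hu t (hmem.mp ht)) (fun t ht _ => ?_) ht
    have hroot := hmem.mp ht
    set q := C u.leadingCoeff * ∏ s ∈ S.erase t, (X - C s) with hq
    have huq : u = (X - C t) * q := by
      rw [hq, mul_left_comm, Finset.mul_prod_erase S (fun s => X - C s) ht, ← hprod]
    have hd1 : (derivative u).eval t = q.eval t := by
      rw [huq]
      simp
    have hd2 : (derivative (derivative u)).eval t = 2 * (derivative q).eval t := by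
      rw [huq]
      simp
      ring
    have hq' : (derivative q).eval t = q.eval t * ∑ s ∈ S.erase t, (t - s)⁻¹ := by
      have := (eval_derivative_prod_X_sub_C (S.erase t) id (u := t)
        fun s hs => (Finset.ne_of_mem_erase hs).symm).1
      simp only [id] at this
      rw [hq, derivative_C_mul, eval_mul, this, eval_mul, mul_assoc]
    have hWt := congr_arg (eval t) hW
    have hW't := congr_arg (fun p => (derivative p).eval t) hW
    simp only [derivative_sub, derivative_mul, eval_sub, eval_add, eval_mul, hroot.eq_zero, hd2,
      hd1, hq'] at hWt hW't
    rw [div_eq_iff (hu t hroot), ← hWt, ← hW't]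
    ring
  obtain ⟨r, hr⟩ := exists_real_of_conj_mem hclosed
  exact ⟨r, by rw [← hr]; exact hprod⟩


/-- A pencil of polynomials of different degrees whose Wronskian has maximal degree and only real
roots contains a real member in general position. -/
lemma exists_real_combination_of_isCoprime {f g : ℂ[X]} (hcop : IsCoprime f g)
    (hdeg : f.natDegree ≠ g.natDegree)
    (hW : (derivative f * g - f * derivative g).natDegree + 2 = 2 * max f.natDegree g.natDegree)
    (hW0 : derivative f * g - f * derivative g ≠ 0)
    (hreal : ∀ z, (derivative f * g - f * derivative g).IsRoot z → ∃ y : ℝ, z = y) :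
    ∃ (α β l : ℂ) (r : ℝ[X]), α ≠ 0 ∧ β ≠ 0 ∧ l ≠ 0 ∧
      C α * f + C β * g = C l * r.map (algebraMap ℝ ℂ) := by
  set W := derivative f * g - f * derivative g with hWdef
  have hf0 : f ≠ 0 := by
    intro h
    simp [hWdef, h] at hW0
  have hg0 : g ≠ 0 := by
    intro h
    simp [hWdef, h] at hW0
  let pencil (z : ℂ) : ℂ[X] := C (g.eval z) * f - C (f.eval z) * g
  have hpencil (z : ℂ) : pencil z ≠ 0 := by
    intro h
    have h1 : C (g.eval z) * f = C (f.eval z) * g := sub_eq_zero.mp h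
    have h2 : C (g.eval z) * derivative f = C (f.eval z) * derivative g := by
      simpa using congr_arg derivative h1
    have hg : C (g.eval z) * W = 0 := by
      rw [hWdef]
      linear_combination g * h2 - derivative g * h1
    have hf : C (f.eval z) * W = 0 := by
      rw [hWdef]
      linear_combination f * h2 - derivative f * h1
    have hgz : g.eval z = 0 := by simpa [hW0] using hg
    have hfz : f.eval z = 0 := by simpa [hW0] using hf
    obtain ⟨a, b, hab⟩ := hcop
    simpa [hfz, hgz] using congr_arg (eval z) hab
  let bad : ℂ[X] := f * g * (W * ∏ z ∈ W.roots.toFinset, pencil z)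
  have hbad : bad ≠ 0 := mul_ne_zero (mul_ne_zero hf0 hg0)
    (mul_ne_zero hW0 (Finset.prod_ne_zero_iff.mpr fun z _ => hpencil z))
  obtain ⟨a, ha⟩ : ∃ a : ℝ, bad.eval (a : ℂ) ≠ 0 := by
    by_contra! h
    refine hbad (eq_zero_of_infinite_isRoot _ ?_)
    refine (Set.infinite_range_of_injective Complex.ofReal_injective).mono ?_
    rintro _ ⟨a, rfl⟩
    exact h a
  simp only [bad, eval_mul, eval_prod, mul_ne_zero_iff, Finset.prod_ne_zero_iff] at ha
  obtain ⟨⟨hfa, hga⟩, hWa, hpa⟩ := ha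
  set u := pencil a with hu
  have hfdeg : (C (g.eval (a : ℂ)) * f).natDegree = f.natDegree := natDegree_C_mul hga
  have hgdeg : (C (f.eval (a : ℂ)) * g).natDegree = g.natDegree := natDegree_C_mul hfa
  have hudeg : u.natDegree = max f.natDegree g.natDegree := by
    rcases hdeg.lt_or_gt with h | h
    · rw [hu, natDegree_sub_eq_right_of_natDegree_lt (by rw [hfdeg, hgdeg]; exact h), hgdeg,
        max_eq_right h.le]
    · rw [hu, natDegree_sub_eq_left_of_natDegree_lt (by rw [hfdeg, hgdeg]; exact h), hfdeg,
        max_eq_left h.le]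
  have hwr : derivative f * u - f * derivative u = C (-f.eval (a : ℂ)) * W := by
    simp only [hu, pencil, hWdef, derivative_sub, derivative_C_mul, C_neg]
    ring
  have hroot {z : ℂ} : (C (-f.eval (a : ℂ)) * W).IsRoot z ↔ W.IsRoot z := by
    simp [IsRoot, hfa]
  obtain ⟨r, hr⟩ := exists_real_of_wronskian hwr (fun z hz => hreal z (hroot.mp hz))
    (by rw [natDegree_C_mul (neg_ne_zero.mpr hfa), hW, hudeg]) (a := a)
    (by simp [hu, pencil, IsRoot, mul_comm]) (fun t ht hWt => by
      refine hpa t (Multiset.mem_toFinset.mpr ((mem_roots hW0).mpr (hroot.mp hWt))) ?_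
      have : u.eval t = 0 := ht
      simp only [hu, pencil, eval_sub, eval_mul, eval_C] at this ⊢
      linear_combination -this)
  refine ⟨g.eval (a : ℂ), -f.eval (a : ℂ), u.leadingCoeff, r, hga, neg_ne_zero.mpr hfa,
    leadingCoeff_ne_zero.mpr (hpencil a), ?_⟩
  rw [← hr, hu]
  simp only [pencil, C_neg]
  ring

lemma exists_real_combination {f g : ℂ[X]} (hdeg : f.natDegree ≠ g.natDegree)
    (hW : (derivative f * g - f * derivative g).natDegree + 2 = 2 * max f.natDegree g.natDegree)
    (hW0 : derivative f * g - f * derivative g ≠ 0)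
    (hreal : ∀ z, (derivative f * g - f * derivative g).IsRoot z → ∃ y : ℝ, z = y) :
    ∃ (α β : ℂ) (r : ℝ[X]), α ≠ 0 ∧ β ≠ 0 ∧ C α * f + C β * g = r.map (algebraMap ℝ ℂ) := by
  classical
  have hf0 : f ≠ 0 := by
    intro h
    simp [h] at hW0
  have hg0 : g ≠ 0 := by
    intro h
    simp [h] at hW0
  obtain ⟨D, f₁, g₁, hcop, hf, hg⟩ : ∃ D f₁ g₁ : ℂ[X], IsCoprime f₁ g₁ ∧
      f = D * f₁ ∧ g = D * g₁ := by
    have hD : EuclideanDomain.gcd f g ≠ 0 := fun h => hf0 (EuclideanDomain.gcd_eq_zero_iff.mp h).1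
    obtain ⟨f₁, hf⟩ := EuclideanDomain.gcd_dvd_left f g
    obtain ⟨g₁, hg⟩ := EuclideanDomain.gcd_dvd_right f g
    refine ⟨_, f₁, g₁, ⟨EuclideanDomain.gcdA f g, EuclideanDomain.gcdB f g, ?_⟩, hf, hg⟩
    refine mul_left_cancel₀ hD ?_
    linear_combination (-EuclideanDomain.gcdA f g) * hf - EuclideanDomain.gcdB f g * hg -
      EuclideanDomain.gcd_eq_gcd_ab f g
  have hWeq : derivative f * g - f * derivative g =
      D ^ 2 * (derivative f₁ * g₁ - f₁ * derivative g₁) := by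
    rw [hf, hg]
    simp only [derivative_mul]
    ring
  rw [hWeq] at hW hW0 hreal
  obtain ⟨hD2, hW₁⟩ := mul_ne_zero_iff.mp hW0
  have hD : D ≠ 0 := fun h => hD2 (by simp [h])
  have hf₁ : f₁ ≠ 0 := by
    rintro rfl
    simp at hW₁
  have hg₁ : g₁ ≠ 0 := by
    rintro rfl
    simp at hW₁
  have hfd : f.natDegree = D.natDegree + f₁.natDegree := by rw [hf, natDegree_mul hD hf₁]
  have hgd : g.natDegree = D.natDegree + g₁.natDegree := by rw [hg, natDegree_mul hD hg₁]
  rw [natDegree_mul hD2 hW₁, natDegree_pow] at hW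
  obtain ⟨α, β, l, r, hα, hβ, hl, hr⟩ := exists_real_combination_of_isCoprime hcop (by omega)
    (by omega) hW₁ fun z hz => hreal z (by simp [IsRoot, hz.eq_zero])
  obtain ⟨d, hd⟩ := exists_real_of_roots_real (D := D) fun z hz =>
    hreal z (by simp [IsRoot, hz.eq_zero])
  have hlc := leadingCoeff_ne_zero.mpr hD
  have hc : D.leadingCoeff * l ≠ 0 := mul_ne_zero hlc hl
  refine ⟨(D.leadingCoeff * l)⁻¹ * α, (D.leadingCoeff * l)⁻¹ * β, d * r,
    mul_ne_zero (inv_ne_zero hc) hα, mul_ne_zero (inv_ne_zero hc) hβ, ?_⟩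
  have hCc : C (D.leadingCoeff * l)⁻¹ * (C D.leadingCoeff * C l) = 1 := by
    rw [← C_mul, ← C_mul, inv_mul_cancel₀ hc, C_1]
  rw [Polynomial.map_mul, hf, hg, C_mul, C_mul]
  calc _ = C (D.leadingCoeff * l)⁻¹ * (D * (C α * f₁ + C β * g₁)) := by ring
    _ = C (D.leadingCoeff * l)⁻¹ * (C D.leadingCoeff * d.map (algebraMap ℝ ℂ) *
        (C l * r.map (algebraMap ℝ ℂ))) := by rw [hr, ← hd]
    _ = _ := by linear_combination d.map (algebraMap ℝ ℂ) * r.map (algebraMap ℝ ℂ) * hCc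

lemma natDegree_half_wronskian {P Q : ℂ[X]} (hP : P ≠ 0) (hQ : Q ≠ 0) :
    (X * (derivative P * Q - P * derivative Q) + C (1 / 2 : ℂ) * (P * Q)).natDegree =
      P.natDegree + Q.natDegree := by
  have hform : X * (derivative P * Q - P * derivative Q) + C (1 / 2 : ℂ) * (P * Q) =
      (X * derivative P) * Q - P * (X * derivative Q) + C (1 / 2 : ℂ) * (P * Q) := by ring
  have hPX := natDegree_X_mul_derivative_le P
  have hQX := natDegree_X_mul_derivative_le Q
  rw [hform]
  refine natDegree_eq_of_le_of_coeff_ne_zero ?_ ?_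
  · refine natDegree_add_le_of_degree_le ((natDegree_sub_le _ _).trans (max_le ?_ ?_)) ?_
    · exact natDegree_mul_le.trans (by omega)
    · exact natDegree_mul_le.trans (by omega)
    · exact (natDegree_C_mul_le _ _).trans natDegree_mul_le
  · rw [coeff_add, coeff_sub, coeff_C_mul, coeff_mul_add_eq_of_natDegree_le hPX le_rfl,
      coeff_mul_add_eq_of_natDegree_le le_rfl hQX, coeff_mul_add_eq_of_natDegree_le le_rfl le_rfl,
      coeff_X_mul_derivative, coeff_X_mul_derivative, coeff_natDegree, coeff_natDegree]
    have hne := mul_ne_zero (leadingCoeff_ne_zero.mpr hP) (leadingCoeff_ne_zero.mpr hQ)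
    have h : (P.natDegree - Q.natDegree + 1 / 2 : ℂ) ≠ 0 := by
      intro h
      have h2 : ((2 * P.natDegree + 1 : ℕ) : ℂ) = (2 * Q.natDegree : ℕ) := by
        push_cast
        linear_combination 2 * h
      have := Nat.cast_injective h2
      omega
    intro h0
    exact mul_ne_zero h hne (by linear_combination h0)

/-- Proposition (reality of preimages for `α = 1/2`): if `R` is a real
polynomial of degree `p + q` (with `p = q` or `q = p + 1`) all of whose roots
are real and non-negative, then every projective solution `(P, Q)` of
`z(P'Q - PQ') + (1/2)PQ = c·R` consists of polynomials with real
coefficients up to scalar multiples. -/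
theorem W_half_preimages_real (p q : ℕ) (hpq : q = p ∨ q = p + 1)
    (R : Polynomial ℝ) (hdeg : R.degree = (p + q : ℕ))
    (hroots : ∀ z : ℂ, (R.map (algebraMap ℝ ℂ)).IsRoot z → ∃ x : ℝ, 0 ≤ x ∧ z = x)
    (P Q : Polynomial ℂ) (hP : P ≠ 0) (hQ : Q ≠ 0)
    (hdp : P.natDegree ≤ p) (hdq : Q.natDegree ≤ q)
    (c : ℂ) (hc : c ≠ 0)
    (heq : X * (derivative P * Q - P * derivative Q) + C (1 / 2 : ℂ) * (P * Q)
      = C c * R.map (algebraMap ℝ ℂ)) :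
    ∃ (lP lQ : ℂ) (P₀ Q₀ : Polynomial ℝ), lP ≠ 0 ∧ lQ ≠ 0 ∧
      P = C lP * P₀.map (algebraMap ℝ ℂ) ∧ Q = C lQ * Q₀.map (algebraMap ℝ ℂ) := by
  have hR0 : R ≠ 0 := by
    rintro rfl
    exact WithBot.bot_ne_coe (degree_zero.symm.trans hdeg)
  have hRdeg : R.natDegree = p + q := natDegree_eq_of_degree_eq_some hdeg
  have hdegs := natDegree_half_wronskian hP hQ
  rw [heq, natDegree_C_mul hc, natDegree_map, hRdeg] at hdegs
  set f : ℂ[X] := X * expand ℂ 2 P with hf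
  set g : ℂ[X] := expand ℂ 2 Q with hg
  have hW : derivative f * g - f * derivative g =
      expand ℂ 2 (C (2 * c) * R.map (algebraMap ℝ ℂ)) := by
    have h := congr_arg (expand ℂ 2) heq
    have hhalf : (C (1 / 2 : ℂ) : ℂ[X]) * 2 = 1 := by
      rw [show (2 : ℂ[X]) = C 2 from rfl, ← C_mul]
      norm_num
    simp only [map_add, map_sub, map_mul, expand_X, expand_C] at h
    simp only [hf, hg, derivative_mul, derivative_X, derivative_expand, map_mul, expand_C,
      Nat.cast_ofNat]
    rw [show (C 2 : ℂ[X]) = 2 from rfl]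
    linear_combination 2 * h - expand ℂ 2 P * expand ℂ 2 Q * hhalf
  have hfdeg : f.natDegree = 2 * p + 1 := by
    rw [hf, natDegree_X_mul ((expand_ne_zero two_pos).mpr hP), natDegree_expand]
    omega
  have hgdeg : g.natDegree = 2 * q := by
    rw [hg, natDegree_expand]
    omega
  have hRC : C (2 * c) * R.map (algebraMap ℝ ℂ) ≠ 0 :=
    mul_ne_zero (C_ne_zero.mpr (mul_ne_zero two_ne_zero hc))
      ((Polynomial.map_ne_zero_iff (algebraMap ℝ ℂ).injective).mpr hR0)
  obtain ⟨α, β, r, hα, hβ, hr⟩ := exists_real_combination (f := f) (g := g) (by omega)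
    (by
      rw [hW, natDegree_expand, natDegree_C_mul (mul_ne_zero two_ne_zero hc), natDegree_map, hRdeg,
        hfdeg, hgdeg]
      omega)
    (by rw [hW]; exact (expand_ne_zero two_pos).mpr hRC)
    (by
      intro z hz
      rw [hW, IsRoot, expand_eval, eval_mul, eval_C, mul_eq_zero] at hz
      obtain ⟨x, hx, hzx⟩ := hroots (z ^ 2) (hz.resolve_left (mul_ne_zero two_ne_zero hc))
      have hsq : z ^ 2 = ((√x : ℝ) : ℂ) ^ 2 := by
        rw [hzx, ← Complex.ofReal_pow, Real.sq_sqrt hx]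
      rcases sq_eq_sq_iff_eq_or_eq_neg.mp hsq with h | h
      · exact ⟨_, h⟩
      · exact ⟨-√x, by rw [h, Complex.ofReal_neg]⟩)
  refine ⟨α⁻¹, β⁻¹, contract 2 (divX r), contract 2 r, inv_ne_zero hα, inv_ne_zero hβ, ?_, ?_⟩
  · ext n
    have h := congr_arg (fun s => s.coeff (n * 2 + 1)) hr
    have hodd : ¬ 2 ∣ n * 2 + 1 := by omega
    simp only [hf, hg, coeff_add, coeff_C_mul, coeff_X_mul, coeff_expand_mul two_pos,
      coeff_expand two_pos, hodd, if_false, mul_zero, add_zero, coeff_map] at h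
    rw [coeff_C_mul, coeff_map, coeff_contract two_ne_zero, coeff_divX, ← h,
      inv_mul_cancel_left₀ hα]
  · ext n
    have h := congr_arg (fun s => s.coeff (n * 2)) hr
    have hX : (X * expand ℂ 2 P).coeff (n * 2) = 0 := by
      cases n with
      | zero => simp
      | succ n =>
        rw [show (n + 1) * 2 = (n * 2 + 1) + 1 by ring, coeff_X_mul, coeff_expand two_pos,
          if_neg (by omega)]
    simp only [hf, hg, coeff_add, coeff_C_mul, hX, coeff_expand_mul two_pos, mul_zero, zero_add,
      coeff_map] at h
    rw [coeff_C_mul, coeff_map, coeff_contract two_ne_zero, ← h, inv_mul_cancel_left₀ hβ]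
end
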